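/- arXiv:2512.10645 — 9 statements merged into one kernel-verified Lean document; each statement's English description precedes it below -/
import Mathlib

section
/- Let m ∈ ℕ and X, Y, Z ∈ M_m. Then (cos φ)·X + (sin φ)·Y + Z ∈ 𝒰_m for all φ ∈ ℝ if and only if X*X = Y*Y = I_m − Z*Z and Re(X*Y) = Re(X*Z) = Re(Y*Z) = 0. -/
open Matrix Kronecker

/-- `Mat m` is the space of `m × m` complex matrices. -/
abbrev Mat (m : ℕ) : Type := Matrix (Fin m) (Fin m) ℂ

/-- The "real part" `(A + A*)/2` of a square complex matrix. -/
noncomputable def MRe {m : ℕ} (A : Mat m) : Mat m := (2⁻¹ : ℂ) • (A + Aᴴ)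

/-- The real vector space `ℋ_m` of `m × m` complex hermitian matrices,
as a real submodule of `Mat m`. -/
noncomputable def HermS (m : ℕ) : Submodule ℝ (Mat m) where
  carrier := {A | A.IsHermitian}
  add_mem' := fun ha hb => ha.add hb
  zero_mem' := Matrix.isHermitian_zero
  smul_mem' := fun r A hA => by
    simpa [Matrix.IsHermitian, Matrix.conjTranspose_smul] using congrArg (r • ·) hA

/-- The real vector space `ℋ_m^0` of trace-zero `m × m` complex hermitian matrices,
as a real submodule of `Mat m`. -/
noncomputable def H0S (m : ℕ) : Submodule ℝ (Mat m) where
  carrier := {A | A.IsHermitian ∧ A.trace = 0}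
  add_mem' := fun ha hb => ⟨ha.1.add hb.1, by simp [Matrix.trace_add, ha.2, hb.2]⟩
  zero_mem' := ⟨Matrix.isHermitian_zero, by simp⟩
  smul_mem' := fun r A hA => ⟨by
    simpa [Matrix.IsHermitian, Matrix.conjTranspose_smul] using congrArg (r • ·) hA.1,
    by simp [Matrix.trace_smul, hA.2]⟩

/-- Transport a square matrix along an equality of sizes. -/
def castM {a b : ℕ} (h : a = b) (A : Mat a) : Mat b :=
  Matrix.reindex (finCongr h) (finCongr h) A

/-- A `2 × 2` block matrix with blocks of sizes `a` and `b`. -/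
def blks {a b : ℕ} (A : Matrix (Fin a) (Fin a) ℂ) (B : Matrix (Fin a) (Fin b) ℂ)
    (C : Matrix (Fin b) (Fin a) ℂ) (D : Matrix (Fin b) (Fin b) ℂ) : Mat (a + b) :=
  Matrix.reindex finSumFinEquiv finSumFinEquiv (Matrix.fromBlocks A B C D)

/-- The direct (block-diagonal) sum `A ⊕ B` of square matrices. -/
def dsum {a b : ℕ} (A : Mat a) (B : Mat b) : Mat (a + b) := blks A 0 0 B

/-- The Kronecker product of complex matrices, with `Fin`-indexing. -/
def kron {a b c d : ℕ} (A : Matrix (Fin a) (Fin b) ℂ) (B : Matrix (Fin c) (Fin d) ℂ) :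
    Matrix (Fin (a * c)) (Fin (b * d)) ℂ :=
  Matrix.reindex finProdFinEquiv finProdFinEquiv (A ⊗ₖ B)

/-- Iterated direct (block-diagonal) sum `A 0 ⊕ A 1 ⊕ ⋯ ⊕ A (r-1)` of square matrices
of sizes `m 0, …, m (r-1)`. -/
def bdiag : {r : ℕ} → (m : Fin r → ℕ) → ((j : Fin r) → Mat (m j)) → Mat (∑ j, m j)
  | 0, _, _ => 0
  | _+1, m, A =>
      castM (Fin.sum_univ_succ m).symm
        (dsum (A 0) (bdiag (fun j => m j.succ) (fun j => A j.succ)))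


theorem expand7 {m : ℕ} (X Y Z : Mat m) (c s : ℝ) :
    ((c : ℂ) • X + (s : ℂ) • Y + Z)ᴴ * ((c : ℂ) • X + (s : ℂ) • Y + Z) =
    ((c : ℂ) * c) • (Xᴴ * X) + ((s : ℂ) * s) • (Yᴴ * Y) + Zᴴ * Z
      + ((c : ℂ) * s) • (Xᴴ * Y + Yᴴ * X) + (c : ℂ) • (Xᴴ * Z + Zᴴ * X)
      + (s : ℂ) • (Yᴴ * Z + Zᴴ * Y) := by
  simp only [conjTranspose_add, conjTranspose_smul, Complex.star_def, Complex.conj_ofReal,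
    add_mul, mul_add, smul_mul_assoc, mul_smul_comm, smul_add, smul_smul]
  rw [mul_comm (s : ℂ) (c : ℂ)]
  abel

theorem mre7 {m : ℕ} (X Y : Mat m) : MRe (Xᴴ * Y) = 0 ↔ Xᴴ * Y + Yᴴ * X = 0 := by
  rw [MRe, conjTranspose_mul, conjTranspose_conjTranspose, smul_eq_zero_iff_right (by norm_num)]

/-- Lemma `prva`. -/
theorem stmt7 (m : ℕ) (hm : 0 < m) (X Y Z : Mat m) :
    (∀ θ : ℝ, (Real.cos θ : ℂ) • X + (Real.sin θ : ℂ) • Y + Z ∈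
        Matrix.unitaryGroup (Fin m) ℂ) ↔
    (Xᴴ * X = Yᴴ * Y ∧ Xᴴ * X = 1 - Zᴴ * Z ∧
      MRe (Xᴴ * Y) = 0 ∧ MRe (Xᴴ * Z) = 0 ∧ MRe (Yᴴ * Z) = 0) := by
  simp only [mem_unitaryGroup_iff', star_eq_conjTranspose, mre7, expand7]
  generalize Xᴴ * X = A
  generalize Yᴴ * Y = B
  generalize Zᴴ * Z = C
  generalize Xᴴ * Y + Yᴴ * X = P
  generalize Xᴴ * Z + Zᴴ * X = Q
  generalize Yᴴ * Z + Zᴴ * Y = R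
  constructor
  · intro h
    have h0 := h 0
    have h1 := h Real.pi
    have h2 := h (Real.pi / 2)
    have h3 := h (-(Real.pi / 2))
    have h4 := h (Real.pi / 4)
    simp only [Real.cos_zero, Real.sin_zero, Real.cos_pi, Real.sin_pi, Real.cos_pi_div_two,
      Real.sin_pi_div_two, Real.cos_neg, Real.sin_neg, Complex.ofReal_zero, Complex.ofReal_one,
      Complex.ofReal_neg, mul_zero, zero_mul, mul_one, zero_smul, one_smul, neg_smul, neg_mul_neg,
      add_zero, zero_add] at h0 h1 h2 h3
    have hQ : Q = 0 := by
      ext i j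
      have e0 := congrArg (fun M : Mat m => M i j) h0
      have e1 := congrArg (fun M : Mat m => M i j) h1
      simp only [Matrix.add_apply, Matrix.neg_apply, Matrix.zero_apply] at *
      linear_combination (e0 - e1) / 2
    have hR : R = 0 := by
      ext i j
      have e0 := congrArg (fun M : Mat m => M i j) h2
      have e1 := congrArg (fun M : Mat m => M i j) h3
      simp only [Matrix.add_apply, Matrix.neg_apply, Matrix.zero_apply] at *
      linear_combination (e0 - e1) / 2
    subst hQ hR
    have hA : A = 1 - C := by rw [← h0]; abel
    have hB : B = 1 - C := by rw [← h2]; abel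
    refine ⟨hA.trans hB.symm, hA, ?_, rfl, rfl⟩
    have hc : ((Real.cos (Real.pi / 4) : ℝ) : ℂ) * ((Real.cos (Real.pi / 4) : ℝ) : ℂ) = 1 / 2 := by
      rw [← Complex.ofReal_mul, Real.cos_pi_div_four]
      have : √2 / 2 * (√2 / 2) = (1 / 2 : ℝ) := by
        nlinarith [Real.mul_self_sqrt (show (0 : ℝ) ≤ 2 by norm_num)]
      rw [this]; norm_num
    have hs : Real.sin (Real.pi / 4) = Real.cos (Real.pi / 4) := by
      rw [Real.cos_pi_div_four, Real.sin_pi_div_four]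
    rw [hs, hc, hA, hB] at h4
    ext i j
    have e := congrArg (fun M : Mat m => M i j) h4
    simp only [Matrix.add_apply, Matrix.sub_apply, Matrix.smul_apply, Matrix.zero_apply, smul_eq_mul] at *
    linear_combination 2 * e
  · rintro ⟨hAB, hA, rfl, rfl, rfl⟩ θ
    have hcs : (Real.cos θ : ℂ) * Real.cos θ + Real.sin θ * Real.sin θ = 1 := by
      have := Real.cos_sq_add_sin_sq θ
      rw [← Complex.ofReal_mul, ← Complex.ofReal_mul, ← Complex.ofReal_add, ← sq, ← sq, this,
        Complex.ofReal_one]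
    rw [← hAB, ← add_smul, hcs, hA]
    simp
end

section
/- Let m, n ∈ ℕ, let ℳ ⊆ M_m be a real vector subspace, and let φ : ℳ → M_n be a real-linear map such that φ(ℳ ∩ 𝒰_m) ⊆ 𝒰_n. Then for all U, V ∈ ℳ ∩ 𝒰_m: if Re(U*V) = 0_m then Re(φ(U)*φ(V)) = 0_n. -/
open Matrix Kronecker

theorem aux_unit {k : ℕ} (A B : Mat k) (hA : A ∈ Matrix.unitaryGroup (Fin k) ℂ)
    (hB : B ∈ Matrix.unitaryGroup (Fin k) ℂ) :
    ((3/5 : ℝ) • A + (4/5 : ℝ) • B) ∈ Matrix.unitaryGroup (Fin k) ℂ ↔ MRe (Aᴴ * B) = 0 := by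
  rw [Matrix.mem_unitaryGroup_iff', Matrix.star_eq_conjTranspose] at *
  have key : ((3/5 : ℝ) • A + (4/5 : ℝ) • B)ᴴ * ((3/5 : ℝ) • A + (4/5 : ℝ) • B)
      = 1 + (24/25 : ℝ) • MRe (Aᴴ * B) := by
    have h1 : MRe (Aᴴ * B) = (2⁻¹ : ℝ) • (Aᴴ * B + Bᴴ * A) := by
      ext i j
      simp [MRe, Matrix.conjTranspose_mul]
      ring
    rw [h1]
    simp only [Matrix.conjTranspose_add, Matrix.conjTranspose_smul, star_trivial, add_mul, mul_add,
      smul_mul_assoc, mul_smul_comm, hA, hB]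
    module
  rw [key]
  simp

/-- Corollary `phk`. -/
theorem stmt8 (m n : ℕ) (hm : 0 < m) (hn : 0 < n)
    (M : Submodule ℝ (Mat m)) (φ : M → Mat n) (hlin : IsLinearMap ℝ φ)
    (hu : ∀ A : M, (A : Mat m) ∈ Matrix.unitaryGroup (Fin m) ℂ →
      φ A ∈ Matrix.unitaryGroup (Fin n) ℂ) :
    ∀ U V : M, (U : Mat m) ∈ Matrix.unitaryGroup (Fin m) ℂ →
      (V : Mat m) ∈ Matrix.unitaryGroup (Fin m) ℂ →
      MRe ((U : Mat m)ᴴ * (V : Mat m)) = 0 → MRe ((φ U)ᴴ * (φ V)) = 0 := by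
  intro U V hU hV h
  have hW := hu ((3/5 : ℝ) • U + (4/5 : ℝ) • V) (by
    simpa using (aux_unit (U : Mat m) (V : Mat m) hU hV).2 h)
  rw [hlin.map_add, hlin.map_smul, hlin.map_smul] at hW
  exact (aux_unit _ _ (hu U hU) (hu V hV)).1 hW
end

section
/- Let m, n ∈ ℕ and let A, B be complex matrices with 2n rows and 2m columns. If A(H ⊗ I_m) = (H ⊗ I_n)B for every trace-zero hermitian unitary 2×2 matrix H ∈ I(ℋ_2^0), then A = B = I_2 ⊗ T for some n×m complex matrix T (identifying a (2n)×(2m) matrix with a 2×2 block matrix of n×m blocks, so that I_2 ⊗ T is the block-diagonal matrix with both diagonal blocks equal to T). -/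
open Matrix Kronecker

theorem kron_entry {m n : ℕ} (A B : Matrix (Fin (2 * n)) (Fin (2 * m)) ℂ) (H : Mat 2)
    (h : A * kron H (1 : Mat m) = kron H (1 : Mat n) * B) (p q : Fin 2) (i : Fin n) (j : Fin m) :
    ∑ k, A (finProdFinEquiv (p, i)) (finProdFinEquiv (k, j)) * H k q =
    ∑ k, H p k * B (finProdFinEquiv (k, i)) (finProdFinEquiv (q, j)) := by
  have h1 := congrFun (congrFun h (finProdFinEquiv (p, i))) (finProdFinEquiv (q, j))
  rw [Matrix.mul_apply, Matrix.mul_apply, ← finProdFinEquiv.sum_comp,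
    ← finProdFinEquiv.sum_comp, Fintype.sum_prod_type, Fintype.sum_prod_type] at h1
  simpa only [kron, Matrix.reindex_apply, Matrix.submatrix_apply, Equiv.symm_apply_apply,
    Matrix.kroneckerMap_apply, Matrix.one_apply, mul_ite, ite_mul, mul_one, mul_zero, zero_mul,
    Finset.sum_ite_eq, Finset.sum_ite_eq', Finset.mem_univ, if_true] using h1

/-- Lemma `abh`. -/
theorem stmt9 (m n : ℕ) (hm : 0 < m) (hn : 0 < n)
    (A B : Matrix (Fin (2 * n)) (Fin (2 * m)) ℂ)
    (h : ∀ H : Mat 2, H.IsHermitian → H.trace = 0 →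
      H ∈ Matrix.unitaryGroup (Fin 2) ℂ →
      A * kron H (1 : Mat m) = kron H (1 : Mat n) * B) :
    ∃ T : Matrix (Fin n) (Fin m) ℂ,
      A = kron (1 : Mat 2) T ∧ B = kron (1 : Mat 2) T := by
  have hZ := kron_entry A B _ (h !![1, 0; 0, -1]
    (by ext i j; fin_cases i <;> fin_cases j <;> simp)
    (by simp [Matrix.trace_fin_two])
    (by rw [Matrix.mem_unitaryGroup_iff]; ext i j
        fin_cases i <;> fin_cases j <;> simp [Matrix.mul_apply, Matrix.star_apply]))
  have hX := kron_entry A B _ (h !![0, 1; 1, 0]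
    (by ext i j; fin_cases i <;> fin_cases j <;> simp)
    (by simp [Matrix.trace_fin_two])
    (by rw [Matrix.mem_unitaryGroup_iff]; ext i j
        fin_cases i <;> fin_cases j <;> simp [Matrix.mul_apply, Matrix.star_apply]))
  have hY := kron_entry A B _ (h !![0, -Complex.I; Complex.I, 0]
    (by ext i j; fin_cases i <;> fin_cases j <;> simp)
    (by simp [Matrix.trace_fin_two])
    (by rw [Matrix.mem_unitaryGroup_iff]; ext i j
        fin_cases i <;> fin_cases j <;> simp [Matrix.mul_apply, Matrix.star_apply]))
  have key : ∀ i j, 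
      A (finProdFinEquiv (0, i)) (finProdFinEquiv (1, j)) = 0 ∧
      A (finProdFinEquiv (1, i)) (finProdFinEquiv (0, j)) = 0 ∧
      B (finProdFinEquiv (0, i)) (finProdFinEquiv (1, j)) = 0 ∧
      B (finProdFinEquiv (1, i)) (finProdFinEquiv (0, j)) = 0 ∧
      A (finProdFinEquiv (1, i)) (finProdFinEquiv (1, j)) =
        A (finProdFinEquiv (0, i)) (finProdFinEquiv (0, j)) ∧
      B (finProdFinEquiv (1, i)) (finProdFinEquiv (1, j)) =
        A (finProdFinEquiv (0, i)) (finProdFinEquiv (0, j)) ∧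
      B (finProdFinEquiv (0, i)) (finProdFinEquiv (0, j)) =
        A (finProdFinEquiv (0, i)) (finProdFinEquiv (0, j)) := by
    intro i j
    have z0 := hZ 0 0 i j
    have z1 := hZ 1 1 i j
    have x0 := hX 0 0 i j
    have x1 := hX 1 1 i j
    have x2 := hX 0 1 i j
    have y0 := hY 0 0 i j
    have y1 := hY 1 1 i j
    simp only [Fin.sum_univ_two, Matrix.of_apply, Matrix.cons_val', Matrix.cons_val_zero,
      Matrix.cons_val_one, Matrix.cons_val_fin_one, mul_zero, zero_mul, mul_one, one_mul,
      zero_add, add_zero] at z0 z1 x0 x1 x2 y0 y1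
    generalize A (finProdFinEquiv (0, i)) (finProdFinEquiv (0, j)) = a00 at *
    generalize A (finProdFinEquiv (0, i)) (finProdFinEquiv (1, j)) = a01 at *
    generalize A (finProdFinEquiv (1, i)) (finProdFinEquiv (0, j)) = a10 at *
    generalize A (finProdFinEquiv (1, i)) (finProdFinEquiv (1, j)) = a11 at *
    generalize B (finProdFinEquiv (0, i)) (finProdFinEquiv (0, j)) = b00 at *
    generalize B (finProdFinEquiv (0, i)) (finProdFinEquiv (1, j)) = b01 at *
    generalize B (finProdFinEquiv (1, i)) (finProdFinEquiv (0, j)) = b10 at *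
    generalize B (finProdFinEquiv (1, i)) (finProdFinEquiv (1, j)) = b11 at *
    have hI := Complex.I_mul_I
    have e0 : a01 = 0 := by
      linear_combination (-Complex.I / 2) * y0 + (1/2) * x0 + ((a01 + b10) / 2) * hI
    have e1 : a10 = 0 := by
      linear_combination (Complex.I / 2) * y1 + (1/2) * x1 + ((a10 + b01) / 2) * hI
    refine ⟨e0, e1, ?_, ?_, ?_, ?_, ?_⟩
    · linear_combination e1 - x1
    · linear_combination e0 - x0
    · linear_combination -z1 - x2
    · linear_combination -x2
    · linear_combination -z0
  refine ⟨Matrix.of fun i j => A (finProdFinEquiv (0, i)) (finProdFinEquiv (0, j)), ?_, ?_⟩ <;>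
  · ext r c
    obtain ⟨⟨p, i⟩, rfl⟩ := finProdFinEquiv.surjective r
    obtain ⟨⟨q, j⟩, rfl⟩ := finProdFinEquiv.surjective c
    obtain ⟨k1, k2, k3, k4, k5, k6, k7⟩ := key i j
    simp only [kron, Matrix.reindex_apply, Matrix.submatrix_apply, Equiv.symm_apply_apply,
      Matrix.kroneckerMap_apply]
    fin_cases p <;> fin_cases q <;> simp [k1, k2, k3, k4, k5, k6, k7]
end

section
/- Let m ∈ ℕ and let φ : ℋ_2^0 → M_m be a map. The following two statements are equivalent: (1) φ is real-linear and φ(I(ℋ_2^0)) ⊆ 𝒰_m; (2) there exist U, V ∈ 𝒰_m and n ∈ ℕ such that m = 2n and φ(A) = U(A ⊗ I_n)V for all A ∈ ℋ_2^0. -/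
open Matrix Kronecker

section helpers

theorem kron_add' {n : ℕ} (A B : Mat 2) : kron (A + B) (1 : Mat n) = kron A 1 + kron B 1 := by
  unfold kron; rw [Matrix.add_kronecker]; rfl

theorem kron_smul' {n : ℕ} (c : ℂ) (A : Mat 2) : kron (c • A) (1 : Mat n) = c • kron A 1 := by
  unfold kron; rw [Matrix.smul_kronecker]; rfl

theorem kron_rsmul' {n : ℕ} (c : ℝ) (A : Mat 2) : kron (c • A) (1 : Mat n) = c • kron A 1 := by
  unfold kron; rw [Matrix.smul_kronecker]; rfl

theorem kron_mul' {n : ℕ} (A B : Mat 2) : kron A (1 : Mat n) * kron B (1 : Mat n) = kron (A * B) (1 : Mat n) := by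
  unfold kron
  have := Matrix.mul_kronecker_mul A B (1 : Mat n) (1 : Mat n)
  rw [mul_one] at this
  rw [this]
  simp only [Matrix.reindex_apply, Matrix.submatrix_mul_equiv]

theorem kron_star' {n : ℕ} (A : Mat 2) : star (kron A (1 : Mat n)) = kron (star A) 1 := by
  unfold kron
  simp only [Matrix.star_eq_conjTranspose, Matrix.reindex_apply, Matrix.conjTranspose_submatrix,
    Matrix.conjTranspose_kronecker, Matrix.conjTranspose_one]

theorem kron_one' {n : ℕ} : kron (1 : Mat 2) (1 : Mat n) = 1 := by
  unfold kron; simp [Matrix.one_kronecker_one]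

theorem kron_unit {n : ℕ} {A : Mat 2} (h : A ∈ Matrix.unitaryGroup (Fin 2) ℂ) :
    kron A (1 : Mat n) ∈ Matrix.unitaryGroup (Fin (2 * n)) ℂ := by
  rw [Matrix.mem_unitaryGroup_iff] at *
  rw [kron_star', kron_mul', h, kron_one']

theorem castM_rfl {a : ℕ} (h : a = a) (A : Mat a) : castM h A = A := by
  unfold castM; ext i j; simp

noncomputable def sx : Mat 2 := !![0, 1; 1, 0]
noncomputable def sy : Mat 2 := !![0, -Complex.I; Complex.I, 0]
noncomputable def sz : Mat 2 := !![1, 0; 0, -1]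

theorem key {m : ℕ} (R T : Mat m) (hR : R.IsHermitian) (hT : T.IsHermitian)
    (hRR : R * R = 1) (hTT : T * T = 1) (hRT : R * T = -(T * R)) :
    ∃ (n : ℕ) (_ : m = 2 * n) (X : Matrix (Fin m) (Fin n) ℂ), Xᴴ * X = 1 ∧ R * X = X := by
  classical
  have hev : ∀ i, hR.eigenvalues i = 1 ∨ hR.eigenvalues i = -1 := by
    intro i
    have h1 := hR.mulVec_eigenvectorBasis i
    have h2 : R *ᵥ (R *ᵥ ⇑(hR.eigenvectorBasis i)) = ⇑(hR.eigenvectorBasis i) := by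
      rw [Matrix.mulVec_mulVec, hRR, Matrix.one_mulVec]
    rw [h1, Matrix.mulVec_smul, h1, smul_smul] at h2
    have hne : (⇑(hR.eigenvectorBasis i) : Fin m → ℂ) ≠ 0 := by
      intro h
      have := hR.eigenvectorBasis.orthonormal.ne_zero i
      apply this
      ext j
      exact congrFun h j
    have h3 : hR.eigenvalues i * hR.eigenvalues i = 1 := by
      obtain ⟨j, hj⟩ := Function.ne_iff.mp hne
      have := congrFun h2 j
      simp only [Pi.smul_apply, Complex.real_smul] at this
      have h4 := mul_right_cancel₀ hj (this.trans (one_mul _).symm)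
      exact_mod_cast h4
    exact mul_self_eq_one_iff.mp h3
  let s := {i // hR.eigenvalues i = 1}
  have htr : R.trace = 0 := by
    have h1 : R.trace = -R.trace := by
      calc R.trace = (R * T * T).trace := by rw [mul_assoc, hTT, mul_one]
        _ = (-(T * R) * T).trace := by rw [hRT]
        _ = -(T * R * T).trace := by rw [neg_mul, Matrix.trace_neg]
        _ = -(T * (T * R)).trace := by rw [Matrix.trace_mul_comm (T * R) T]
        _ = -R.trace := by rw [← mul_assoc, hTT, one_mul]
    exact self_eq_neg.mp h1
  have hcard : m = 2 * Fintype.card s := by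
    have h1 := hR.trace_eq_sum_eigenvalues
    rw [htr] at h1
    have h2 : ∑ i, hR.eigenvalues i = 0 := by
      have h3 := h1.symm
      simp only [Complex.coe_algebraMap] at h3
      exact_mod_cast h3
    have h3 : ∀ i, hR.eigenvalues i = 2 * (if hR.eigenvalues i = 1 then 1 else 0) - 1 := by
      intro i
      rcases hev i with h | h <;> rw [h] <;> norm_num
    rw [Finset.sum_congr rfl (fun i _ => h3 i), Finset.sum_sub_distrib, ← Finset.mul_sum,
      Finset.sum_boole] at h2
    simp only [Finset.sum_const, Finset.card_univ, Fintype.card_fin, nsmul_eq_mul, mul_one] at h2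
    have h5 : Fintype.card s = (Finset.univ.filter fun i => hR.eigenvalues i = 1).card :=
      Fintype.card_subtype _
    rw [h5]
    have h6 : (m : ℝ) = 2 * ((Finset.univ.filter fun i => hR.eigenvalues i = 1).card : ℝ) := by
      linarith
    exact_mod_cast h6
  let e := (Fintype.equivFin s).symm
  refine ⟨Fintype.card s, hcard, Matrix.of fun i k => hR.eigenvectorBasis (e k).1 i, ?_, ?_⟩
  · ext k l
    have h := (orthonormal_iff_ite.mp hR.eigenvectorBasis.orthonormal) (e k).1 (e l).1
    rw [EuclideanSpace.inner_eq_star_dotProduct] at h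
    rw [Matrix.mul_apply, Matrix.one_apply]
    have h2 : ((e k).1 = (e l).1) ↔ k = l := by
      rw [Subtype.val_inj, e.injective.eq_iff]
    simp only [h2] at h
    rw [← h]
    simp only [dotProduct, Matrix.conjTranspose_apply, Matrix.of_apply, Pi.star_apply]
    exact Finset.sum_congr rfl (fun i _ => mul_comm _ _)
  · ext i k
    have h1 := congrFun (hR.mulVec_eigenvectorBasis (e k).1) i
    rw [(e k).2, one_smul] at h1
    exact h1

theorem key2 {n : ℕ} (R T : Mat (2 * n)) (hR : R.IsHermitian) (hT : T.IsHermitian)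
    (hTT : T * T = 1) (hRT : R * T = -(T * R))
    (X : Matrix (Fin (2 * n)) (Fin n) ℂ) (hX : Xᴴ * X = 1) (hRX : R * X = X) :
    ∃ Q : Mat (2 * n), Q ∈ Matrix.unitaryGroup (Fin (2 * n)) ℂ ∧ T * Q = Q * kron sx 1 ∧
      R * Q = Q * kron sz 1 := by
  classical
  set Y := T * X with hY
  have hRY : R * Y = -Y := by
    rw [hY, ← Matrix.mul_assoc, hRT, Matrix.neg_mul, Matrix.mul_assoc, hRX]
  have hTY : T * Y = X := by rw [hY, ← Matrix.mul_assoc, hTT, Matrix.one_mul]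
  have hYY : Yᴴ * Y = 1 := by
    rw [hY, Matrix.conjTranspose_mul, hT.eq, Matrix.mul_assoc, ← hY, hTY, hX]
  have hXY : Xᴴ * Y = 0 := by
    have h1 : Xᴴ * Y = -(Xᴴ * Y) := by
      calc Xᴴ * Y = (R * X)ᴴ * Y := by rw [hRX]
        _ = Xᴴ * (R * Y) := by rw [Matrix.conjTranspose_mul, hR.eq, Matrix.mul_assoc]
        _ = _ := by rw [hRY, Matrix.mul_neg]
    ext i j
    exact self_eq_neg.mp (congrFun (congrFun h1 i) j)
  have hYX : Yᴴ * X = 0 := by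
    have := congrArg Matrix.conjTranspose hXY
    simpa using this
  let e : Fin 2 × Fin n ≃ Fin (2 * n) := finProdFinEquiv
  let Q0 : Matrix (Fin (2 * n)) (Fin 2 × Fin n) ℂ := Matrix.of fun i p => ![X i p.2, Y i p.2] p.1
  have hmul : ∀ A : Mat 2, Q0.submatrix id e.symm * kron A 1 =
      (Q0 * (A ⊗ₖ (1 : Mat n))).submatrix id e.symm := by
    intro A
    unfold kron
    rw [Matrix.reindex_apply, Matrix.submatrix_mul_equiv]
  refine ⟨Q0.submatrix id e.symm, ?_, ?_, ?_⟩
  · rw [Matrix.mem_unitaryGroup_iff', Matrix.star_eq_conjTranspose, Matrix.conjTranspose_submatrix]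
    have h1 : Q0ᴴ * Q0 = 1 := by
      ext ⟨a, k⟩ ⟨b, l⟩
      have e1 := congrFun (congrFun hX k) l
      have e2 := congrFun (congrFun hYY k) l
      have e3 := congrFun (congrFun hXY k) l
      have e4 := congrFun (congrFun hYX k) l
      simp only [Matrix.mul_apply, Matrix.conjTranspose_apply, Matrix.one_apply,
        Matrix.zero_apply] at e1 e2 e3 e4
      rw [Matrix.mul_apply, Matrix.one_apply]
      fin_cases a <;> fin_cases b <;> simp [Q0, - Complex.star_def, - RCLike.star_def, e1, e2, e3, e4]
    have h2 : Q0ᴴ.submatrix e.symm id * Q0.submatrix id e.symm = (Q0ᴴ * Q0).submatrix e.symm e.symm := by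
      rw [Matrix.submatrix_mul _ _ _ id _ Function.bijective_id]
    rw [h2, h1, Matrix.submatrix_one_equiv]
  · rw [hmul]
    have h1 : T * Q0 = Q0 * (sx ⊗ₖ (1 : Mat n)) := by
      ext i ⟨b, l⟩
      have e1 := congrFun (congrFun hY i) l
      have e2 := congrFun (congrFun hTY i) l
      simp only [Matrix.mul_apply] at e1 e2
      rw [Matrix.mul_apply, Matrix.mul_apply, Fintype.sum_prod_type]
      fin_cases b <;> simp [Q0, sx, e1, e2, Matrix.one_apply]
    rw [← h1]; rfl
  · rw [hmul]
    have h1 : R * Q0 = Q0 * (sz ⊗ₖ (1 : Mat n)) := by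
      ext i ⟨b, l⟩
      have e1 := congrFun (congrFun hRX i) l
      have e2 := congrFun (congrFun hRY i) l
      simp only [Matrix.mul_apply] at e1 e2
      rw [Matrix.mul_apply, Matrix.mul_apply, Fintype.sum_prod_type]
      fin_cases b <;> simp [Q0, sz, e1, e2, Matrix.one_apply]
    rw [← h1]; rfl

theorem sx_mem : sx ∈ H0S 2 := by
  refine ⟨?_, ?_⟩
  · ext i j; fin_cases i <;> fin_cases j <;> simp [sx]
  · simp [sx, Matrix.trace_fin_two]
theorem sy_mem : sy ∈ H0S 2 := by
  refine ⟨?_, ?_⟩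
  · ext i j; fin_cases i <;> fin_cases j <;> simp [sy]
  · simp [sy, Matrix.trace_fin_two]
theorem sz_mem : sz ∈ H0S 2 := by
  refine ⟨?_, ?_⟩
  · ext i j; fin_cases i <;> fin_cases j <;> simp [sz]
  · simp [sz, Matrix.trace_fin_two]

noncomputable def lc (a b c : ℝ) : H0S 2 :=
  a • (⟨sx, sx_mem⟩ : H0S 2) + b • (⟨sy, sy_mem⟩ : H0S 2) + c • (⟨sz, sz_mem⟩ : H0S 2)

theorem lc_coe (a b c : ℝ) : (lc a b c : Mat 2) = a • sx + b • sy + c • sz := rfl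

theorem lc_unit (a b c : ℝ) (h : a * a + b * b + c * c = 1) :
    (lc a b c : Mat 2) ∈ Matrix.unitaryGroup (Fin 2) ℂ := by
  rw [Matrix.mem_unitaryGroup_iff, lc_coe]
  have h' : (a : ℂ) * a + b * b + c * c = 1 := by exact_mod_cast h
  have hI := Complex.I_mul_I
  ext i j
  fin_cases i <;> fin_cases j <;>
    simp [sx, sy, sz, Matrix.mul_apply, Fin.sum_univ_two, Matrix.star_apply] <;> grind

theorem exists_lc (A : H0S 2) : ∃ a b c, A = lc a b c := by
  obtain ⟨A, hA, ht⟩ := A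
  refine ⟨(A 1 0).re, (A 1 0).im, (A 0 0).re, ?_⟩
  apply Subtype.ext
  rw [lc_coe]
  have h00 := hA.apply 0 0
  have h01 := hA.apply 0 1
  rw [Matrix.trace_fin_two] at ht
  have h00' : (A 0 0).im = 0 := by
    have := congrArg Complex.im h00
    simp at this; linarith
  have h11 : A 1 1 = - A 0 0 := by linear_combination ht
  ext i j
  fin_cases i <;> fin_cases j <;> apply Complex.ext <;>
    simp [sx, sy, sz, h11, h00', ← h01]

theorem unit_pair {m : ℕ} {P Q : Mat m} (hP : P * star P = 1) (hQ : Q * star Q = 1)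
    (h : ((3/5 : ℝ) • P + (4/5 : ℝ) • Q) * star ((3/5 : ℝ) • P + (4/5 : ℝ) • Q) = 1) :
    P * star Q + Q * star P = 0 := by
  have h1 : ((3/5 : ℝ) • P + (4/5 : ℝ) • Q) * star ((3/5 : ℝ) • P + (4/5 : ℝ) • Q)
      = (9/25 : ℝ) • (P * star P) + (16/25 : ℝ) • (Q * star Q) +
        (12/25 : ℝ) • (P * star Q + Q * star P) := by
    simp only [star_add, star_smul, star_trivial, add_mul, mul_add, smul_mul_assoc, mul_smul_comm]
    module
  rw [h1, hP, hQ] at h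
  have h2 : (12/25 : ℝ) • (P * star Q + Q * star P) = 0 := by
    have : (9/25 : ℝ) • (1 : Mat m) + (16/25 : ℝ) • (1 : Mat m) = 1 := by
      rw [← add_smul]; norm_num
    rw [this] at h
    simpa using h
  exact (smul_eq_zero.mp h2).resolve_left (by norm_num)

theorem unit_pair' {m : ℕ} {P Q : Mat m} (hP : P ∈ Matrix.unitaryGroup (Fin m) ℂ)
    (hQ : Q ∈ Matrix.unitaryGroup (Fin m) ℂ)
    (h : (3/5 : ℝ) • P + (4/5 : ℝ) • Q ∈ Matrix.unitaryGroup (Fin m) ℂ) :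
    P * star Q + Q * star P = 0 ∧ star P * Q + star Q * P = 0 := by
  refine ⟨unit_pair (Matrix.mem_unitaryGroup_iff.mp hP) (Matrix.mem_unitaryGroup_iff.mp hQ)
    (Matrix.mem_unitaryGroup_iff.mp h), ?_⟩
  have := unit_pair (P := star P) (Q := star Q)
    (by rw [star_star]; exact (Matrix.mem_unitaryGroup_iff'.mp hP))
    (by rw [star_star]; exact (Matrix.mem_unitaryGroup_iff'.mp hQ))
    (by
      have := Matrix.mem_unitaryGroup_iff'.mp h
      simpa only [star_add, star_smul, star_trivial, star_star] using this)
  simpa only [star_star] using this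

theorem sz_sx : sz * sz = 1 := by
  ext i j; fin_cases i <;> fin_cases j <;> simp [sz]
theorem sz_sy : sz * sy = (-Complex.I) • sx := by
  ext i j; fin_cases i <;> fin_cases j <;> simp [sz, sy, sx]

theorem fwd {m : ℕ} (X Y Z : Mat m) (hX : X ∈ Matrix.unitaryGroup (Fin m) ℂ)
    (hY : Y ∈ Matrix.unitaryGroup (Fin m) ℂ) (hZ : Z ∈ Matrix.unitaryGroup (Fin m) ℂ)
    (hxy : X * star Y + Y * star X = 0) (hxz : star X * Z + star Z * X = 0)
    (hyz : star Y * Z + star Z * Y = 0) :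
    ∃ (n : ℕ) (h : m = 2 * n) (U V : Mat m), U ∈ Matrix.unitaryGroup (Fin m) ℂ ∧
      V ∈ Matrix.unitaryGroup (Fin m) ℂ ∧ X = U * castM h.symm (kron sx 1) * V ∧
      Y = U * castM h.symm (kron sy 1) * V ∧ Z = U * castM h.symm (kron sz 1) * V := by
  have hZ1 := Matrix.mem_unitaryGroup_iff.mp hZ
  have hX1 := Matrix.mem_unitaryGroup_iff'.mp hX
  have hY1 := Matrix.mem_unitaryGroup_iff'.mp hY
  obtain ⟨B, hB⟩ : ∃ B, B = star Z * X := ⟨_, rfl⟩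
  obtain ⟨C, hC⟩ : ∃ C, C = star Z * Y := ⟨_, rfl⟩
  have hZB : Z * B = X := by rw [hB, ← mul_assoc, hZ1, one_mul]
  have hZC : Z * C = Y := by rw [hC, ← mul_assoc, hZ1, one_mul]
  have sB : star B = -B := by
    rw [hB, star_mul, star_star]; exact eq_neg_of_add_eq_zero_left hxz
  have sC : star C = -C := by
    rw [hC, star_mul, star_star]; exact eq_neg_of_add_eq_zero_left hyz
  have hBB : B * B = -1 := by
    have : star B * B = 1 := by
      rw [hB, star_mul, star_star, mul_assoc, ← mul_assoc Z, hZ1, one_mul, hX1]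
    rw [sB, neg_mul] at this
    rw [← this, neg_neg]
  have hCC : C * C = -1 := by
    have : star C * C = 1 := by
      rw [hC, star_mul, star_star, mul_assoc, ← mul_assoc Z, hZ1, one_mul, hY1]
    rw [sC, neg_mul] at this
    rw [← this, neg_neg]
  have hBC : C * B = -(B * C) := by
    have h1 : B * star C + C * star B = 0 := by
      have : B * star C + C * star B = star Z * (X * star Y + Y * star X) * Z := by
        rw [hB, hC]; simp only [star_mul, star_star]; noncomm_ring
      rw [this, hxy, mul_zero, zero_mul]
    rw [sB, sC, mul_neg, mul_neg] at h1
    rw [eq_neg_iff_add_eq_zero, add_comm]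
    have := congrArg Neg.neg h1
    simpa [add_comm] using this
  obtain ⟨R, hRdef⟩ : ∃ R, R = Complex.I • (B * C) := ⟨_, rfl⟩
  obtain ⟨T, hTdef⟩ : ∃ T, T = Complex.I • C := ⟨_, rfl⟩
  have hBCC : B * C * C = -B := by rw [mul_assoc, hCC, mul_neg, mul_one]
  have hCBC : C * (B * C) = B := by
    rw [← mul_assoc, hBC, neg_mul, hBCC, neg_neg]
  have hRT : R * T = B := by
    rw [hRdef, hTdef, smul_mul_smul_comm, Complex.I_mul_I, hBCC, neg_one_smul, neg_neg]
  have hTR : T * R = -B := by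
    rw [hRdef, hTdef, smul_mul_smul_comm, Complex.I_mul_I, hCBC, neg_one_smul]
  have hTT : T * T = 1 := by
    rw [hTdef, smul_mul_smul_comm, Complex.I_mul_I, hCC, neg_one_smul, neg_neg]
  have hRR : R * R = 1 := by
    rw [hRdef, smul_mul_smul_comm, Complex.I_mul_I, mul_assoc, hCBC, hBB, neg_one_smul, neg_neg]
  have hTh : T.IsHermitian := by
    change star T = T
    rw [hTdef, star_smul, sC]
    simp
  have hRh : R.IsHermitian := by
    change star R = R
    rw [hRdef, star_smul, star_mul, sB, sC, neg_mul_neg, hBC]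
    simp
  obtain ⟨n, hmn, X0, hX0, hRX0⟩ := key R T hRh hTh hRR hTT (by rw [hRT, hTR, neg_neg])
  subst hmn
  obtain ⟨Q, hQ, hTQ, hRQ⟩ := key2 R T hRh hTh hTT (by rw [hRT, hTR, neg_neg]) X0 hX0 hRX0
  have hszu : sz ∈ Matrix.unitaryGroup (Fin 2) ℂ := by
    have := lc_unit 0 0 1 (by norm_num)
    simpa [lc_coe] using this
  have hQ1 := Matrix.mem_unitaryGroup_iff.mp hQ
  have hC' : C = (-Complex.I) • T := by rw [hTdef, smul_smul]; simp
  refine ⟨n, rfl, Z * Q * kron sz 1, star Q, ?_, ?_, ?_, ?_, ?_⟩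
  · exact mul_mem (mul_mem hZ hQ) (kron_unit hszu)
  · exact (star (⟨Q, hQ⟩ : Matrix.unitaryGroup (Fin (2 * n)) ℂ)).2
  · rw [castM_rfl, mul_assoc Z, ← hRQ, mul_assoc Z, mul_assoc R, ← hTQ, ← mul_assoc R, hRT,
      mul_assoc, mul_assoc B, hQ1, mul_one, hZB]
  · rw [castM_rfl, mul_assoc _ (kron sz 1), kron_mul', sz_sy, kron_smul', mul_smul_comm,
      mul_assoc Z, ← hTQ, ← mul_smul_comm, ← smul_mul_assoc, ← hC', mul_assoc, mul_assoc C, hQ1,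
      mul_one, hZC]
  · rw [castM_rfl, mul_assoc (Z * Q) (kron sz 1) (kron sz 1), kron_mul', sz_sx, kron_one', mul_one, mul_assoc, hQ1,
      mul_one]

end helpers

/-- Proposition `h0u`. -/
theorem stmt10 (m : ℕ) (hm : 0 < m) (φ : H0S 2 → Mat m) :
    (IsLinearMap ℝ φ ∧ ∀ A : H0S 2, (A : Mat 2) ∈ Matrix.unitaryGroup (Fin 2) ℂ →
        φ A ∈ Matrix.unitaryGroup (Fin m) ℂ) ↔
    (∃ n : ℕ, 0 < n ∧ ∃ h : m = 2 * n, ∃ U V : Mat m,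
      U ∈ Matrix.unitaryGroup (Fin m) ℂ ∧ V ∈ Matrix.unitaryGroup (Fin m) ℂ ∧
      ∀ A : H0S 2, φ A = U * castM h.symm (kron (A : Mat 2) (1 : Mat n)) * V) := by
  constructor
  · rintro ⟨hl, hu⟩
    have hφ : ∀ a b c : ℝ, φ (lc a b c) = a • φ ⟨sx, sx_mem⟩ + b • φ ⟨sy, sy_mem⟩
        + c • φ ⟨sz, sz_mem⟩ := by
      intro a b c
      unfold lc
      rw [hl.map_add, hl.map_add, hl.map_smul, hl.map_smul, hl.map_smul]
    have hU : ∀ a b c : ℝ, a * a + b * b + c * c = 1 →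
        a • φ ⟨sx, sx_mem⟩ + b • φ ⟨sy, sy_mem⟩ + c • φ ⟨sz, sz_mem⟩
          ∈ Matrix.unitaryGroup (Fin m) ℂ := by
      intro a b c h
      rw [← hφ]
      exact hu _ (lc_unit a b c h)
    have hX := hU 1 0 0 (by norm_num)
    have hY := hU 0 1 0 (by norm_num)
    have hZ := hU 0 0 1 (by norm_num)
    have hXY := hU (3/5) (4/5) 0 (by norm_num)
    have hXZ := hU (3/5) 0 (4/5) (by norm_num)
    have hYZ := hU 0 (3/5) (4/5) (by norm_num)
    simp only [one_smul, zero_smul, add_zero, zero_add] at hX hY hZ hXY hXZ hYZ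
    obtain ⟨n, h, U, V, hU', hV, eX, eY, eZ⟩ := fwd _ _ _ hX hY hZ (unit_pair' hX hY hXY).1
      (unit_pair' hX hZ hXZ).2 (unit_pair' hY hZ hYZ).2
    refine ⟨n, by omega, h, U, V, hU', hV, ?_⟩
    intro A
    obtain ⟨a, b, c, rfl⟩ := exists_lc A
    rw [hφ, eX, eY, eZ, lc_coe]
    subst h
    simp only [castM_rfl, kron_add', kron_rsmul', mul_add, add_mul, smul_mul_assoc, mul_smul_comm]
  · rintro ⟨n, hn, h, U, V, hU, hV, hA⟩
    subst h
    simp only [castM_rfl] at hA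
    refine ⟨⟨?_, ?_⟩, ?_⟩
    · intro A B
      simp only [hA, Submodule.coe_add, kron_add', mul_add, add_mul]
    · intro c A
      simp only [hA, Submodule.coe_smul, kron_rsmul', smul_mul_assoc, mul_smul_comm]
    · intro A h
      rw [hA]
      exact mul_mem (mul_mem hU (kron_unit h)) hV
end

section
/- Let m ∈ ℕ and let φ : ℋ_2^0 → ℋ_m be a map. The following two statements are equivalent: (1) φ is real-linear and φ(I(ℋ_2^0)) ⊆ ℋ_m ∩ 𝒰_m; (2) there exist p, q ∈ ℕ ∪ {0} and U ∈ 𝒰_m such that m = 2(p+q) and φ(A) = U((A ⊗ I_p) ⊕ (−A ⊗ I_q))U* for all A ∈ ℋ_2^0, where ⊕ denotes the direct (block-diagonal) sum of matrices. -/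
open Matrix Kronecker

lemma proj_factor {m : ℕ} (P : Mat m) (hP : P.IsHermitian) (hPP : P * P = P) :
    ∃ (p : ℕ) (V : Matrix (Fin m) (Fin p) ℂ), V * Vᴴ = P ∧ Vᴴ * V = 1 := by
  classical
  let E : Matrix (Fin m) (Fin m) ℂ := (hP.eigenvectorUnitary : Matrix _ _ ℂ)
  have hE : Eᴴ * E = 1 := (Matrix.mem_unitaryGroup_iff').1 hP.eigenvectorUnitary.2
  have hE' : E * Eᴴ = 1 := (Matrix.mem_unitaryGroup_iff).1 hP.eigenvectorUnitary.2
  let d : Fin m → ℂ := fun i => (hP.eigenvalues i : ℂ)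
  have hs : P = E * diagonal d * Eᴴ := by
    have := hP.spectral_theorem
    rw [Unitary.conjStarAlgAut_apply] at this
    exact this
  have hdE : diagonal d = Eᴴ * P * E := by
    rw [hs]
    calc diagonal d = (Eᴴ * E) * diagonal d * (Eᴴ * E) := by simp [hE]
      _ = _ := by simp only [Matrix.mul_assoc]
  have hdd : diagonal d * diagonal d = diagonal d := by
    calc diagonal d * diagonal d = Eᴴ * (P * ((E * Eᴴ) * P)) * E := by
          rw [hdE]; simp only [Matrix.mul_assoc]
      _ = diagonal d := by rw [hE', Matrix.one_mul, hPP, hdE]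
  have hd : ∀ i, d i = 0 ∨ d i = 1 := by
    intro i
    have := congrFun (congrFun hdd i) i
    simp at this
    rcases eq_or_ne (d i) 0 with h | h
    · exact Or.inl h
    · exact Or.inr (mul_right_cancel₀ h (by rw [this, one_mul]))
  let S := {i : Fin m // d i = 1}
  let e : S ≃ Fin (Fintype.card S) := Fintype.equivFin S
  refine ⟨Fintype.card S, E.submatrix id (fun k => (e.symm k).1), ?_, ?_⟩
  · ext a b
    rw [hs, Matrix.mul_apply, Matrix.mul_apply]
    simp only [Matrix.conjTranspose_apply, Matrix.submatrix_apply, id, Matrix.mul_diagonal]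
    rw [Equiv.sum_comp e.symm (fun k : S => E a k.1 * star (E b k.1))]
    have : ∀ x, E a x * d x * star (E b x) = if d x = 1 then E a x * star (E b x) else 0 := by
      intro x
      rcases hd x with h | h <;> simp [h]
    simp only [this]
    rw [← Finset.sum_filter, Finset.sum_subtype (p := fun i => d i = 1)]
    · simp
  · ext a b
    have := congrFun (congrFun hE (e.symm a).1) (e.symm b).1
    simp only [Matrix.mul_apply, Matrix.conjTranspose_apply] at this
    simp only [Matrix.mul_apply, Matrix.conjTranspose_apply, Matrix.submatrix_apply, id, this]
    simp [Matrix.one_apply, Subtype.ext_iff.symm]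

/-- index equivalence -/
def bigE {p q m : ℕ} (h : 2 * p + 2 * q = m) : (Fin 2 × Fin p) ⊕ (Fin 2 × Fin q) ≃ Fin m :=
  ((Equiv.sumCongr finProdFinEquiv finProdFinEquiv).trans finSumFinEquiv).trans (finCongr h)

/-- the block matrix -/
def bigD (p q : ℕ) (A : Mat 2) :
    Matrix ((Fin 2 × Fin p) ⊕ (Fin 2 × Fin q)) ((Fin 2 × Fin p) ⊕ (Fin 2 × Fin q)) ℂ :=
  Matrix.fromBlocks (A ⊗ₖ (1 : Mat p)) 0 0 ((-A) ⊗ₖ (1 : Mat q))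

lemma cast_eq_big {p q m : ℕ} (h : 2 * p + 2 * q = m) (A : Mat 2) :
    castM h (dsum (kron A (1 : Mat p)) (kron (-A) (1 : Mat q))) =
      (bigD p q A).submatrix (bigE h).symm (bigE h).symm := by
  ext a b
  obtain ⟨a, rfl⟩ := (bigE h).surjective a
  obtain ⟨b, rfl⟩ := (bigE h).surjective b
  rcases a with a | a <;> rcases b with b | b <;>
    simp [castM, dsum, blks, kron, bigE, bigD]

lemma bigD_add (p q : ℕ) (A B : Mat 2) : bigD p q (A + B) = bigD p q A + bigD p q B := by
  ext a b
  rcases a with a | a <;> rcases b with b | b <;> simp [bigD] <;> ring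

lemma bigD_smul (p q : ℕ) (r : ℝ) (A : Mat 2) : bigD p q (r • A) = r • bigD p q A := by
  ext a b
  rcases a with a | a <;> rcases b with b | b <;> simp [bigD] <;> ring

lemma bigD_mul (p q : ℕ) (A : Mat 2) (h : A * A = 1) : bigD p q A * bigD p q A = 1 := by
  simp only [bigD, Matrix.fromBlocks_multiply, ← Matrix.mul_kronecker_mul]
  simp [h]

lemma dir1 {m : ℕ} (X Y Z : Mat m) (hX : Xᴴ = X) (hY : Yᴴ = Y) (hZ : Zᴴ = Z)
    (XX : X * X = 1) (YY : Y * Y = 1) (ZZ : Z * Z = 1)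
    (YX : Y * X = -(X * Y)) (ZX : Z * X = -(X * Z)) (ZY : Z * Y = -(Y * Z)) :
    ∃ p q : ℕ, ∃ h : 2 * p + 2 * q = m, ∃ U : Mat m, U * Uᴴ = 1 ∧
      ∀ (x y z : ℝ) (A : Mat 2), A = !![(z : ℂ), x - Complex.I * y; x + Complex.I * y, -z] →
        (x : ℂ) • X + (y : ℂ) • Y + (z : ℂ) • Z =
          U * (bigD p q A).submatrix (bigE h).symm (bigE h).symm * Uᴴ := by
  have XX' : ∀ {k : ℕ} (M : Matrix (Fin m) (Fin k) ℂ), X * (X * M) = M := by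
    intro k M; rw [← Matrix.mul_assoc, XX, Matrix.one_mul]
  have YY' : ∀ {k : ℕ} (M : Matrix (Fin m) (Fin k) ℂ), Y * (Y * M) = M := by
    intro k M; rw [← Matrix.mul_assoc, YY, Matrix.one_mul]
  have ZZ' : ∀ {k : ℕ} (M : Matrix (Fin m) (Fin k) ℂ), Z * (Z * M) = M := by
    intro k M; rw [← Matrix.mul_assoc, ZZ, Matrix.one_mul]
  have YX' : ∀ {k : ℕ} (M : Matrix (Fin m) (Fin k) ℂ), Y * (X * M) = -(X * (Y * M)) := by
    intro k M; rw [← Matrix.mul_assoc, YX, Matrix.neg_mul, Matrix.mul_assoc]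
  have ZX' : ∀ {k : ℕ} (M : Matrix (Fin m) (Fin k) ℂ), Z * (X * M) = -(X * (Z * M)) := by
    intro k M; rw [← Matrix.mul_assoc, ZX, Matrix.neg_mul, Matrix.mul_assoc]
  have ZY' : ∀ {k : ℕ} (M : Matrix (Fin m) (Fin k) ℂ), Z * (Y * M) = -(Y * (Z * M)) := by
    intro k M; rw [← Matrix.mul_assoc, ZY, Matrix.neg_mul, Matrix.mul_assoc]
  have II : ∀ c : ℂ, Complex.I * (Complex.I * c) = - c := by
    intro c; rw [← mul_assoc, Complex.I_mul_I]; ring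
  obtain ⟨J, hJ⟩ : ∃ J : Mat m, J = (-Complex.I) • (X * (Y * Z)) := ⟨_, rfl⟩
  have hJh : Jᴴ = J := by
    rw [hJ]
    simp [Matrix.conjTranspose_smul, hX, hY, hZ, Matrix.mul_assoc, YX, ZX, ZY, YX', ZX', ZY']
  have JJ : J * J = 1 := by
    rw [hJ]
    simp [Matrix.mul_assoc, XX, YY, ZZ, XX', YY', ZZ', YX, ZX, ZY, YX', ZX', ZY', smul_smul]
  have JX : J * X = X * J := by
    rw [hJ]
    simp [Matrix.mul_assoc, XX, YY, ZZ, XX', YY', ZZ', YX, ZX, ZY, YX', ZX', ZY', smul_smul]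
  have JZ : J * Z = Z * J := by
    rw [hJ]
    simp [Matrix.mul_assoc, XX, YY, ZZ, XX', YY', ZZ', YX, ZX, ZY, YX', ZX', ZY', smul_smul]
  have JJ' : ∀ (M : Mat m), J * (J * M) = M := by
    intro M; rw [← Matrix.mul_assoc, JJ, Matrix.one_mul]
  have JX' : ∀ (M : Mat m), J * (X * M) = X * (J * M) := by
    intro M; rw [← Matrix.mul_assoc, JX, Matrix.mul_assoc]
  have JZ' : ∀ (M : Mat m), J * (Z * M) = Z * (J * M) := by
    intro M; rw [← Matrix.mul_assoc, JZ, Matrix.mul_assoc]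
  have hYJ : Y = Complex.I • (X * (J * Z)) := by
    rw [hJ]
    simp [Matrix.mul_assoc, ZZ, XX', smul_smul]
  clear hJ
  obtain ⟨P, hP⟩ : ∃ P : Mat m, P = (4⁻¹ : ℂ) • (1 + Z + J + Z * J) := ⟨_, rfl⟩
  obtain ⟨Q, hQ⟩ : ∃ P : Mat m, P = (4⁻¹ : ℂ) • (1 - Z - J + Z * J) := ⟨_, rfl⟩
  have hPh : P.IsHermitian := by
    rw [Matrix.IsHermitian, hP]
    simp [Matrix.conjTranspose_smul, hZ, hJh, JZ]
  have hQh : Q.IsHermitian := by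
    rw [Matrix.IsHermitian, hQ]
    simp [Matrix.conjTranspose_smul, hZ, hJh, JZ]
  have hPP : P * P = P := by
    rw [hP]
    simp only [Matrix.smul_mul, Matrix.mul_smul, Matrix.mul_add, Matrix.add_mul, Matrix.one_mul,
      Matrix.mul_one, Matrix.mul_assoc, JJ, ZZ, JZ, JJ', ZZ', JZ']
    module
  have hQQ : Q * Q = Q := by
    rw [hQ]
    simp only [Matrix.smul_mul, Matrix.mul_smul, Matrix.mul_add, Matrix.add_mul, Matrix.one_mul,
      Matrix.mul_sub, Matrix.sub_mul,
      Matrix.mul_one, Matrix.mul_assoc, JJ, ZZ, JZ, JJ', ZZ', JZ']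
    module
  have ZP : Z * P = P := by
    rw [hP]
    simp only [Matrix.mul_smul, Matrix.mul_add, Matrix.mul_one, ZZ, ZZ']
    module
  have JP : J * P = P := by
    rw [hP]
    simp only [Matrix.mul_smul, Matrix.mul_add, Matrix.mul_one, JJ, JZ, JZ']
    module
  have ZQ : Z * Q = -Q := by
    rw [hQ]
    simp only [Matrix.mul_smul, Matrix.mul_add, Matrix.mul_sub, Matrix.mul_one, ZZ, ZZ']
    module
  have JQ : J * Q = -Q := by
    rw [hQ]
    simp only [Matrix.mul_smul, Matrix.mul_add, Matrix.mul_sub, Matrix.mul_one, JJ, JZ, JZ']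
    module
  have hsum : P + X * P * X + (Q + X * Q * X) = 1 := by
    rw [hP, hQ]
    simp only [Matrix.smul_mul, Matrix.mul_smul, Matrix.mul_add, Matrix.add_mul, Matrix.one_mul,
      Matrix.mul_sub, Matrix.sub_mul, Matrix.mul_neg,
      Matrix.mul_one, Matrix.mul_assoc, XX, JX, ZX, XX', JX', ZX']
    module
  obtain ⟨p, V, hV, hV'⟩ := proj_factor P hPh hPP
  obtain ⟨q, W, hW, hW'⟩ := proj_factor Q hQh hQQ
  have PV : P * V = V := by rw [← hV, Matrix.mul_assoc, hV', Matrix.mul_one]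
  have QW : Q * W = W := by rw [← hW, Matrix.mul_assoc, hW', Matrix.mul_one]
  have ZV : Z * V = V := by rw [← PV, ← Matrix.mul_assoc, ZP]
  have JV : J * V = V := by rw [← PV, ← Matrix.mul_assoc, JP]
  have ZW : Z * W = -W := by rw [← QW, ← Matrix.mul_assoc, ZQ, Matrix.neg_mul]
  have JW : J * W = -W := by rw [← QW, ← Matrix.mul_assoc, JQ, Matrix.neg_mul]
  have YV : Y * V = Complex.I • (X * V) := by
    rw [hYJ]; simp [Matrix.mul_assoc, ZV, JV]
  have YW : Y * W = Complex.I • (X * W) := by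
    rw [hYJ]; simp [Matrix.mul_assoc, ZW, JW]
  have trP : P.trace = p := by
    rw [← hV, Matrix.trace_mul_comm, hV']; simp
  have trQ : Q.trace = q := by
    rw [← hW, Matrix.trace_mul_comm, hW']; simp
  have trX : ∀ M : Mat m, (X * M * X).trace = M.trace := by
    intro M; rw [Matrix.trace_mul_comm, XX']
  have hdim : 2 * p + 2 * q = m := by
    have := congrArg Matrix.trace hsum
    simp only [Matrix.trace_add, trX, trP, trQ, Matrix.trace_one, Fintype.card_fin] at this
    have h2 : ((2 * p + 2 * q : ℕ) : ℂ) = (m : ℂ) := by rw [← this]; push_cast; ring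
    exact_mod_cast h2
  let T : Matrix (Fin m) ((Fin 2 × Fin p) ⊕ (Fin 2 × Fin q)) ℂ :=
    Matrix.of fun i => Sum.elim (fun a => if a.1 = 0 then V i a.2 else (X * V) i a.2)
      (fun a => if a.1 = 0 then W i a.2 else -(X * W) i a.2)
  have hTT : T * Tᴴ = 1 := by
    rw [← hsum, ← hV, ← hW]
    have e1 : X * (V * Vᴴ) * X = (X * V) * (X * V)ᴴ := by
      simp [hX, Matrix.mul_assoc]
    have e2 : X * (W * Wᴴ) * X = (X * W) * (X * W)ᴴ := by
      simp [hX, Matrix.mul_assoc]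
    rw [e1, e2]
    ext i j
    simp [-Matrix.conjTranspose_mul, T, Matrix.mul_apply, Fintype.sum_sum_type, Fintype.sum_prod_type]
  refine ⟨p, q, hdim, T.submatrix id (bigE hdim).symm, ?_, ?_⟩
  · rw [Matrix.conjTranspose_submatrix, Matrix.submatrix_mul_equiv, hTT]; simp
  · intro x y z A hA
    set M : Mat m := (x : ℂ) • X + (y : ℂ) • Y + (z : ℂ) • Z with hM
    rw [Matrix.conjTranspose_submatrix, Matrix.submatrix_mul_equiv, Matrix.submatrix_mul_equiv]
    have key : M * T = T * bigD p q A := by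
      have c1 : M * V = A 0 0 • V + A 1 0 • (X * V) := by
        simp only [hM, hA, Matrix.add_mul, Matrix.smul_mul, YV, ZV]
        simp
        module
      have c2 : M * (X * V) = A 0 1 • V + A 1 1 • (X * V) := by
        simp only [hM, hA, Matrix.add_mul, Matrix.smul_mul, YX', ZX', XX', YV, ZV, Matrix.mul_smul]
        simp
        module
      have c3 : M * W = -A 0 0 • W + A 1 0 • (X * W) := by
        simp only [hM, hA, Matrix.add_mul, Matrix.smul_mul, YW, ZW]
        simp
        module
      have c4 : M * (X * W) = A 0 1 • W - A 1 1 • (X * W) := by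
        simp only [hM, hA, Matrix.add_mul, Matrix.smul_mul, YX', ZX', XX', YW, ZW, Matrix.mul_smul]
        simp
        module
      clear_value M
      clear hA
      ext i j
      rcases j with ⟨a, k⟩ | ⟨a, k⟩ <;> fin_cases a
      · have := congrFun (congrFun c1 i) k
        rw [Matrix.mul_apply] at this
        simp only [Matrix.mul_apply (M := M), Matrix.mul_apply (M := T)]
        simp [T, bigD, Fintype.sum_sum_type, Fintype.sum_prod_type, this, Matrix.one_apply]
        try ring
      · have := congrFun (congrFun c2 i) k
        rw [Matrix.mul_apply] at this
        simp only [Matrix.mul_apply (M := M), Matrix.mul_apply (M := T)]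
        simp [T, bigD, Fintype.sum_sum_type, Fintype.sum_prod_type, this, Matrix.one_apply]
        try ring
      · have := congrFun (congrFun c3 i) k
        rw [Matrix.mul_apply] at this
        simp only [Matrix.mul_apply (M := M), Matrix.mul_apply (M := T)]
        simp [T, bigD, Fintype.sum_sum_type, Fintype.sum_prod_type, this, Matrix.one_apply]
        try ring
      · have := congrFun (congrFun c4 i) k
        rw [Matrix.mul_apply] at this
        simp only [Matrix.mul_apply (M := M), Matrix.mul_apply (M := T)]
        simp [T, bigD, Fintype.sum_sum_type, Fintype.sum_prod_type, this, Matrix.one_apply]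
        try ring
    rw [← key, Matrix.mul_assoc, hTT]
    simp

lemma anti {m : ℕ} (ψ : H0S 2 →ₗ[ℝ] HermS m)
    (hψ : ∀ A : H0S 2, (A : Mat 2) * A = 1 → (ψ A : Mat m) * (ψ A : Mat m) = 1)
    (A B : H0S 2) (hA : (A : Mat 2) * A = 1) (hB : (B : Mat 2) * B = 1)
    (hAB : (B : Mat 2) * A = -(A * B)) :
    (ψ B : Mat m) * (ψ A : Mat m) = -((ψ A : Mat m) * (ψ B : Mat m)) := by
  have h1 := hψ A hA
  have h2 := hψ B hB
  have h3 := hψ ((3/5 : ℝ) • A + (4/5 : ℝ) • B) (by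
    simp only [Submodule.coe_add, Submodule.coe_smul, add_mul, mul_add, smul_mul_assoc,
      mul_smul_comm, hA, hB, hAB]
    module)
  simp only [map_add, map_smul, Submodule.coe_add, Submodule.coe_smul, add_mul, mul_add,
    smul_mul_assoc, mul_smul_comm, h1, h2] at h3
  generalize (ψ A : Mat m) * (ψ B : Mat m) = C at *
  generalize (ψ B : Mat m) * (ψ A : Mat m) = D at *
  have : D = -C + (25/12 : ℝ) • (((3/5 : ℝ) • ((3/5 : ℝ) • (1 : Mat m) + (4/5 : ℝ) • D) +
    (4/5 : ℝ) • ((3/5 : ℝ) • C + (4/5 : ℝ) • (1 : Mat m))) - 1) := by module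
  rw [this, h3]; simp

/-- Corollary `c2m`. -/
theorem stmt11 (m : ℕ) (hm : 0 < m) (φ : H0S 2 → HermS m) :
    (IsLinearMap ℝ φ ∧ ∀ A : H0S 2, (A : Mat 2) ∈ Matrix.unitaryGroup (Fin 2) ℂ →
        (φ A : Mat m) ∈ Matrix.unitaryGroup (Fin m) ℂ) ↔
    (∃ p q : ℕ, ∃ h : m = 2 * (p + q), ∃ U : Mat m,
      U ∈ Matrix.unitaryGroup (Fin m) ℂ ∧
      ∀ A : H0S 2, (φ A : Mat m) =
        U * castM (show 2 * p + 2 * q = m by omega)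
          (dsum (kron (A : Mat 2) (1 : Mat p)) (kron (-(A : Mat 2)) (1 : Mat q))) * Uᴴ) := by
  constructor
  · rintro ⟨hlin, hu⟩
    let ψ : H0S 2 →ₗ[ℝ] HermS m := IsLinearMap.mk' φ hlin
    have hψ : ∀ A : H0S 2, (A : Mat 2) * A = 1 → (ψ A : Mat m) * (ψ A : Mat m) = 1 := by
      intro A hA
      have h1 : (A : Mat 2)ᴴ = A := A.2.1
      have h2 : (φ A : Mat m)ᴴ = φ A := (φ A).2
      have h3 := hu A (by rw [Matrix.mem_unitaryGroup_iff, star_eq_conjTranspose, h1, hA])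
      rw [Matrix.mem_unitaryGroup_iff, star_eq_conjTranspose, h2] at h3
      exact h3
    let sx : H0S 2 := ⟨!![0, 1; 1, 0], by
      constructor
      · ext i j; fin_cases i <;> fin_cases j <;> simp
      · simp [Matrix.trace_fin_two]⟩
    let sy : H0S 2 := ⟨!![0, -Complex.I; Complex.I, 0], by
      constructor
      · ext i j; fin_cases i <;> fin_cases j <;> simp
      · simp [Matrix.trace_fin_two]⟩
    let sz : H0S 2 := ⟨!![1, 0; 0, -1], by
      constructor
      · ext i j; fin_cases i <;> fin_cases j <;> simp
      · simp [Matrix.trace_fin_two]⟩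
    have xx : (sx : Mat 2) * sx = 1 := by
      ext i j; fin_cases i <;> fin_cases j <;> simp [sx]
    have yy : (sy : Mat 2) * sy = 1 := by
      ext i j; fin_cases i <;> fin_cases j <;> simp [sy]
    have zz : (sz : Mat 2) * sz = 1 := by
      ext i j; fin_cases i <;> fin_cases j <;> simp [sz]
    have yx : (sy : Mat 2) * sx = -(sx * sy) := by
      ext i j; fin_cases i <;> fin_cases j <;> simp [sx, sy]
    have zx : (sz : Mat 2) * sx = -(sx * sz) := by
      ext i j; fin_cases i <;> fin_cases j <;> simp [sx, sz]
    have zy : (sz : Mat 2) * sy = -(sy * sz) := by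
      ext i j; fin_cases i <;> fin_cases j <;> simp [sz, sy]
    obtain ⟨p, q, h, U, hU, key⟩ := dir1 (ψ sx : Mat m) (ψ sy) (ψ sz) (ψ sx).2 (ψ sy).2 (ψ sz).2
      (hψ _ xx) (hψ _ yy) (hψ _ zz) (anti ψ hψ _ _ xx yy yx) (anti ψ hψ _ _ xx zz zx)
      (anti ψ hψ _ _ yy zz zy)
    refine ⟨p, q, by omega, U, (Matrix.mem_unitaryGroup_iff).2 hU, ?_⟩
    intro A
    rw [cast_eq_big]
    have h00 : star ((A : Mat 2) 0 0) = (A : Mat 2) 0 0 := A.2.1.apply 0 0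
    have h01 : star ((A : Mat 2) 1 0) = (A : Mat 2) 0 1 := A.2.1.apply 0 1
    have htr : (A : Mat 2) 0 0 + (A : Mat 2) 1 1 = 0 := by
      have := A.2.2
      rwa [Matrix.trace_fin_two] at this
    obtain ⟨x, hx⟩ : ∃ x : ℝ, x = ((A : Mat 2) 1 0).re := ⟨_, rfl⟩
    obtain ⟨y, hy⟩ : ∃ x : ℝ, x = ((A : Mat 2) 1 0).im := ⟨_, rfl⟩
    obtain ⟨z, hz⟩ : ∃ x : ℝ, x = ((A : Mat 2) 0 0).re := ⟨_, rfl⟩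
    have a00 : (A : Mat 2) 0 0 = z := by
      rw [hz]; exact (Complex.conj_eq_iff_re.1 h00).symm
    have a10 : (A : Mat 2) 1 0 = x + Complex.I * y := by
      rw [hx, hy, mul_comm, Complex.re_add_im]
    have a01 : (A : Mat 2) 0 1 = x - Complex.I * y := by
      rw [← h01, a10]; simp [sub_eq_add_neg]
    have a11 : (A : Mat 2) 1 1 = -z := by
      rw [← a00]; linear_combination htr
    have hA : (A : Mat 2) = !![(z : ℂ), x - Complex.I * y; x + Complex.I * y, -z] := by
      ext i j; fin_cases i <;> fin_cases j <;> simp [a00, a10, a01, a11]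
    rw [← key x y z A hA]
    have hA2 : A = x • sx + y • sy + z • sz := by
      apply Subtype.ext
      rw [hA]
      ext i j; fin_cases i <;> fin_cases j <;> simp [sx, sy, sz] <;> ring
    have : φ A = x • ψ sx + y • ψ sy + z • ψ sz := by
      rw [← map_smul, ← map_smul, ← map_smul, ← map_add, ← map_add, ← hA2]; rfl
    rw [this]
    simp only [Submodule.coe_add, Submodule.coe_smul]
    ext i j
    simp
  · rintro ⟨p, q, h, U, hU, key⟩
    have hU1 : U * Uᴴ = 1 := (Matrix.mem_unitaryGroup_iff).1 hU
    have hU2 : Uᴴ * U = 1 := (Matrix.mem_unitaryGroup_iff').1 hU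
    simp only [cast_eq_big] at key
    refine ⟨⟨?_, ?_⟩, ?_⟩
    · intro A B
      apply Subtype.ext
      simp only [Submodule.coe_add, key, bigD_add, Matrix.submatrix_add, Pi.add_apply,
        Matrix.mul_add, Matrix.add_mul]
    · intro r A
      apply Subtype.ext
      simp only [Submodule.coe_smul, key, bigD_smul, Matrix.submatrix_smul, Pi.smul_apply,
        Matrix.mul_smul, Matrix.smul_mul]
    · intro A hA
      have h1 : (A : Mat 2)ᴴ = A := A.2.1
      have h2 : (φ A : Mat m)ᴴ = φ A := (φ A).2
      rw [Matrix.mem_unitaryGroup_iff, star_eq_conjTranspose, h1] at hA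
      rw [Matrix.mem_unitaryGroup_iff, star_eq_conjTranspose, h2, key]
      have hh : 2 * p + 2 * q = m := by omega
      obtain ⟨B, hB⟩ : ∃ B : Mat m,
        (bigD p q (A : Mat 2)).submatrix (bigE hh).symm (bigE hh).symm = B := ⟨_, rfl⟩
      rw [hB]
      have hBB : B * B = 1 := by
        rw [← hB, Matrix.submatrix_mul_equiv, bigD_mul p q _ hA]; simp
      calc U * B * Uᴴ * (U * B * Uᴴ) = U * (B * ((Uᴴ * U) * B)) * Uᴴ := by
            simp only [Matrix.mul_assoc]
        _ = 1 := by rw [hU2, Matrix.one_mul, hBB, Matrix.mul_one, hU1]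
end

section
/- Let m ∈ ℕ and X ∈ M_m. If there exists Y ∈ M_m such that both X + Y ∈ 𝒰_m and X − Y ∈ 𝒰_m, then there exist U, V ∈ 𝒰_m, p, q, r ∈ ℕ ∪ {0}, m_1, …, m_r ∈ ℕ, and real numbers 0 < s_r < … < s_1 < 1 such that p + q + Σ_{j=1}^r m_j = m and X = U(I_p ⊕ 0_q ⊕ (⊕_{j=1}^r s_j I_{m_j}))V. Moreover, with U, V, p, q, r, m_j, s_j as above, every Y ∈ M_m satisfying X + Y ∈ 𝒰_m and X − Y ∈ 𝒰_m has the form Y = U(0_p ⊕ W ⊕ (⊕_{j=1}^r i·√(1 − s_j²)·H_j))V for some W ∈ 𝒰_q and hermitian unitary matrices H_j ∈ ℋ_{m_j} ∩ 𝒰_{m_j}, j = 1, …, r. -/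
open Matrix Kronecker

def fF {p q r : ℕ} (mj : Fin r → ℕ) (s : Fin r → ℝ) :
    (Fin p ⊕ Fin q) ⊕ (Σ j, Fin (mj j)) → ℝ :=
  Sum.elim (Sum.elim (fun _ => 1) (fun _ => 0)) (fun x => s x.1)

lemma bdiag_eq : ∀ {r : ℕ} (mj : Fin r → ℕ), ∃ es : (Σ j, Fin (mj j)) ≃ Fin (∑ j, mj j),
    ∀ A : (j : Fin r) → Mat (mj j), bdiag mj A = Matrix.reindex es es (blockDiagonal' A) := by
  intro r
  induction r with
  | zero =>
    intro mj
    refine ⟨Fintype.equivOfCardEq (by simp), fun A => ?_⟩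
    ext i j
    exact absurd i.2 (by simp)
  | succ r ih =>
    intro mj
    obtain ⟨es, hes⟩ := ih (fun j => mj j.succ)
    let g : (Σ j, Fin (mj j)) ≃ Fin (mj 0) ⊕ (Σ j : Fin r, Fin (mj j.succ)) :=
      { toFun := fun x => Fin.cases (motive := fun j => Fin (mj j) → Fin (mj 0) ⊕ (Σ j : Fin r, Fin (mj j.succ)))
          (fun a => Sum.inl a) (fun j a => Sum.inr ⟨j, a⟩) x.1 x.2
        invFun := Sum.elim (fun a => ⟨0, a⟩) (fun x => ⟨x.1.succ, x.2⟩)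
        left_inv := by
          rintro ⟨j, a⟩
          induction j using Fin.cases <;> simp
        right_inv := by
          rintro (a | ⟨j, a⟩) <;> simp }
    refine ⟨((g.trans (Equiv.sumCongr (Equiv.refl _) es)).trans finSumFinEquiv).trans
      (finCongr (Fin.sum_univ_succ mj).symm), fun A => ?_⟩
    rw [bdiag, hes]
    apply (Matrix.reindex (((g.trans (Equiv.sumCongr (Equiv.refl _) es)).trans finSumFinEquiv).trans
      (finCongr (Fin.sum_univ_succ mj).symm)) (((g.trans (Equiv.sumCongr (Equiv.refl _) es)).trans finSumFinEquiv).trans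
      (finCongr (Fin.sum_univ_succ mj).symm))).symm.injective
    rw [Equiv.symm_apply_apply]
    ext ⟨i, a⟩ ⟨j, b⟩
    induction i using Fin.cases <;> induction j using Fin.cases
    · simp [castM, dsum, blks, g, blockDiagonal'_apply]
    · simp [castM, dsum, blks, g, blockDiagonal'_apply, (Fin.succ_ne_zero _).symm]
    · simp [castM, dsum, blks, g, blockDiagonal'_apply, (Fin.succ_ne_zero _)]
    · rename_i i j
      by_cases h : i = j
      · subst h
        simp [castM, dsum, blks, g, blockDiagonal'_apply]
      · simp [castM, dsum, blks, g, blockDiagonal'_apply, h]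

lemma all_eq {p q r m : ℕ} (mj : Fin r → ℕ) (h : p + q + ∑ j, mj j = m) :
    ∃ e : (Fin p ⊕ Fin q) ⊕ (Σ j, Fin (mj j)) ≃ Fin m,
    ∀ (A : Mat p) (B : Mat q) (C : (j : Fin r) → Mat (mj j)),
      castM h (dsum (dsum A B) (bdiag mj C)) =
        Matrix.reindex e e (fromBlocks (fromBlocks A 0 0 B) 0 0 (blockDiagonal' C)) := by
  obtain ⟨es, hes⟩ := bdiag_eq mj
  subst h
  refine ⟨(Equiv.sumCongr finSumFinEquiv es).trans finSumFinEquiv, fun A B C => ?_⟩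
  rw [hes]
  apply (Matrix.reindex ((Equiv.sumCongr finSumFinEquiv es).trans finSumFinEquiv)
    ((Equiv.sumCongr finSumFinEquiv es).trans finSumFinEquiv)).symm.injective
  rw [Equiv.symm_apply_apply]
  ext ((i | i) | i) ((j | j) | j) <;> simp [castM, dsum, blks]

lemma sort_d {m : ℕ} (d : Fin m → ℝ) (h0 : ∀ i, 0 ≤ d i) (h1 : ∀ i, d i ≤ 1) :
    ∃ (p q r : ℕ) (mj : Fin r → ℕ) (s : Fin r → ℝ),
      (∀ j, 0 < mj j) ∧ (∀ j, 0 < s j ∧ s j < 1) ∧ StrictAnti s ∧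
      ∃ g : (Fin p ⊕ Fin q) ⊕ (Σ j, Fin (mj j)) ≃ Fin m, ∀ i, d (g i) = fF mj s i := by
  classical
  let S := (Finset.univ.image d).filter (fun x => 0 < x ∧ x < 1)
  let s : Fin S.card → ℝ := fun j => S.orderEmbOfFin rfl j.rev
  have hs : ∀ j, s j ∈ S := fun j => S.orderEmbOfFin_mem rfl _
  have hs1 : ∀ j, 0 < s j ∧ s j < 1 := fun j => (Finset.mem_filter.1 (hs j)).2
  have hsa : StrictAnti s := fun a b hab =>
    (S.orderEmbOfFin rfl).strictMono (Fin.rev_lt_rev.2 hab)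
  have hsurj : ∀ i, 0 < d i → d i < 1 → ∃ j, d i = s j := by
    intro i hi hi'
    have : d i ∈ Set.range (S.orderEmbOfFin rfl) := by
      rw [Finset.range_orderEmbOfFin]; simp [S, hi, hi']
    obtain ⟨j, hj⟩ := this
    exact ⟨j.rev, by simp [s, hj]⟩
  let φ : ({i // d i = 1} ⊕ {i // d i = 0}) ⊕ (Σ j, {i // d i = s j}) → Fin m :=
    Sum.elim (Sum.elim (fun x => x.1) (fun x => x.1)) (fun x => x.2.1)
  have hφ : Function.Bijective φ := by
    constructor
    · rintro ((⟨i, hi⟩ | ⟨i, hi⟩) | ⟨a, i, hi⟩) ((⟨j, hj⟩ | ⟨j, hj⟩) | ⟨b, j, hj⟩) hij <;>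
        simp only [φ, Sum.elim_inl, Sum.elim_inr] at hij <;> subst hij
      · rfl
      · exact absurd (hi.symm.trans hj) (by norm_num)
      · exact absurd (hi.symm.trans hj) (hs1 b).2.ne'
      · exact absurd (hi.symm.trans hj) (by norm_num)
      · rfl
      · exact absurd (hi.symm.trans hj) (hs1 b).1.ne
      · exact absurd (hi.symm.trans hj) (hs1 a).2.ne
      · exact absurd (hi.symm.trans hj) (hs1 a).1.ne'
      · have := hsa.injective (hi.symm.trans hj)
        subst this
        rfl
    · intro i
      rcases (h0 i).eq_or_lt with h | h
      · exact ⟨Sum.inl (Sum.inr ⟨i, h.symm⟩), rfl⟩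
      rcases (h1 i).eq_or_lt with h' | h'
      · exact ⟨Sum.inl (Sum.inl ⟨i, h'⟩), rfl⟩
      obtain ⟨j, hj⟩ := hsurj i h h'
      exact ⟨Sum.inr ⟨j, i, hj⟩, rfl⟩
  refine ⟨Fintype.card {i // d i = 1}, Fintype.card {i // d i = 0}, S.card,
    fun j => Fintype.card {i // d i = s j}, s, ?_, hs1, hsa,
    (Equiv.sumCongr (Equiv.sumCongr (Fintype.equivFin _).symm (Fintype.equivFin _).symm)
      (Equiv.sigmaCongrRight fun j => (Fintype.equivFin _).symm)).trans (Equiv.ofBijective φ hφ), ?_⟩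
  · intro j
    obtain ⟨i, _, hi⟩ := Finset.mem_image.1 (Finset.mem_filter.1 (hs j)).1
    exact Fintype.card_pos_iff.2 ⟨⟨i, hi⟩⟩
  · rintro ((i | i) | ⟨j, i⟩)
    · exact ((Fintype.equivFin {i // d i = 1}).symm i).2
    · exact ((Fintype.equivFin {i // d i = 0}).symm i).2
    · exact ((Fintype.equivFin {i // d i = s j}).symm i).2

open scoped ComplexOrder in
lemma svd {m : ℕ} (X : Mat m) : ∃ U V : Mat m, U ∈ Matrix.unitaryGroup (Fin m) ℂ ∧
    V ∈ Matrix.unitaryGroup (Fin m) ℂ ∧ ∃ d : Fin m → ℝ, (∀ i, 0 ≤ d i) ∧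
      X = U * diagonal (fun i => (d i : ℂ)) * V := by
  classical
  have hP : (Xᴴ * X).PosSemidef := posSemidef_conjTranspose_mul_self X
  let Q := hP.isHermitian.eigenvectorUnitary
  let l := hP.isHermitian.eigenvalues
  have hl : ∀ i, 0 ≤ l i := hP.eigenvalues_nonneg
  let Z : Mat m := X * (Q : Mat m)
  have hQ : (Q : Mat m)ᴴ * Q = 1 := Unitary.coe_star_mul_self Q
  have hQ' : (Q : Mat m) * (Q : Mat m)ᴴ = 1 := Unitary.coe_mul_star_self Q
  have hZ : Zᴴ * Z = diagonal (fun i => (l i : ℂ)) := by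
    have := hP.isHermitian.spectral_theorem
    rw [Unitary.conjStarAlgAut_apply] at this
    have h2 : Zᴴ * Z = (Q : Mat m)ᴴ * (Xᴴ * X) * Q := by
      simp only [Z, conjTranspose_mul, Matrix.mul_assoc]
    rw [h2, this]
    change (Q : Mat m)ᴴ * ((Q : Mat m) * _ * (Q : Mat m)ᴴ) * Q = _
    simp only [Matrix.mul_assoc, hQ, Matrix.mul_one]
    rw [← Matrix.mul_assoc, hQ, Matrix.one_mul]
    rfl
  have hZe : ∀ i j, ∑ k, star (Z k i) * Z k j = if i = j then (l i : ℂ) else 0 := by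
    intro i j
    have := congrFun (congrFun hZ i) j
    simpa [Matrix.mul_apply, diagonal_apply] using this
  let v : Fin m → EuclideanSpace ℂ (Fin m) := fun i =>
    WithLp.toLp 2 (fun k => ((Real.sqrt (l i))⁻¹ : ℂ) * Z k i)
  have hv : Orthonormal ℂ (({i | l i ≠ 0} : Set (Fin m)).restrict v) := by
    rw [orthonormal_iff_ite]
    rintro ⟨i, hi⟩ ⟨j, hj⟩
    have hi' : l i ≠ 0 := hi
    have : inner ℂ (v i) (v j) =
        ((Real.sqrt (l i))⁻¹ : ℂ) * ((Real.sqrt (l j))⁻¹ : ℂ) * ∑ k, star (Z k i) * Z k j := by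
      simp only [v, PiLp.inner_apply, Finset.mul_sum]
      refine Finset.sum_congr rfl fun k _ => ?_
      simp
      ring
    change inner ℂ (v i) (v j) = _
    rw [this, hZe]
    by_cases hij : i = j
    · subst hij
      simp only [if_true]
      rw [← mul_inv, ← Complex.ofReal_mul, Real.mul_self_sqrt (hl i)]
      exact inv_mul_cancel₀ (by exact_mod_cast hi')
    · simp [hij]
  obtain ⟨b, hb⟩ := hv.exists_orthonormalBasis_extension_of_card_eq (by simp)
  let U : Mat m := Matrix.of fun k i => b i k
  have hU : U ∈ Matrix.unitaryGroup (Fin m) ℂ := by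
    rw [Matrix.mem_unitaryGroup_iff']
    ext i j
    have := orthonormal_iff_ite.1 b.orthonormal i j
    simp only [PiLp.inner_apply] at this
    simp only [star_eq_conjTranspose, Matrix.mul_apply, U, conjTranspose_apply, of_apply, one_apply]
    rw [← this]
    refine Finset.sum_congr rfl fun k _ => ?_
    simp [mul_comm]
  refine ⟨U, (Q : Mat m)ᴴ, hU, (star Q).2, fun i => Real.sqrt (l i), fun i => Real.sqrt_nonneg _, ?_⟩
  have : Z = U * diagonal (fun i => (Real.sqrt (l i) : ℂ)) := by
    ext k i
    rw [mul_diagonal]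
    by_cases hi : l i = 0
    · have h1 := hZe i i
      simp only [if_true, hi, Complex.ofReal_zero] at h1
      have h2 : ∑ k, ‖Z k i‖ ^ 2 = 0 := by
        have : ((∑ k, ‖Z k i‖ ^ 2 : ℝ) : ℂ) = 0 := by
          rw [← h1]; push_cast
          refine Finset.sum_congr rfl fun k _ => ?_
          exact (Complex.conj_mul' _).symm
        exact_mod_cast this
      have h3 := (Finset.sum_eq_zero_iff_of_nonneg (fun k _ => by positivity)).1 h2 k (Finset.mem_univ _)
      have : Z k i = 0 := by simpa using h3
      simp [this, hi]
    · have : U k i = ((Real.sqrt (l i))⁻¹ : ℂ) * Z k i := by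
        simp only [U, of_apply, hb i hi]; rfl
      rw [this]
      have : (Real.sqrt (l i) : ℂ) ≠ 0 := by
        exact_mod_cast (Real.sqrt_pos.2 ((hl i).lt_of_ne' hi)).ne'
      field_simp
  rw [← this]
  simp only [Z, Matrix.mul_assoc, hQ', Matrix.mul_one]

lemma rel {n : Type*} [Fintype n] [DecidableEq n] (D Y : Matrix n n ℂ)
    (h1 : D + Y ∈ Matrix.unitaryGroup n ℂ) (h2 : D - Y ∈ Matrix.unitaryGroup n ℂ) :
    Dᴴ * D + Yᴴ * Y = 1 ∧ Dᴴ * Y + Yᴴ * D = 0 ∧ D * Yᴴ + Y * Dᴴ = 0 := by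
  have a1 := Matrix.mem_unitaryGroup_iff.1 h1
  have a2 := Matrix.mem_unitaryGroup_iff'.1 h1
  have b1 := Matrix.mem_unitaryGroup_iff.1 h2
  have b2 := Matrix.mem_unitaryGroup_iff'.1 h2
  simp only [star_eq_conjTranspose, conjTranspose_add, conjTranspose_sub, Matrix.add_mul,
    Matrix.mul_add, Matrix.sub_mul, Matrix.mul_sub] at a1 a2 b1 b2
  refine ⟨?_, ?_, ?_⟩ <;> ext i j
  all_goals
    have a1 := congrFun (congrFun a1 i) j
    have a2 := congrFun (congrFun a2 i) j
    have b1 := congrFun (congrFun b1 i) j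
    have b2 := congrFun (congrFun b2 i) j
    simp only [Matrix.add_apply, Matrix.sub_apply, Matrix.zero_apply] at *
  · linear_combination (a2 + b2) / 2
  · linear_combination (a2 - b2) / 2
  · linear_combination (a1 - b1) / 2

lemma block {p q r : ℕ} (mj : Fin r → ℕ) (s : Fin r → ℝ) (hs1 : ∀ j, 0 < s j ∧ s j < 1)
    (hsa : StrictAnti s)
    (T : Matrix ((Fin p ⊕ Fin q) ⊕ (Σ j, Fin (mj j))) ((Fin p ⊕ Fin q) ⊕ (Σ j, Fin (mj j))) ℂ)
    (h1 : diagonal (fun i => (fF mj s i : ℂ)) + T ∈ Matrix.unitaryGroup _ ℂ)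
    (h2 : diagonal (fun i => (fF mj s i : ℂ)) - T ∈ Matrix.unitaryGroup _ ℂ) :
    ∃ (W : Mat q) (Hm : (j : Fin r) → Mat (mj j)),
      W ∈ Matrix.unitaryGroup (Fin q) ℂ ∧
      (∀ j, (Hm j).IsHermitian ∧ Hm j ∈ Matrix.unitaryGroup (Fin (mj j)) ℂ) ∧
      T = fromBlocks (fromBlocks 0 0 0 W) 0 0 (blockDiagonal' fun j =>
        ((Complex.I * (Real.sqrt (1 - s j ^ 2) : ℂ)) • Hm j)) := by
  obtain ⟨r1, r2, r3⟩ := rel _ _ h1 h2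
  set f : (Fin p ⊕ Fin q) ⊕ (Σ j, Fin (mj j)) → ℝ := fF mj s with hf
  have hD : (diagonal (fun i => (f i : ℂ)))ᴴ = diagonal (fun i => (f i : ℂ)) := by
    rw [diagonal_conjTranspose]; congr 1; ext i; simp
  rw [hD] at r1 r2 r3
  have e2 : ∀ i j, (f i : ℂ) * T i j + star (T j i) * f j = 0 := fun i j => by
    simpa using congrFun (congrFun r2 i) j
  have e3 : ∀ i j, (f i : ℂ) * star (T j i) + T i j * f j = 0 := fun i j => by
    simpa using congrFun (congrFun r3 i) j
  have f0 : ∀ i, 0 ≤ f i := by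
    rintro ((i | i) | i) <;> simp [f, fF, (hs1 _).1.le]
  have off : ∀ i j, f i ≠ f j → T i j = 0 := by
    intro i j hij
    have h : ((f i : ℂ) ^ 2 - (f j : ℂ) ^ 2) * T i j = 0 := by
      linear_combination (f i : ℂ) * e2 i j - (f j : ℂ) * e3 i j
    rcases mul_eq_zero.1 h with h | h
    · exfalso; apply hij
      have : f i ^ 2 = f j ^ 2 := by exact_mod_cast sub_eq_zero.1 h
      exact (pow_left_inj₀ (f0 i) (f0 j) two_ne_zero).1 this
    · exact h
  let W : Mat q := Matrix.of fun i j => T (.inl (.inr i)) (.inl (.inr j))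
  let C : (j : Fin r) → Mat (mj j) := fun j => Matrix.of fun a b => T (.inr ⟨j, a⟩) (.inr ⟨j, b⟩)
  have hone : ∀ i j, T (.inl (.inl i)) (.inl (.inl j)) = 0 := by
    intro i j
    have h := congrFun (congrFun r1 (.inl (.inl j))) (.inl (.inl j))
    have h1 : ∑ k, star (T k (.inl (.inl j))) * T k (.inl (.inl j)) = 0 := by
      simpa [f, fF, Matrix.mul_apply] using h
    have h2 : ∑ k, ‖T k (.inl (.inl j))‖ ^ 2 = 0 := by
      have : ((∑ k, ‖T k (.inl (.inl j))‖ ^ 2 : ℝ) : ℂ) = 0 := by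
        rw [← h1]; push_cast
        refine Finset.sum_congr rfl fun k _ => ?_
        exact (Complex.conj_mul' _).symm
      exact_mod_cast this
    have h3 := (Finset.sum_eq_zero_iff_of_nonneg (fun k _ => by positivity)).1 h2
      (.inl (.inl i)) (Finset.mem_univ _)
    simpa using h3
  have hT : T = fromBlocks (fromBlocks 0 0 0 W) 0 0 (blockDiagonal' C) := by
    ext ((i | i) | ⟨a, i⟩) ((j | j) | ⟨b, j⟩)
    · simpa using hone i j
    · simpa using off _ _ (by simp [f, fF])
    · simpa using off _ _ (by simpa [f, fF] using (hs1 b).2.ne')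
    · simpa using off _ _ (by simp [f, fF])
    · simp [W]
    · simpa using off _ _ (by simpa [f, fF] using (hs1 b).1.ne)
    · simpa using off _ _ (by simpa [f, fF] using (hs1 a).2.ne)
    · simpa using off _ _ (by simpa [f, fF] using (hs1 a).1.ne')
    · by_cases hab : a = b
      · subst hab; simp [C]
      · simpa [blockDiagonal'_apply, hab] using
          off (.inr ⟨a, i⟩) (.inr ⟨b, j⟩) (by simpa [f, fF] using hsa.injective.ne hab)
  have hDD : (1 : Matrix ((Fin p ⊕ Fin q) ⊕ (Σ j, Fin (mj j))) _ ℂ)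
      - diagonal (fun i => (f i : ℂ)) * diagonal (fun i => (f i : ℂ)) =
      fromBlocks (fromBlocks 0 0 0 1) 0 0 (blockDiagonal' fun j => ((1 - s j ^ 2 : ℝ) : ℂ) • 1) := by
    rw [diagonal_mul_diagonal]
    ext ((i | i) | ⟨a, i⟩) ((j | j) | ⟨b, j⟩)
    · by_cases h : i = j <;> simp [f, fF, diagonal_apply, one_apply, h]
    · simp
    · simp
    · simp
    · by_cases h : i = j <;> simp [f, fF, diagonal_apply, one_apply, h]
    · simp
    · simp
    · simp
    · by_cases hab : a = b
      · subst hab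
        by_cases h : i = j <;> simp [f, fF, diagonal_apply, one_apply, h, pow_two]
      · simp [blockDiagonal'_apply, hab, diagonal_apply, one_apply]
  have hTT : Tᴴ * T = _ := (eq_sub_of_add_eq' r1).trans hDD
  rw [hT] at hTT
  simp only [fromBlocks_conjTranspose, fromBlocks_multiply, conjTranspose_zero, Matrix.mul_zero, Matrix.zero_mul, add_zero, zero_add,
    fromBlocks_inj, true_and] at hTT
  obtain ⟨hW, hC⟩ := hTT
  rw [blockDiagonal'_conjTranspose, ← blockDiagonal'_mul] at hC
  have hC := fun j => congrFun (blockDiagonal'_injective hC) j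
  have hskew : ∀ j, (C j)ᴴ = - C j := by
    intro j
    ext a b
    have := e2 (.inr ⟨j, a⟩) (.inr ⟨j, b⟩)
    have hs : (s j : ℂ) ≠ 0 := by exact_mod_cast (hs1 j).1.ne'
    simp only [f, fF, Sum.elim_inr] at this
    simp only [conjTranspose_apply, Matrix.neg_apply, C, of_apply]
    apply mul_left_cancel₀ hs
    linear_combination this
  have hc : ∀ j, 0 < 1 - s j ^ 2 := fun j => by nlinarith [hs1 j]
  have hk : ∀ j, Complex.I * (Real.sqrt (1 - s j ^ 2) : ℂ) ≠ 0 := fun j =>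
    mul_ne_zero Complex.I_ne_zero (by exact_mod_cast (Real.sqrt_pos.2 (hc j)).ne')
  have hstar : ∀ j, star (Complex.I * (Real.sqrt (1 - s j ^ 2) : ℂ))⁻¹ =
      -(Complex.I * (Real.sqrt (1 - s j ^ 2) : ℂ))⁻¹ := by
    intro j
    simp [mul_comm]
  have hher : ∀ j, ((Complex.I * (Real.sqrt (1 - s j ^ 2) : ℂ))⁻¹ • C j)ᴴ =
      (Complex.I * (Real.sqrt (1 - s j ^ 2) : ℂ))⁻¹ • C j := by
    intro j
    rw [conjTranspose_smul, hstar, hskew, smul_neg, neg_smul, neg_neg]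
  refine ⟨W, fun j => (Complex.I * (Real.sqrt (1 - s j ^ 2) : ℂ))⁻¹ • C j,
    Matrix.mem_unitaryGroup_iff'.2 hW, fun j => ⟨hher j, Matrix.mem_unitaryGroup_iff'.2 ?_⟩, ?_⟩
  · rw [star_eq_conjTranspose, conjTranspose_smul, hstar, smul_mul_smul_comm, hC j, smul_smul]
    have hsq : (Real.sqrt (1 - s j ^ 2) : ℂ) ^ 2 = ((1 - s j ^ 2 : ℝ) : ℂ) := by
      rw [← Complex.ofReal_pow, Real.sq_sqrt (hc j).le]
    have hne : ((1 - s j ^ 2 : ℝ) : ℂ) ≠ 0 := by exact_mod_cast (hc j).ne'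
    have : (-(Complex.I * (Real.sqrt (1 - s j ^ 2) : ℂ))⁻¹ *
        (Complex.I * (Real.sqrt (1 - s j ^ 2) : ℂ))⁻¹) * ((1 - s j ^ 2 : ℝ) : ℂ) = 1 := by
      rw [neg_mul, ← mul_inv, ← pow_two, mul_pow, Complex.I_sq, hsq, neg_one_mul, inv_neg, neg_neg]
      exact inv_mul_cancel₀ hne
    rw [this, one_smul]
  · rw [hT]
    congr 2
    funext j
    rw [smul_smul, mul_inv_cancel₀ (hk j), one_smul]

lemma unit_conj {m : ℕ} {U V A : Mat m} (hU : U ∈ Matrix.unitaryGroup (Fin m) ℂ)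
    (hV : V ∈ Matrix.unitaryGroup (Fin m) ℂ) (hA : A ∈ Matrix.unitaryGroup (Fin m) ℂ) :
    Uᴴ * A * Vᴴ ∈ Matrix.unitaryGroup (Fin m) ℂ :=
  mul_mem (mul_mem (Unitary.star_mem hU) hA) (Unitary.star_mem hV)

lemma unit_sub {n k : Type*} [Fintype n] [DecidableEq n] [Fintype k] [DecidableEq k]
    (e : n ≃ k) (A : Matrix k k ℂ) (hA : A ∈ Matrix.unitaryGroup k ℂ) :
    A.submatrix e e ∈ Matrix.unitaryGroup n ℂ := by
  rw [Matrix.mem_unitaryGroup_iff] at *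
  rw [star_eq_conjTranspose, conjTranspose_submatrix, submatrix_mul_equiv]
  rw [star_eq_conjTranspose] at hA
  rw [hA, submatrix_one_equiv]

/-- Lemma `xyuv`. -/
theorem stmt13 (m : ℕ) (hm : 0 < m) (X : Mat m)
    (hX : ∃ Y : Mat m, X + Y ∈ Matrix.unitaryGroup (Fin m) ℂ ∧
      X - Y ∈ Matrix.unitaryGroup (Fin m) ℂ) :
    ∃ U V : Mat m, U ∈ Matrix.unitaryGroup (Fin m) ℂ ∧ V ∈ Matrix.unitaryGroup (Fin m) ℂ ∧
    ∃ (p q r : ℕ) (mj : Fin r → ℕ) (s : Fin r → ℝ),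
      (∀ j, 0 < mj j) ∧ (∀ j, 0 < s j ∧ s j < 1) ∧ StrictAnti s ∧
      ∃ h : p + q + ∑ j, mj j = m,
        X = U * castM h (dsum (dsum (1 : Mat p) (0 : Mat q))
              (bdiag mj fun j => ((s j : ℂ) • 1 : Mat (mj j)))) * V ∧
        ∀ Y : Mat m, X + Y ∈ Matrix.unitaryGroup (Fin m) ℂ →
          X - Y ∈ Matrix.unitaryGroup (Fin m) ℂ →
          ∃ (W : Mat q) (Hm : (j : Fin r) → Mat (mj j)),
            W ∈ Matrix.unitaryGroup (Fin q) ℂ ∧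
            (∀ j, (Hm j).IsHermitian ∧ Hm j ∈ Matrix.unitaryGroup (Fin (mj j)) ℂ) ∧
            Y = U * castM h (dsum (dsum (0 : Mat p) W)
                  (bdiag mj fun j =>
                    ((Complex.I * (Real.sqrt (1 - s j ^ 2) : ℂ)) • Hm j))) * V := by
  obtain ⟨U, V, hU, hV, d, hd0, hXd⟩ := svd X
  have hUU : Uᴴ * U = 1 := Matrix.mem_unitaryGroup_iff'.1 hU
  have hUU' : U * Uᴴ = 1 := Matrix.mem_unitaryGroup_iff.1 hU
  have hVV : V * Vᴴ = 1 := Matrix.mem_unitaryGroup_iff.1 hV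
  have hVV' : Vᴴ * V = 1 := Matrix.mem_unitaryGroup_iff'.1 hV
  have hXc : Uᴴ * X * Vᴴ = diagonal (fun i => (d i : ℂ)) := by
    rw [hXd, ← Matrix.mul_assoc, ← Matrix.mul_assoc, hUU, Matrix.one_mul, Matrix.mul_assoc, hVV,
      Matrix.mul_one]
  have key : ∀ Y : Mat m, X + Y ∈ Matrix.unitaryGroup (Fin m) ℂ →
      X - Y ∈ Matrix.unitaryGroup (Fin m) ℂ →
      diagonal (fun i => (d i : ℂ)) + Uᴴ * Y * Vᴴ ∈ Matrix.unitaryGroup (Fin m) ℂ ∧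
      diagonal (fun i => (d i : ℂ)) - Uᴴ * Y * Vᴴ ∈ Matrix.unitaryGroup (Fin m) ℂ := by
    intro Y h1 h2
    rw [← hXc, ← Matrix.add_mul, ← Matrix.mul_add, ← Matrix.sub_mul, ← Matrix.mul_sub]
    exact ⟨unit_conj hU hV h1, unit_conj hU hV h2⟩
  have hd1 : ∀ i, d i ≤ 1 := by
    obtain ⟨Y, h1, h2⟩ := hX
    obtain ⟨k1, k2⟩ := key Y h1 h2
    obtain ⟨r1, -, -⟩ := rel _ _ k1 k2
    intro i
    have h := congrFun (congrFun r1 i) i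
    set T := Uᴴ * Y * Vᴴ
    have h' : (d i : ℂ) * d i + ∑ k, star (T k i) * T k i = 1 := by
      simpa [Matrix.mul_apply, diagonal_apply] using h
    have h2 : d i * d i + ∑ k, ‖T k i‖ ^ 2 = 1 := by
      have : ((d i * d i + ∑ k, ‖T k i‖ ^ 2 : ℝ) : ℂ) = 1 := by
        rw [← h']; push_cast
        congr 1
        refine Finset.sum_congr rfl fun k _ => ?_
        exact (Complex.conj_mul' _).symm
      exact_mod_cast this
    have : 0 ≤ ∑ k, ‖T k i‖ ^ 2 := by positivity
    nlinarith
  obtain ⟨p, q, r, mj, s, hmj, hs1, hsa, g, hg⟩ := sort_d d hd0 hd1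
  have h : p + q + ∑ j, mj j = m := by
    have := Fintype.card_congr g
    simpa using this
  obtain ⟨e, he⟩ := all_eq mj h
  have hbl : fromBlocks (fromBlocks (1 : Mat p) 0 0 (0 : Mat q)) 0 0
      (blockDiagonal' fun j => ((s j : ℂ) • 1 : Mat (mj j))) =
      diagonal (fun i => (fF mj s i : ℂ)) := by
    ext ((i | i) | ⟨a, i⟩) ((j | j) | ⟨b, j⟩)
    · by_cases h : i = j <;> simp [fF, diagonal_apply, one_apply, h]
    · simp
    · simp
    · simp
    · by_cases h : i = j <;> simp [fF, diagonal_apply, h]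
    · simp
    · simp
    · simp
    · by_cases hab : a = b
      · subst hab
        by_cases h : i = j <;> simp [fF, diagonal_apply, one_apply, h]
      · simp [blockDiagonal'_apply, hab, diagonal_apply]
  have hconj : ∀ A : Mat m, U * A * V =
      U.submatrix id (e.symm.trans g) * A.submatrix (e.symm.trans g) (e.symm.trans g) *
        V.submatrix (e.symm.trans g) id := by
    intro A
    rw [submatrix_mul_equiv, submatrix_mul_equiv, submatrix_id_id]
  have hDs : (diagonal (fun i => (d i : ℂ))).submatrix g g =
      diagonal (fun i => (fF mj s i : ℂ)) := by
    rw [submatrix_diagonal_equiv]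
    congr 1
    funext i
    simp [hg]
  refine ⟨U.submatrix id (e.symm.trans g), V.submatrix (e.symm.trans g) id, ?_, ?_,
    p, q, r, mj, s, hmj, hs1, hsa, h, ?_, ?_⟩
  · rw [Matrix.mem_unitaryGroup_iff, star_eq_conjTranspose, conjTranspose_submatrix,
      submatrix_mul_equiv, hUU', submatrix_id_id]
  · rw [Matrix.mem_unitaryGroup_iff', star_eq_conjTranspose, conjTranspose_submatrix,
      submatrix_mul_equiv, hVV', submatrix_id_id]
  · rw [he, hbl, ← hDs, reindex_apply, submatrix_submatrix]
    rw [hXd, hconj]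
    rfl
  · intro Y h1 h2
    obtain ⟨k1, k2⟩ := key Y h1 h2
    have k1 := unit_sub g _ k1
    have k2 := unit_sub g _ k2
    rw [submatrix_add, Pi.add_apply, Pi.add_apply, hDs] at k1
    rw [submatrix_sub, Pi.sub_apply, Pi.sub_apply, hDs] at k2
    obtain ⟨W, Hm, hW, hH, hT⟩ := block mj s hs1 hsa _ k1 k2
    refine ⟨W, Hm, hW, hH, ?_⟩
    rw [he, ← hT, reindex_apply, submatrix_submatrix]
    have : Y = U * (Uᴴ * Y * Vᴴ) * V := by
      rw [Matrix.mul_assoc, Matrix.mul_assoc (Uᴴ * Y), hVV', Matrix.mul_one, ← Matrix.mul_assoc,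
        hUU', Matrix.one_mul]
    conv_lhs => rw [this, hconj]
    rfl
end

section
/- Let k, m ∈ ℕ with k ≥ 2, and let φ : ℋ_{2k}^0 → M_m be a real-linear map such that φ(I(ℋ_{2k}^0)) ⊆ 𝒰_m. Let H ∈ I(ℋ_{2(k−2)}^0), let K ∈ ℋ_2 ∩ 𝒰_2, Z ∈ 𝒰_2, let T be a 2(k−1)×2 complex matrix and V a 2(k−1)×2(k−2) complex matrix such that the 2(k−1)×2(k−1) matrix [V T] (columns of V followed by columns of T) is unitary. Form the trace-zero hermitian 2k×2k matrices M₁ = [[0, TZ],[(TZ)*, 0]] (block off-diagonal with blocks of sizes 2(k−1) and 2), M₂ = (TKT*) ⊕ (−Z*KZ), and M₃ = (VHV*) ⊕ 0_2. Then φ(M₁)*φ(M₁) = φ(M₂)*φ(M₂) = I_m − φ(M₃)*φ(M₃) and Re(φ(M₂)*φ(M₁)) = 0_m. -/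
open Matrix Kronecker

theorem castM_mul' {a b : ℕ} (h : a = b) (A B : Mat a) :
    castM h A * castM h B = castM h (A * B) := by subst h; rfl

theorem castM_add' {a b : ℕ} (h : a = b) (A B : Mat a) :
    castM h A + castM h B = castM h (A + B) := by subst h; rfl

theorem castM_one' {a b : ℕ} (h : a = b) : castM h (1 : Mat a) = 1 := by
  subst h; simp [castM]

theorem castM_zero' {a b : ℕ} (h : a = b) : castM h (0 : Mat a) = 0 := by
  subst h; rfl

theorem blks_mul' {a b : ℕ} (A : Matrix (Fin a) (Fin a) ℂ) (B : Matrix (Fin a) (Fin b) ℂ)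
    (C : Matrix (Fin b) (Fin a) ℂ) (D : Matrix (Fin b) (Fin b) ℂ)
    (A' : Matrix (Fin a) (Fin a) ℂ) (B' : Matrix (Fin a) (Fin b) ℂ)
    (C' : Matrix (Fin b) (Fin a) ℂ) (D' : Matrix (Fin b) (Fin b) ℂ) :
    blks A B C D * blks A' B' C' D' =
      blks (A * A' + B * C') (A * B' + B * D') (C * A' + D * C') (C * B' + D * D') := by
  simp [blks, Matrix.submatrix_mul_equiv, Matrix.fromBlocks_multiply]

theorem blks_add' {a b : ℕ} (A : Matrix (Fin a) (Fin a) ℂ) (B : Matrix (Fin a) (Fin b) ℂ)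
    (C : Matrix (Fin b) (Fin a) ℂ) (D : Matrix (Fin b) (Fin b) ℂ)
    (A' : Matrix (Fin a) (Fin a) ℂ) (B' : Matrix (Fin a) (Fin b) ℂ)
    (C' : Matrix (Fin b) (Fin a) ℂ) (D' : Matrix (Fin b) (Fin b) ℂ) :
    blks A B C D + blks A' B' C' D' = blks (A + A') (B + B') (C + C') (D + D') := by
  simp only [blks, ← Matrix.fromBlocks_add]; rfl

theorem blks_one' {a b : ℕ} : blks (1 : Mat a) 0 0 (1 : Mat b) = 1 := by
  simp [blks]

theorem blks_zero' {a b : ℕ} : blks (0 : Mat a) 0 0 (0 : Mat b) = 0 := by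
  simp [blks]

theorem cols_rel {n p : ℕ} (h : p + 2 = n) (V : Matrix (Fin n) (Fin p) ℂ)
    (T : Matrix (Fin n) (Fin 2) ℂ)
    (hVT : Matrix.reindex (Equiv.refl _) ((finSumFinEquiv).trans (finCongr h))
        (Matrix.fromCols V T) ∈ Matrix.unitaryGroup (Fin n) ℂ) :
    Vᴴ * V = 1 ∧ Vᴴ * T = 0 ∧ Tᴴ * V = 0 ∧ Tᴴ * T = 1 ∧ V * Vᴴ + T * Tᴴ = 1 := by
  subst h
  have h1 := Matrix.mem_unitaryGroup_iff'.1 hVT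
  have h2 := Matrix.mem_unitaryGroup_iff.1 hVT
  rw [Matrix.star_eq_conjTranspose, Matrix.conjTranspose_reindex] at h1 h2
  have e1 : (fromCols V T)ᴴ * fromCols V T = 1 := by
    simp only [Matrix.reindex_apply] at h1
    rw [Equiv.refl_symm, Equiv.coe_refl,
      ← Matrix.submatrix_mul _ _ _ id _ Function.bijective_id] at h1
    apply (Matrix.reindex (finSumFinEquiv.trans (finCongr rfl))
      (finSumFinEquiv.trans (finCongr rfl))).injective
    rw [Matrix.reindex_apply, Matrix.reindex_apply, Matrix.submatrix_one_equiv]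
    exact h1
  have e2 : fromCols V T * (fromCols V T)ᴴ = 1 := by
    simpa [Matrix.reindex_apply, Matrix.submatrix_mul_equiv] using h2
  rw [conjTranspose_fromCols_eq_fromRows_conjTranspose] at e1 e2
  rw [fromCols_mul_fromRows] at e2
  rw [fromRows_mul_fromCols, ← fromBlocks_one, fromBlocks_inj] at e1
  exact ⟨e1.1, e1.2.1, e1.2.2.1, e1.2.2.2, e2⟩

theorem core_alg {k m : ℕ} (φ : H0S k → Mat m) (hlin : IsLinearMap ℝ φ)
    (hu : ∀ A : H0S k, (A : Mat k) ∈ Matrix.unitaryGroup (Fin k) ℂ →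
      φ A ∈ Matrix.unitaryGroup (Fin m) ℂ) (X Y W : H0S k)
    (hX : (X : Mat k) * X + (W : Mat k) * W = 1)
    (hY : (Y : Mat k) * Y + (W : Mat k) * W = 1)
    (hXY : (X : Mat k) * Y + (Y : Mat k) * X = 0)
    (hXW : (X : Mat k) * W = 0) (hWX : (W : Mat k) * X = 0)
    (hYW : (Y : Mat k) * W = 0) (hWY : (W : Mat k) * Y = 0) :
    (φ X)ᴴ * (φ X) = (φ Y)ᴴ * (φ Y) ∧
      (φ X)ᴴ * (φ X) = 1 - (φ W)ᴴ * (φ W) ∧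
      MRe ((φ Y)ᴴ * (φ X)) = 0 := by
  have key : ∀ c s e : ℝ, c * c + s * s = 1 → e * e = 1 →
      (c • φ X + s • φ Y + e • φ W)ᴴ * (c • φ X + s • φ Y + e • φ W) = 1 := by
    intro c s e hcs he
    have hm := hu (c • X + s • Y + e • W) (by
      rw [Matrix.mem_unitaryGroup_iff', Matrix.star_eq_conjTranspose,
        (c • X + s • Y + e • W).2.1.eq]
      have hX' : (X : Mat k) * X = 1 - (W : Mat k) * W := eq_sub_of_add_eq hX
      have hY' : (Y : Mat k) * Y = 1 - (W : Mat k) * W := eq_sub_of_add_eq hY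
      have hXY' : (X : Mat k) * Y = - ((Y : Mat k) * X) := eq_neg_of_add_eq_zero_left hXY
      simp only [Submodule.coe_add, Submodule.coe_smul, add_mul, mul_add, smul_mul_assoc,
        mul_smul_comm, hXW, hWX, hYW, hWY, hX', hY', hXY', smul_smul, smul_zero, he]
      linear_combination (norm := module)
        hcs • (1 - (W : Mat k) * (W : Mat k)) + he • ((W : Mat k) * (W : Mat k)))
    rw [hlin.map_add, hlin.map_add, hlin.map_smul, hlin.map_smul, hlin.map_smul] at hm
    exact Matrix.mem_unitaryGroup_iff'.1 hm
  have k1 := key 1 0 1 (by norm_num) (by norm_num)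
  have k2 := key 1 0 (-1) (by norm_num) (by norm_num)
  have k3 := key 0 1 1 (by norm_num) (by norm_num)
  have k4 := key 0 1 (-1) (by norm_num) (by norm_num)
  have k5 := key (3/5) (4/5) 1 (by norm_num) (by norm_num)
  have k6 := key (3/5) (4/5) (-1) (by norm_num) (by norm_num)
  simp only [conjTranspose_add, conjTranspose_smul, star_trivial, add_mul, mul_add,
    smul_mul_assoc, mul_smul_comm] at k1 k2 k3 k4 k5 k6
  generalize φ X = a at *
  generalize φ Y = b at *
  generalize φ W = c at *
  have r1 : aᴴ * a = 1 - cᴴ * c := by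
    linear_combination (norm := module) (1/2 : ℝ) • k1 + (1/2 : ℝ) • k2
  have r2 : bᴴ * b = 1 - cᴴ * c := by
    linear_combination (norm := module) (1/2 : ℝ) • k3 + (1/2 : ℝ) • k4
  have r3 : aᴴ * b + bᴴ * a = 0 := by
    linear_combination (norm := module) (25/24 : ℝ) • k5 + (25/24 : ℝ) • k6 - (3/4 : ℝ) • r1 - (4/3 : ℝ) • r2
  refine ⟨r1.trans r2.symm, r1, ?_⟩
  simp only [MRe, conjTranspose_mul, conjTranspose_conjTranspose]
  rw [add_comm, r3, smul_zero]

/-- Lemma `toto`. -/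
theorem stmt15 (k m : ℕ) (hk : 2 ≤ k) (hm : 0 < m)
    (φ : H0S (2 * k) → Mat m) (hlin : IsLinearMap ℝ φ)
    (hu : ∀ A : H0S (2 * k), (A : Mat (2 * k)) ∈ Matrix.unitaryGroup (Fin (2 * k)) ℂ →
      φ A ∈ Matrix.unitaryGroup (Fin m) ℂ)
    (Hm : Mat (2 * (k - 2))) (hH : Hm.IsHermitian) (hH0 : Hm.trace = 0)
    (hHu : Hm ∈ Matrix.unitaryGroup (Fin (2 * (k - 2))) ℂ)
    (K : Mat 2) (hKh : K.IsHermitian) (hKu : K ∈ Matrix.unitaryGroup (Fin 2) ℂ)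
    (Z : Mat 2) (hZ : Z ∈ Matrix.unitaryGroup (Fin 2) ℂ)
    (T : Matrix (Fin (2 * (k - 1))) (Fin 2) ℂ)
    (V : Matrix (Fin (2 * (k - 1))) (Fin (2 * (k - 2))) ℂ)
    (hVT : Matrix.reindex (Equiv.refl _)
        ((finSumFinEquiv).trans (finCongr (show 2 * (k - 2) + 2 = 2 * (k - 1) by omega)))
        (Matrix.fromCols V T) ∈ Matrix.unitaryGroup (Fin (2 * (k - 1))) ℂ) :
    ∀ N₁ N₂ N₃ : H0S (2 * k),
      (N₁ : Mat (2 * k)) = castM (show 2 * (k - 1) + 2 = 2 * k by omega)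
        (blks 0 (T * Z) (T * Z)ᴴ 0) →
      (N₂ : Mat (2 * k)) = castM (show 2 * (k - 1) + 2 = 2 * k by omega)
        (blks (T * K * Tᴴ) 0 0 (-(Zᴴ * K * Z))) →
      (N₃ : Mat (2 * k)) = castM (show 2 * (k - 1) + 2 = 2 * k by omega)
        (blks (V * Hm * Vᴴ) 0 0 (0 : Mat 2)) →
      (φ N₁)ᴴ * (φ N₁) = (φ N₂)ᴴ * (φ N₂) ∧
      (φ N₁)ᴴ * (φ N₁) = 1 - (φ N₃)ᴴ * (φ N₃) ∧
      MRe ((φ N₂)ᴴ * (φ N₁)) = 0 := by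
  intro N₁ N₂ N₃ h1 h2 h3
  obtain ⟨hVV, hVT', hTV, hTT, hC⟩ := cols_rel _ V T hVT
  have hKK : K * K = 1 := by
    have := Matrix.mem_unitaryGroup_iff.1 hKu
    rwa [Matrix.star_eq_conjTranspose, hKh.eq] at this
  have hHH : Hm * Hm = 1 := by
    have := Matrix.mem_unitaryGroup_iff.1 hHu
    rwa [Matrix.star_eq_conjTranspose, hH.eq] at this
  have hZ1 : Z * Zᴴ = 1 := Matrix.mem_unitaryGroup_iff.1 hZ
  have hZ2 : Zᴴ * Z = 1 := Matrix.mem_unitaryGroup_iff'.1 hZ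
  have aTT : ∀ {q : ℕ} (M : Matrix (Fin 2) (Fin q) ℂ), Tᴴ * (T * M) = M := fun M => by
    rw [← Matrix.mul_assoc, hTT, Matrix.one_mul]
  have aVV : ∀ {q : ℕ} (M : Matrix (Fin (2 * (k - 2))) (Fin q) ℂ), Vᴴ * (V * M) = M := fun M => by
    rw [← Matrix.mul_assoc, hVV, Matrix.one_mul]
  have aVT : ∀ {q : ℕ} (M : Matrix (Fin 2) (Fin q) ℂ), Vᴴ * (T * M) = 0 := fun M => by
    rw [← Matrix.mul_assoc, hVT', Matrix.zero_mul]
  have aTV : ∀ {q : ℕ} (M : Matrix (Fin (2 * (k - 2))) (Fin q) ℂ), Tᴴ * (V * M) = 0 := fun M => by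
    rw [← Matrix.mul_assoc, hTV, Matrix.zero_mul]
  have aKK : ∀ {q : ℕ} (M : Matrix (Fin 2) (Fin q) ℂ), K * (K * M) = M := fun M => by
    rw [← Matrix.mul_assoc, hKK, Matrix.one_mul]
  have aHH : ∀ {q : ℕ} (M : Matrix (Fin (2 * (k - 2))) (Fin q) ℂ), Hm * (Hm * M) = M := fun M => by
    rw [← Matrix.mul_assoc, hHH, Matrix.one_mul]
  have aZ1 : ∀ {q : ℕ} (M : Matrix (Fin 2) (Fin q) ℂ), Z * (Zᴴ * M) = M := fun M => by
    rw [← Matrix.mul_assoc, hZ1, Matrix.one_mul]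
  have hC' : T * Tᴴ + V * Vᴴ = 1 := by rw [add_comm]; exact hC
  apply core_alg φ hlin hu N₁ N₂ N₃ <;> simp only [h1, h2, h3] <;>
    simp [castM_mul', castM_add', blks_mul', blks_add', Matrix.mul_assoc, conjTranspose_mul,
      hVV, hVT', hTV, hTT, hKK, hHH, hZ1, hZ2, aTT, aVV, aVT, aTV, aKK, aHH, aZ1, hC',
      blks_one', blks_zero', castM_one', castM_zero']
end

section
/- Let k, q ∈ ℕ with k ≥ 2, and let φ : ℋ_{2k}^0 → M_{2q} be a real-linear map such that φ(I(ℋ_{2k}^0)) ⊆ 𝒰_{2q}, and suppose there exist U, V ∈ 𝒰_{2q} such that φ(A ⊕ B) = U(B ⊗ I_q)V for all A ∈ ℋ_{2(k−1)}^0 and B ∈ ℋ_2^0. Then there exists a real-linear map ψ : M_{2(k−1)} → ℋ_q such that ψ(𝒰_{2(k−1)}) ⊆ ℋ_q ∩ 𝒰_q. -/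
open Matrix Kronecker

lemma aux_block {q : ℕ} (Y : Matrix (Fin 2 × Fin q) (Fin 2 × Fin q) ℂ)
    (hY : Y * Yᴴ = 1)
    (h : ∀ B : Mat 2, B.IsHermitian → B.trace = 0 → B * B = 1 →
      (B ⊗ₖ (1 : Mat q)) * Yᴴ + Y * (B ⊗ₖ (1 : Mat q)) = 0) :
    (∀ i j, star (Y (0, j) (0, i)) = - Y (0, i) (0, j)) ∧
      (Y.submatrix (fun i : Fin q => ((0 : Fin 2), i)) (fun i : Fin q => ((0 : Fin 2), i))) *
      (Y.submatrix (fun i : Fin q => ((0 : Fin 2), i)) (fun i : Fin q => ((0 : Fin 2), i)))ᴴ = 1 := by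
  have e : ∀ B : Mat 2, B.IsHermitian → B.trace = 0 → B * B = 1 → ∀ s t i j,
      B s 0 * star (Y (t, j) (0, i)) + B s 1 * star (Y (t, j) (1, i))
        + (Y (s, i) (0, j) * B 0 t + Y (s, i) (1, j) * B 1 t) = 0 := by
    intro B h1 h2 h3 s t i j
    have := congrFun (congrFun (h B h1 h2 h3) (s, i)) (t, j)
    simpa [Matrix.mul_apply, Fintype.sum_prod_type, Matrix.one_apply, Fin.sum_univ_two] using this
  have ez := e !![1, 0; 0, -1]
    (by ext i j; fin_cases i <;> fin_cases j <;> simp) (by simp [Matrix.trace_fin_two])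
    (by ext i j; fin_cases i <;> fin_cases j <;> simp [Matrix.mul_apply, Fin.sum_univ_two])
  have ex := e !![0, 1; 1, 0]
    (by ext i j; fin_cases i <;> fin_cases j <;> simp) (by simp [Matrix.trace_fin_two])
    (by ext i j; fin_cases i <;> fin_cases j <;> simp [Matrix.mul_apply, Fin.sum_univ_two])
  have ey := e !![0, -Complex.I; Complex.I, 0]
    (by ext i j; fin_cases i <;> fin_cases j <;> simp) (by simp [Matrix.trace_fin_two])
    (by ext i j; fin_cases i <;> fin_cases j <;> simp [Matrix.mul_apply, Fin.sum_univ_two])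
  have hb : ∀ i j, Y (0, i) (1, j) = 0 := by
    intro i j
    have h1 := ex 0 0 i j
    have h2 := ey 0 0 i j
    simp at h1 h2
    have h3 : Complex.I * (2 * Y (0, i) (1, j)) = 0 := by
      linear_combination h2 + Complex.I * h1
    simpa using h3
  refine ⟨fun i j => ?_, ?_⟩
  · have h1 := ez 0 0 i j
    simp at h1
    simpa using eq_neg_of_add_eq_zero_left h1
  · ext i j
    have h1 := congrFun (congrFun hY (0, i)) (0, j)
    simpa [Matrix.mul_apply, Fintype.sum_prod_type, Matrix.one_apply, Fin.sum_univ_two, hb] using h1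

/-- diagonal alternating entries, zero in the first two positions. -/
noncomputable def auxD (n : ℕ) : Mat n := Matrix.diagonal (fun i => if i.val < 2 then 0 else (-1) ^ i.val)

noncomputable def auxJ (n : ℕ) : Matrix (Fin n) (Fin 2) ℂ := fun i j => if i.val = j.val then 1 else 0

lemma auxD_herm (n : ℕ) : (auxD n)ᴴ = auxD n := by
  unfold auxD
  rw [Matrix.diagonal_conjTranspose]
  congr 1; ext i
  simp only [Pi.star_apply]
  split_ifs <;> simp

lemma auxD_trace (m : ℕ) : (auxD (2 * (m + 1))).trace = 0 := by
  unfold auxD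
  rw [Matrix.trace_diagonal, Fin.sum_univ_eq_sum_range (fun i => if i < 2 then (0:ℂ) else (-1) ^ i)]
  induction m with
  | zero => simp [Finset.sum_range_succ]
  | succ m ih =>
    rw [show 2 * (m + 1 + 1) = 2 * (m + 1) + 1 + 1 by ring, Finset.sum_range_succ,
      Finset.sum_range_succ, ih, if_neg (by omega), if_neg (by omega)]
    ring

lemma auxDJ (n : ℕ) : auxD n * auxJ n = 0 := by
  ext i j
  simp only [auxD, auxJ, Matrix.diagonal_mul, Matrix.zero_apply]
  split_ifs <;> first | (exfalso; omega) | simp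

lemma auxJJ (m : ℕ) : (auxJ (2 * (m + 1)))ᴴ * auxJ (2 * (m + 1)) = 1 := by
  ext i j
  simp only [auxJ, Matrix.mul_apply, Matrix.conjTranspose_apply, Matrix.one_apply]
  have hi := i.2
  rw [Finset.sum_eq_single (⟨i.val, by omega⟩ : Fin (2 * (m + 1)))]
  · simp [Fin.ext_iff]
  · intro b _ hb
    rw [if_neg (fun h => hb (Fin.ext h))]; simp
  · simp

lemma auxDD (n : ℕ) : auxD n * auxD n + auxJ n * (auxJ n)ᴴ = 1 := by
  ext i j
  simp only [auxJ, auxD, Matrix.diagonal_mul_diagonal, Matrix.add_apply, Matrix.mul_apply,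
    Matrix.conjTranspose_apply, Matrix.one_apply, Fin.sum_univ_two, Matrix.diagonal_apply]
  by_cases h : i = j
  · subst h
    rcases Nat.lt_or_ge i.val 2 with h2 | h2
    · have : i.val = 0 ∨ i.val = 1 := by omega
      rcases this with h | h <;> simp [h]
    · simp [show ¬ i.val < 2 by omega, show i.val ≠ 0 by omega, show i.val ≠ 1 by omega,
        ← mul_pow]
  · have h' : i.val ≠ j.val := fun hh => h (Fin.ext hh)
    simp only [if_neg h, zero_add]
    by_cases h0 : i.val = 0 <;> by_cases h1 : i.val = 1
    · omega
    · have : j.val ≠ 0 := by omega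
      simp [h0, this]
    · have : j.val ≠ 1 := by omega
      simp [h1, this]
    · simp [h0, h1]

/-- abstract existence of the isometry and complement. -/
lemma aux_E (m : ℕ) (W : Mat (2 * (m + 1))) (hW : W ∈ Matrix.unitaryGroup (Fin (2 * (m + 1))) ℂ) :
    (W * auxJ (2 * (m + 1)))ᴴ * (W * auxJ (2 * (m + 1))) = 1 ∧ ∃ E : Mat (2 * (m + 1)), Eᴴ = E ∧ E.trace = 0 ∧
      E * (W * auxJ (2 * (m + 1))) = 0 ∧ E * E + (W * auxJ (2 * (m + 1))) * (W * auxJ (2 * (m + 1)))ᴴ = 1 := by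
  have h1 : Wᴴ * W = 1 := Matrix.mem_unitaryGroup_iff'.1 hW
  have h2 : W * Wᴴ = 1 := Matrix.mem_unitaryGroup_iff.1 hW
  refine ⟨?_, W * auxD _ * Wᴴ, ?_, ?_, ?_, ?_⟩
  · rw [Matrix.conjTranspose_mul, Matrix.mul_assoc, ← Matrix.mul_assoc _ W, h1, Matrix.one_mul, auxJJ]
  · simp [Matrix.conjTranspose_mul, auxD_herm, Matrix.mul_assoc]
  · rw [Matrix.trace_mul_comm, ← Matrix.mul_assoc, h1, Matrix.one_mul, auxD_trace]
  · rw [Matrix.mul_assoc, ← Matrix.mul_assoc _ W, h1, Matrix.one_mul, Matrix.mul_assoc, auxDJ,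
      Matrix.mul_zero]
  · have : W * auxD _ * Wᴴ * (W * auxD _ * Wᴴ) = W * (auxD _ * auxD _) * Wᴴ := by
      calc _ = W * auxD _ * (Wᴴ * W) * auxD _ * Wᴴ := by simp only [Matrix.mul_assoc]
        _ = _ := by rw [h1]; simp only [Matrix.mul_one, Matrix.mul_assoc]
    rw [this, Matrix.conjTranspose_mul]
    calc _ = W * (auxD _ * auxD _ + auxJ (2 * (m + 1)) * (auxJ (2 * (m + 1)))ᴴ) * Wᴴ := by
            simp only [Matrix.mul_add, Matrix.add_mul, Matrix.mul_assoc]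
      _ = 1 := by rw [auxDD, Matrix.mul_one, h2]

/-- The key involution. -/
lemma aux_sq {n : ℕ} (X : Matrix (Fin n) (Fin 2) ℂ) (E : Mat n) (B : Mat 2) (c s : ℝ)
    (hcs : c ^ 2 + s ^ 2 = 1) (hX : Xᴴ * X = 1) (hE : Eᴴ = E) (hEX : E * X = 0)
    (hEE : E * E + X * Xᴴ = 1) (hB : B.IsHermitian) (hBB : B * B = 1) :
    let M := Matrix.fromBlocks (E - c • (X * B * Xᴴ)) (s • X) (s • Xᴴ) (c • B)
    M * M = 1 ∧ Mᴴ = M := by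
  have hXE : Xᴴ * E = 0 := by
    have := congrArg Matrix.conjTranspose hEX
    simpa [Matrix.conjTranspose_mul, hE] using this
  have hA : X * B * Xᴴ * (X * B * Xᴴ) = X * Xᴴ := by
    calc _ = X * (B * (Xᴴ * X) * B) * Xᴴ := by simp only [Matrix.mul_assoc]
      _ = _ := by rw [hX, Matrix.mul_one, hBB, Matrix.mul_one]
  have hEA : E * (X * B * Xᴴ) = 0 := by
    rw [← Matrix.mul_assoc, ← Matrix.mul_assoc, hEX]; simp
  have hAE : (X * B * Xᴴ) * E = 0 := by
    rw [Matrix.mul_assoc, hXE]; simp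
  have hAX : X * B * Xᴴ * X = X * B := by rw [Matrix.mul_assoc, hX, Matrix.mul_one]
  have hXA : Xᴴ * (X * B * Xᴴ) = B * Xᴴ := by
    rw [← Matrix.mul_assoc, ← Matrix.mul_assoc, hX, Matrix.one_mul]
  intro M
  constructor
  · simp only [M]
    rw [Matrix.fromBlocks_multiply, ← Matrix.fromBlocks_one]
    congr 1
    · simp only [Matrix.sub_mul, Matrix.mul_sub, Matrix.smul_mul, Matrix.mul_smul, hA, hEA, hAE, smul_zero,
        sub_zero, zero_sub, smul_smul]
      rw [← hEE]
      have : X * Xᴴ = (c * c) • (X * Xᴴ) + (s * s) • (X * Xᴴ) := by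
        rw [← add_smul, ← sq, ← sq, hcs, one_smul]
      conv_rhs => rw [this]
      module
    · simp only [Matrix.sub_mul, Matrix.smul_mul, Matrix.mul_smul, hEX, hAX, smul_smul]
      module
    · simp only [Matrix.mul_sub, Matrix.smul_mul, Matrix.mul_smul, hXE, hXA, smul_smul]
      module
    · simp only [Matrix.smul_mul, Matrix.mul_smul, hX, hBB, smul_smul]
      rw [← add_smul, ← sq, ← sq, add_comm, hcs, one_smul]
  · simp only [M]
    rw [Matrix.fromBlocks_conjTranspose]
    have hB' : Bᴴ = B := hB
    simp [Matrix.conjTranspose_smul, Matrix.conjTranspose_mul, hE, hB', Matrix.mul_assoc]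

def aemb {a b N : ℕ} (h : a + b = N) (M : Matrix (Fin a ⊕ Fin b) (Fin a ⊕ Fin b) ℂ) : Mat N :=
  M.submatrix (finSumFinEquiv.trans (finCongr h)).symm (finSumFinEquiv.trans (finCongr h)).symm

lemma aemb_dsum {a b N : ℕ} (h : a + b = N) (A : Mat a) (B : Mat b) :
    aemb h (Matrix.fromBlocks A 0 0 B) = castM h (dsum A B) := rfl

lemma aemb_mem {a b N : ℕ} (h : a + b = N) (M : Matrix (Fin a ⊕ Fin b) (Fin a ⊕ Fin b) ℂ)
    (hM : Mᴴ = M) (ht : M.trace = 0) : aemb h M ∈ H0S N := by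
  refine ⟨?_, ?_⟩
  · unfold aemb Matrix.IsHermitian
    rw [Matrix.conjTranspose_submatrix, hM]
  · subst h
    rw [← ht]
    unfold aemb Matrix.trace
    exact Equiv.sum_comp (finSumFinEquiv.trans (finCongr rfl)).symm (fun i => M.diag i)

lemma aemb_unitary {a b N : ℕ} (h : a + b = N) (M : Matrix (Fin a ⊕ Fin b) (Fin a ⊕ Fin b) ℂ)
    (hM : Mᴴ = M) (ht : M * M = 1) : aemb h M ∈ Matrix.unitaryGroup (Fin N) ℂ := by
  rw [Matrix.mem_unitaryGroup_iff, Matrix.star_eq_conjTranspose]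
  unfold aemb
  rw [Matrix.conjTranspose_submatrix, hM, Matrix.submatrix_mul_equiv, ht, Matrix.submatrix_one_equiv]

lemma aux_tr {a b : ℕ} (A : Mat a) (B : Matrix (Fin a) (Fin b) ℂ) (C : Matrix (Fin b) (Fin a) ℂ)
    (D : Mat b) : (Matrix.fromBlocks A B C D).trace = A.trace + D.trace := by
  simp [Matrix.trace, Fintype.sum_sum_type]

lemma aemb_add {a b N : ℕ} (h : a + b = N) (M M' : Matrix (Fin a ⊕ Fin b) (Fin a ⊕ Fin b) ℂ) :
    aemb h (M + M') = aemb h M + aemb h M' := rfl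

lemma aemb_smul {a b N : ℕ} (h : a + b = N) (r : ℝ)
    (M : Matrix (Fin a ⊕ Fin b) (Fin a ⊕ Fin b) ℂ) :
    aemb h (r • M) = r • aemb h M := rfl

noncomputable def aoff {n N : ℕ} (h : n + 2 = N) (X : Matrix (Fin n) (Fin 2) ℂ) : H0S N :=
  ⟨aemb h (Matrix.fromBlocks 0 X Xᴴ 0), aemb_mem h _ (by simp [Matrix.fromBlocks_conjTranspose])
    (by simp [aux_tr])⟩

lemma aoff_add {n N : ℕ} (h : n + 2 = N) (X Y : Matrix (Fin n) (Fin 2) ℂ) :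
    aoff h (X + Y) = aoff h X + aoff h Y := by
  apply Subtype.ext
  simp only [aoff, Submodule.coe_add]
  rw [← aemb_add]
  simp [Matrix.fromBlocks_add]

lemma aoff_smul {n N : ℕ} (h : n + 2 = N) (r : ℝ) (X : Matrix (Fin n) (Fin 2) ℂ) :
    aoff h (r • X) = r • aoff h X := by
  apply Subtype.ext
  simp only [aoff, Submodule.coe_smul]
  rw [← aemb_smul]
  simp [Matrix.fromBlocks_smul, Matrix.conjTranspose_smul]

lemma core2 (m q N : ℕ) (h : 2 * (m + 1) + 2 = N)
    (T : H0S N →ₗ[ℝ] Matrix (Fin 2 × Fin q) (Fin 2 × Fin q) ℂ)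
    (hu : ∀ A : H0S N, (A : Mat N) ∈ Matrix.unitaryGroup (Fin N) ℂ → T A * (T A)ᴴ = 1)
    (hform : ∀ (A : H0S (2 * (m + 1))) (B : H0S 2) (C : H0S N),
        (C : Mat N) = castM h (dsum (A : Mat (2 * (m + 1))) (B : Mat 2)) →
        T C = (B : Mat 2) ⊗ₖ (1 : Mat q)) (W : Mat (2 * (m + 1)))
    (hW : W ∈ Matrix.unitaryGroup (Fin (2 * (m + 1))) ℂ) :
    T (aoff h (W * auxJ (2 * (m + 1)))) * (T (aoff h (W * auxJ (2 * (m + 1)))))ᴴ = 1 ∧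
     ∀ B : Mat 2, B.IsHermitian → B.trace = 0 → B * B = 1 →
      (B ⊗ₖ (1 : Mat q)) * (T (aoff h (W * auxJ (2 * (m + 1)))))ᴴ + T (aoff h (W * auxJ (2 * (m + 1)))) * (B ⊗ₖ (1 : Mat q)) = 0 := by
  obtain ⟨hX, E, hE, hEt, hEX, hEE⟩ := aux_E m W hW
  generalize W * auxJ (2 * (m + 1)) = X at *
  generalize hY : T (aoff h X) = Y
  have key : ∀ B : Mat 2, B.IsHermitian → B.trace = 0 → B * B = 1 → ∀ c s : ℝ, c ^ 2 + s ^ 2 = 1 →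
      (c • (B ⊗ₖ (1 : Mat q)) + s • Y) * (c • (B ⊗ₖ (1 : Mat q)) + s • Yᴴ) = 1 := by
    intro B hB hBt hBB c s hcs
    obtain ⟨h1, h2⟩ := aux_sq X E B c s hcs hX hE hEX hEE hB hBB
    have hB' : Bᴴ = B := hB
    have hAt : (E - c • (X * B * Xᴴ)).trace = 0 := by
      rw [Matrix.trace_sub, Matrix.trace_smul, Matrix.trace_mul_comm, ← Matrix.mul_assoc, hX,
        Matrix.one_mul, hEt, hBt]
      simp
    have hAh : (E - c • (X * B * Xᴴ))ᴴ = E - c • (X * B * Xᴴ) := by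
      simp [Matrix.conjTranspose_smul, Matrix.conjTranspose_mul, hE, hB', Matrix.mul_assoc]
    let A' : H0S (2 * (m + 1)) := ⟨E - c • (X * B * Xᴴ), hAh, hAt⟩
    let B' : H0S 2 := c • ⟨B, hB, hBt⟩
    have hBv : (B' : Mat 2) = c • B := rfl
    let D : H0S N := ⟨aemb h (Matrix.fromBlocks (E - c • (X * B * Xᴴ)) 0 0 (c • B)),
      aemb_mem h _ (by rw [Matrix.fromBlocks_conjTranspose, hAh]; simp [Matrix.conjTranspose_smul, hB'])
        (by rw [aux_tr, hAt, Matrix.trace_smul, hBt]; simp)⟩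
    have hD : T D = (c • B) ⊗ₖ (1 : Mat q) := hform A' B' D rfl
    have hC : ((D + s • aoff h X : H0S N) : Mat N) = aemb h
        (Matrix.fromBlocks (E - c • (X * B * Xᴴ)) (s • X) (s • Xᴴ) (c • B)) := by
      simp only [D, aoff, Submodule.coe_add, Submodule.coe_smul]
      rw [← aemb_smul, ← aemb_add]
      simp [Matrix.fromBlocks_smul, Matrix.fromBlocks_add]
    have hun := hu (D + s • aoff h X) (by rw [hC]; exact aemb_unitary h _ h2 h1)
    rw [map_add, map_smul, hD, hY, Matrix.smul_kronecker] at hun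
    simpa [Matrix.conjTranspose_add, Matrix.conjTranspose_smul, Matrix.conjTranspose_kronecker, hB']
      using hun
  have hYY : Y * Yᴴ = 1 := by
    have := key !![1, 0; 0, -1]
      (by ext i j; fin_cases i <;> fin_cases j <;> simp) (by simp [Matrix.trace_fin_two])
      (by ext i j; fin_cases i <;> fin_cases j <;> simp [Matrix.mul_apply, Fin.sum_univ_two])
      0 1 (by norm_num)
    simpa using this
  refine ⟨hYY, fun B hB hBt hBB => ?_⟩
  have h1 := key B hB hBt hBB (3/5) (4/5) (by norm_num)
  have hPP : (B ⊗ₖ (1 : Mat q)) * (B ⊗ₖ (1 : Mat q)) = 1 := by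
    rw [← Matrix.mul_kronecker_mul, hBB]; simp
  generalize B ⊗ₖ (1 : Mat q) = P at *
  simp only [Matrix.mul_add, Matrix.add_mul, Matrix.smul_mul, Matrix.mul_smul, hPP, hYY] at h1
  have h2 : ((12 : ℝ) / 25) • (P * Yᴴ + Y * P) = 0 := by
    have h3 := sub_eq_zero.2 h1
    rw [← h3]
    module
  exact (smul_eq_zero.1 h2).resolve_left (by norm_num)

lemma core (m q N : ℕ) (h : 2 * (m + 1) + 2 = N)
    (φ : H0S N → Mat (2 * q)) (hlin : IsLinearMap ℝ φ)
    (hu : ∀ A : H0S N, (A : Mat N) ∈ Matrix.unitaryGroup (Fin N) ℂ →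
      φ A ∈ Matrix.unitaryGroup (Fin (2 * q)) ℂ)
    (hform : ∃ U V : Mat (2 * q),
      U ∈ Matrix.unitaryGroup (Fin (2 * q)) ℂ ∧ V ∈ Matrix.unitaryGroup (Fin (2 * q)) ℂ ∧
      ∀ (A : H0S (2 * (m + 1))) (B : H0S 2) (C : H0S N),
        (C : Mat N) = castM h (dsum (A : Mat (2 * (m + 1))) (B : Mat 2)) →
        φ C = U * kron (B : Mat 2) (1 : Mat q) * V) :
    ∃ ψ : Mat (2 * (m + 1)) → HermS q, IsLinearMap ℝ ψ ∧
      ∀ W : Mat (2 * (m + 1)), W ∈ Matrix.unitaryGroup (Fin (2 * (m + 1))) ℂ →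
        (ψ W : Mat q) ∈ Matrix.unitaryGroup (Fin q) ℂ := by
  obtain ⟨U, V, hU, hV, hf⟩ := hform
  have hU1 : Uᴴ * U = 1 := Matrix.mem_unitaryGroup_iff'.1 hU
  have hV1 : V * Vᴴ = 1 := Matrix.mem_unitaryGroup_iff.1 hV
  have hV2 : Vᴴ * V = 1 := Matrix.mem_unitaryGroup_iff'.1 hV
  let T : H0S N →ₗ[ℝ] Matrix (Fin 2 × Fin q) (Fin 2 × Fin q) ℂ :=
    { toFun := fun C => (Uᴴ * φ C * Vᴴ).submatrix finProdFinEquiv finProdFinEquiv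
      map_add' := fun x y => by
        rw [hlin.map_add, Matrix.mul_add, Matrix.add_mul, Matrix.submatrix_add]; rfl
      map_smul' := fun r x => by
        rw [hlin.map_smul, Matrix.mul_smul, Matrix.smul_mul, Matrix.submatrix_smul]; rfl }
  have hTu : ∀ A : H0S N, (A : Mat N) ∈ Matrix.unitaryGroup (Fin N) ℂ → T A * (T A)ᴴ = 1 := by
    intro A hA
    have h1 : φ A * (φ A)ᴴ = 1 := Matrix.mem_unitaryGroup_iff.1 (hu A hA)
    change (Uᴴ * φ A * Vᴴ).submatrix _ _ * ((Uᴴ * φ A * Vᴴ).submatrix _ _)ᴴ = 1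
    rw [Matrix.conjTranspose_submatrix, Matrix.submatrix_mul_equiv]
    have : Uᴴ * φ A * Vᴴ * (Uᴴ * φ A * Vᴴ)ᴴ = 1 := by
      simp only [Matrix.conjTranspose_mul, Matrix.conjTranspose_conjTranspose]
      calc _ = Uᴴ * (φ A * (Vᴴ * V) * (φ A)ᴴ) * U := by simp only [Matrix.mul_assoc]
        _ = 1 := by rw [hV2, Matrix.mul_one, h1, Matrix.mul_one, hU1]
    rw [this, Matrix.submatrix_one_equiv]
  have hTf : ∀ (A : H0S (2 * (m + 1))) (B : H0S 2) (C : H0S N),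
        (C : Mat N) = castM h (dsum (A : Mat (2 * (m + 1))) (B : Mat 2)) →
        T C = (B : Mat 2) ⊗ₖ (1 : Mat q) := by
    intro A B C hC
    change (Uᴴ * φ C * Vᴴ).submatrix _ _ = _
    rw [hf A B C hC]
    have : Uᴴ * (U * kron (B : Mat 2) (1 : Mat q) * V) * Vᴴ = kron (B : Mat 2) (1 : Mat q) := by
      calc _ = (Uᴴ * U) * kron (B : Mat 2) (1 : Mat q) * (V * Vᴴ) := by simp only [Matrix.mul_assoc]
        _ = _ := by rw [hU1, hV1, Matrix.one_mul, Matrix.mul_one]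
    rw [this]
    ext i j
    simp [kron]
  have hmain := core2 m q N h T hTu hTf
  let bl : Mat (2 * (m + 1)) → Mat q := fun W => Complex.I •
    (T (aoff h (W * auxJ (2 * (m + 1))))).submatrix (fun i : Fin q => ((0 : Fin 2), i)) (fun i : Fin q => ((0 : Fin 2), i))
  have bl_add : ∀ x y, bl (x + y) = bl x + bl y := by
    intro x y
    simp only [bl]
    rw [Matrix.add_mul, aoff_add, map_add, Matrix.submatrix_add]
    exact smul_add _ _ _
  have bl_smul : ∀ (r : ℝ) x, bl (r • x) = r • bl x := by
    intro r x
    simp only [bl]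
    rw [Matrix.smul_mul, aoff_smul, map_smul, Matrix.submatrix_smul]
    exact smul_comm Complex.I r (_ : Mat q)
  refine ⟨fun W => ⟨(2⁻¹ : ℝ) • (bl W + (bl W)ᴴ), ?_⟩, ⟨?_, ?_⟩, ?_⟩
  · change ((2⁻¹ : ℝ) • (bl W + (bl W)ᴴ))ᴴ = _
    simp [Matrix.conjTranspose_smul, add_comm]
  · intro x y
    apply Subtype.ext
    simp only [bl_add, Submodule.coe_add, Matrix.conjTranspose_add]
    module
  · intro r x
    apply Subtype.ext
    simp only [bl_smul, Submodule.coe_smul, Matrix.conjTranspose_smul, star_trivial]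
    module
  · intro W hW
    obtain ⟨h1, h2⟩ := hmain W hW
    obtain ⟨h3, h4⟩ := aux_block _ h1 h2
    have hbl : (bl W)ᴴ = bl W := by
      ext i j
      have := h3 i j
      simp only [bl, Matrix.conjTranspose_apply, Matrix.smul_apply, Matrix.submatrix_apply,
        smul_eq_mul, star_mul', this]
      simp
    have hv : (2⁻¹ : ℝ) • (bl W + (bl W)ᴴ) = bl W := by
      rw [hbl]; module
    simp only [hv]
    rw [Matrix.mem_unitaryGroup_iff, Matrix.star_eq_conjTranspose]
    simp only [bl, Matrix.conjTranspose_smul, Matrix.smul_mul, Matrix.mul_smul, h4, smul_smul]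
    simp

/-- Lemma `kq`. -/
theorem stmt16 (k q : ℕ) (hk : 2 ≤ k) (hq : 0 < q)
    (φ : H0S (2 * k) → Mat (2 * q)) (hlin : IsLinearMap ℝ φ)
    (hu : ∀ A : H0S (2 * k), (A : Mat (2 * k)) ∈ Matrix.unitaryGroup (Fin (2 * k)) ℂ →
      φ A ∈ Matrix.unitaryGroup (Fin (2 * q)) ℂ)
    (hform : ∃ U V : Mat (2 * q),
      U ∈ Matrix.unitaryGroup (Fin (2 * q)) ℂ ∧ V ∈ Matrix.unitaryGroup (Fin (2 * q)) ℂ ∧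
      ∀ (A : H0S (2 * (k - 1))) (B : H0S 2) (C : H0S (2 * k)),
        (C : Mat (2 * k)) = castM (show 2 * (k - 1) + 2 = 2 * k by omega)
          (dsum (A : Mat (2 * (k - 1))) (B : Mat 2)) →
        φ C = U * kron (B : Mat 2) (1 : Mat q) * V) :
    ∃ ψ : Mat (2 * (k - 1)) → HermS q, IsLinearMap ℝ ψ ∧
      ∀ W : Mat (2 * (k - 1)), W ∈ Matrix.unitaryGroup (Fin (2 * (k - 1))) ℂ →
        (ψ W : Mat q) ∈ Matrix.unitaryGroup (Fin q) ℂ := by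
  obtain ⟨m, rfl⟩ : ∃ m, k = m + 2 := ⟨k - 2, by omega⟩
  exact core m q (2 * (m + 2)) (by omega) φ hlin hu hform
end

section
/- Let k, m ∈ ℕ be such that there exists a real-linear map φ : ℋ_{2k}^0 → M_m with φ(I(ℋ_{2k}^0)) ⊆ 𝒰_m. Then m ≥ 2k. -/
open Matrix Kronecker

theorem ext_frame {n ι κ : Type} [Fintype n] [DecidableEq n] [Fintype ι] [DecidableEq ι] [Fintype κ] [DecidableEq κ]
    (V : Matrix n ι ℂ) (hV : Vᴴ * V = 1) (hc : Fintype.card n = Fintype.card ι + Fintype.card κ) :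
    ∃ W : Matrix n κ ℂ, Wᴴ * W = 1 ∧ Vᴴ * W = 0 ∧ V * Vᴴ + W * Wᴴ = 1 := by
  classical
  let v : ι ⊕ κ → EuclideanSpace ℂ n := Sum.elim (fun j => WithLp.toLp 2 (fun i => V i j)) (fun _ => 0)
  have hcard : Module.finrank ℂ (EuclideanSpace ℂ n) = Fintype.card (ι ⊕ κ) := by simp [hc]
  have ho : Orthonormal ℂ ((Set.range (Sum.inl : ι → ι ⊕ κ)).domRestrict v) := by
    rw [orthonormal_iff_ite]
    rintro ⟨_, i, rfl⟩ ⟨_, j, rfl⟩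
    have := congrFun (congrFun hV i) j
    simp only [Matrix.mul_apply, conjTranspose_apply, Matrix.one_apply] at this
    split_ifs with h
    · have hij : i = j := Sum.inl.inj (Subtype.mk.inj h)
      rw [if_pos hij] at this
      simpa [v, Set.domRestrict, PiLp.inner_apply, mul_comm] using this
    · have hij : ¬ i = j := fun hh => h (by subst hh; rfl)
      rw [if_neg hij] at this
      simpa [v, Set.domRestrict, PiLp.inner_apply, mul_comm] using this
  obtain ⟨b, hb⟩ := ho.exists_orthonormalBasis_extension_of_card_eq hcard
  let W : Matrix n κ ℂ := Matrix.of fun i j => b (Sum.inr j) i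
  have hVb : V = Matrix.of fun i j => b (Sum.inl j) i := by
    ext i j
    simp [hb (Sum.inl j) ⟨j, rfl⟩, v]
  have hin := orthonormal_iff_ite.1 b.orthonormal
  have h1 : Wᴴ * W = 1 := by
    ext i j
    have := hin (Sum.inr i) (Sum.inr j)
    simp [PiLp.inner_apply] at this
    simp [W, Matrix.mul_apply, Matrix.one_apply]
    simpa [mul_comm] using this
  have h2 : Vᴴ * W = 0 := by
    ext i j
    have := hin (Sum.inl i) (Sum.inr j)
    rw [PiLp.inner_apply] at this
    simp [W, hVb, Matrix.mul_apply]
    simpa [mul_comm] using this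
  have h2' : Wᴴ * V = 0 := by
    have := congrArg conjTranspose h2
    simpa using this
  refine ⟨W, h1, h2, ?_⟩
  let e : n ≃ ι ⊕ κ := Fintype.equivOfCardEq (by simp [hc])
  have h3 : (fromRows Vᴴ Wᴴ) * (fromCols V W) = 1 := by
    rw [fromRows_mul_fromCols, hV, h1, h2, h2', fromBlocks_one]
  have h4 := Matrix.mul_eq_one_comm_of_card_eq (R := ℂ) (m := ι ⊕ κ) (n := n) (by simp [hc]) |>.1 h3
  rw [fromCols_mul_fromRows] at h4
  exact h4

theorem compl_sym {n ι : Type} [Fintype n] [DecidableEq n] [Fintype ι] [DecidableEq ι]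
    (V : Matrix n ι ℂ) (hV : Vᴴ * V = 1) (l : ℕ) (hc : Fintype.card n = Fintype.card ι + 2 * l) :
    ∃ R : Matrix n n ℂ, Rᴴ = R ∧ R.trace = 0 ∧ R * V = 0 ∧ R * R = 1 - V * Vᴴ := by
  obtain ⟨W, h1, h2, h3⟩ := ext_frame (κ := Fin l ⊕ Fin l) V hV (by simp [hc]; ring)
  have h2' : Wᴴ * V = 0 := by
    have := congrArg conjTranspose h2
    simpa using this
  let S : Matrix (Fin l ⊕ Fin l) (Fin l ⊕ Fin l) ℂ := fromBlocks 1 0 0 (-1)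
  have hS : S * S = 1 := by simp [S, fromBlocks_multiply]
  have hS' : Sᴴ = S := by simp [S, fromBlocks_conjTranspose]
  refine ⟨W * S * Wᴴ, ?_, ?_, ?_, ?_⟩
  · simp [Matrix.mul_assoc, hS']
  · rw [Matrix.trace_mul_comm, ← Matrix.mul_assoc, h1]; simp [S, Matrix.trace]
  · rw [Matrix.mul_assoc, h2', Matrix.mul_zero]
  · rw [← h3, add_sub_cancel_left]
    calc _ = W * (S * (Wᴴ * W) * S) * Wᴴ := by simp only [Matrix.mul_assoc]
      _ = _ := by rw [h1, Matrix.mul_one, hS, Matrix.mul_one]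

theorem frame_const {n ι E : Type} [Fintype n] [DecidableEq n] [Fintype ι] [DecidableEq ι]
    [NormedAddCommGroup E] [InnerProductSpace ℝ E] (T : Matrix n n ℂ →ₗ[ℝ] E)
    (hT : ∀ A : Matrix n n ℂ, Aᴴ = A → A * A = 1 → A.trace = 0 → ‖T A‖ = 1)
    (V : Matrix n ι ℂ) (hV : Vᴴ * V = 1) (l : ℕ) (hc : Fintype.card n = Fintype.card ι + 2 * l) :
    ∃ s : ℝ, ∀ M : Matrix ι ι ℂ, Mᴴ = M → M * M = 1 → M.trace = 0 → ‖T (V * M * Vᴴ)‖ ^ 2 = s := by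
  obtain ⟨R, r1, r2, r3, r4⟩ := compl_sym V hV l hc
  have r3' : Vᴴ * R = 0 := by
    have := congrArg conjTranspose r3
    simpa [r1] using this
  have key : ∀ M : Matrix ι ι ℂ, Mᴴ = M → M * M = 1 → M.trace = 0 →
      ‖T (V * M * Vᴴ) + T R‖ = 1 := by
    intro M m1 m2 m3
    rw [← map_add]
    apply hT
    · simp [Matrix.mul_assoc, m1, r1]
    · have e1 : V * M * Vᴴ * (V * M * Vᴴ) = V * Vᴴ := by
        calc _ = V * (M * (Vᴴ * V) * M) * Vᴴ := by simp only [Matrix.mul_assoc]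
          _ = _ := by rw [hV, Matrix.mul_one, m2, Matrix.mul_one]
      have e2 : V * M * Vᴴ * R = 0 := by rw [Matrix.mul_assoc, r3', Matrix.mul_zero]
      have e3 : R * (V * M * Vᴴ) = 0 := by
        rw [Matrix.mul_assoc, ← Matrix.mul_assoc, r3, Matrix.zero_mul]
      rw [Matrix.add_mul, Matrix.mul_add, Matrix.mul_add, e1, e2, e3, r4]; abel
    · rw [Matrix.trace_add, r2, Matrix.trace_mul_comm, ← Matrix.mul_assoc, hV]; simp [m3]
  refine ⟨1 - ‖T R‖ ^ 2, fun M m1 m2 m3 => ?_⟩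
  have k1 := key M m1 m2 m3
  have k2 := key (-M) (by simp [m1]) (by simp [m2]) (by simp [m3])
  simp only [Matrix.mul_neg, Matrix.neg_mul, map_neg] at k2
  have a1 := norm_add_sq_real (T (V * M * Vᴴ)) (T R)
  have a2 := norm_add_sq_real (-T (V * M * Vᴴ)) (T R)
  rw [k1] at a1
  rw [k2, norm_neg, inner_neg_left] at a2
  linarith


set_option maxHeartbeats 2000000 in
theorem core4 {E : Type} [NormedAddCommGroup E] [InnerProductSpace ℝ E]
    (τ : Matrix (Fin 4) (Fin 4) ℂ →ₗ[ℝ] E) (s : ℝ)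
    (hs : ∀ M : Matrix (Fin 4) (Fin 4) ℂ, Mᴴ = M → M * M = 1 → M.trace = 0 → ‖τ M‖ ^ 2 = s)
    (hx : τ !![0,1,0,0;1,0,0,0;0,0,0,0;0,0,0,0] = 0)
    (hne : τ !![-1,0,0,0;0,0,0,0;0,0,1,0;0,0,0,0] ≠ 0)
    (α β : ℝ) (hab : ¬ (α = 0 ∧ β = 0)) :
    α • τ !![0,0,1,0;0,0,0,0;1,0,0,0;0,0,0,0] + β • τ !![0,0,0,0;0,0,0,0;0,0,0,1;0,0,1,0] ≠ 0 := by
  set x12 : Matrix (Fin 4) (Fin 4) ℂ := !![0,1,0,0;1,0,0,0;0,0,0,0;0,0,0,0] with d12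
  set x13 : Matrix (Fin 4) (Fin 4) ℂ := !![0,0,1,0;0,0,0,0;1,0,0,0;0,0,0,0] with d13
  set x34 : Matrix (Fin 4) (Fin 4) ℂ := !![0,0,0,0;0,0,0,0;0,0,0,1;0,0,1,0] with d34
  set z13 : Matrix (Fin 4) (Fin 4) ℂ := !![-1,0,0,0;0,0,0,0;0,0,1,0;0,0,0,0] with dz
  set x24 : Matrix (Fin 4) (Fin 4) ℂ := !![0,0,0,0;0,0,0,1;0,0,0,0;0,1,0,0] with d24
  have e1 : ‖τ (x12 + x34)‖ ^ 2 = s := by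
    apply hs
    · ext i j; fin_cases i <;> fin_cases j <;> simp [d12, d34]
    · ext i j; fin_cases i <;> fin_cases j <;> simp [d12, d34, Matrix.mul_apply, Fin.sum_univ_four]
    · simp [d12, d34, Matrix.trace, Fin.sum_univ_four]
  have e2 : ‖τ (x13 + x24)‖ ^ 2 = s := by
    apply hs
    · ext i j; fin_cases i <;> fin_cases j <;> simp [d13, d24]
    · ext i j; fin_cases i <;> fin_cases j <;> simp [d13, d24, Matrix.mul_apply, Fin.sum_univ_four]
    · simp [d13, d24, Matrix.trace, Fin.sum_univ_four]
  have e3 : ‖τ (x13 - x24)‖ ^ 2 = s := by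
    apply hs
    · ext i j; fin_cases i <;> fin_cases j <;> simp [d13, d24]
    · ext i j; fin_cases i <;> fin_cases j <;> simp [d13, d24, Matrix.mul_apply, Fin.sum_univ_four]
    · simp [d13, d24, Matrix.trace, Fin.sum_univ_four]
  have e4 : ‖τ (z13 + x24)‖ ^ 2 = s := by
    apply hs
    · ext i j; fin_cases i <;> fin_cases j <;> simp [dz, d24]
    · ext i j; fin_cases i <;> fin_cases j <;> simp [dz, d24, Matrix.mul_apply, Fin.sum_univ_four]
    · simp [dz, d24, Matrix.trace, Fin.sum_univ_four]
  have e5 : ‖τ (z13 - x24)‖ ^ 2 = s := by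
    apply hs
    · ext i j; fin_cases i <;> fin_cases j <;> simp [dz, d24]
    · ext i j; fin_cases i <;> fin_cases j <;> simp [dz, d24, Matrix.mul_apply, Fin.sum_univ_four]
    · simp [dz, d24, Matrix.trace, Fin.sum_univ_four]
  let r : ℝ := (√2)⁻¹
  have hr : r * r = 1 / 2 := by
    simp only [r]; rw [← mul_inv, Real.mul_self_sqrt (by norm_num)]; norm_num
  have hrc : (r : ℂ) * (r : ℂ) = 1 / 2 := by
    rw [← Complex.ofReal_mul, hr]; norm_num
  have hr0 : r ≠ 0 := by intro h; rw [h] at hr; norm_num at hr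
  have e6 : ‖τ (r • ((x12 + x13) + (x34 - x24)))‖ ^ 2 = s := by
    apply hs
    · ext i j; fin_cases i <;> fin_cases j <;> simp [d12, d13, d34, d24]
    · ext i j; fin_cases i <;> fin_cases j <;> simp [d12, d13, d34, d24, Matrix.mul_apply, Fin.sum_univ_four, hrc] <;> norm_num
    · simp [d12, d13, d34, d24, Matrix.trace, Fin.sum_univ_four]
  have e7 : ‖τ (r • ((x12 + x13) - (x34 - x24)))‖ ^ 2 = s := by
    apply hs
    · ext i j; fin_cases i <;> fin_cases j <;> simp [d12, d13, d34, d24]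
    · ext i j; fin_cases i <;> fin_cases j <;> simp [d12, d13, d34, d24, Matrix.mul_apply, Fin.sum_univ_four, hrc] <;> norm_num
    · simp [d12, d13, d34, d24, Matrix.trace, Fin.sum_univ_four]
  simp only [map_add, map_sub, map_smul, hx, zero_add, norm_smul, mul_pow] at e1 e2 e3 e4 e5 e6 e7
  rw [norm_add_sq_real] at e2 e4 e6
  rw [norm_sub_sq_real] at e3 e5 e7
  have hnr : ‖r‖ ^ 2 = 1 / 2 := by rw [Real.norm_eq_abs, sq_abs, sq, hr]
  rw [hnr] at e6 e7
  rw [inner_sub_right] at e6 e7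
  have hz : 0 < ‖τ z13‖ ^ 2 := by
    have := norm_pos_iff.2 hne
    positivity
  have hin : inner ℝ (τ x13) (τ x34) = 0 := by linarith
  have h24 := sq_nonneg ‖τ x24‖
  have h13 : 0 < ‖τ x13‖ ^ 2 := by linarith
  have h34 : 0 < ‖τ x34‖ ^ 2 := by linarith
  intro h0
  have := norm_add_sq_real (α • τ x13) (β • τ x34)
  rw [h0, inner_smul_left, inner_smul_right, hin, norm_smul, norm_smul, mul_pow, mul_pow] at this
  simp at this
  have t1 : 0 ≤ α ^ 2 * ‖τ x13‖ ^ 2 := by positivity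
  have t2 : 0 ≤ β ^ 2 * ‖τ x34‖ ^ 2 := by positivity
  apply hab
  constructor
  · have : α ^ 2 * ‖τ x13‖ ^ 2 = 0 := by linarith
    rcases mul_eq_zero.1 this with h | h
    · exact pow_eq_zero_iff (two_ne_zero) |>.1 h
    · linarith
  · have : β ^ 2 * ‖τ x34‖ ^ 2 = 0 := by linarith
    rcases mul_eq_zero.1 this with h | h
    · exact pow_eq_zero_iff (two_ne_zero) |>.1 h
    · linarith

set_option maxHeartbeats 2000000 in
theorem kill4 {E : Type} [NormedAddCommGroup E] [InnerProductSpace ℝ E]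
    (τ : Matrix (Fin 4) (Fin 4) ℂ →ₗ[ℝ] E) (s : ℝ)
    (hs : ∀ M : Matrix (Fin 4) (Fin 4) ℂ, Mᴴ = M → M * M = 1 → M.trace = 0 → ‖τ M‖ ^ 2 = s)
    (hx : τ !![0,1,0,0;1,0,0,0;0,0,0,0;0,0,0,0] = 0) :
    τ !![1,0,0,0;0,-1,0,0;0,0,0,0;0,0,0,0] = 0 ∧
    τ !![0,Complex.I,0,0;-Complex.I,0,0,0;0,0,0,0;0,0,0,0] = 0 := by
  set x12 : Matrix (Fin 4) (Fin 4) ℂ := !![0,1,0,0;1,0,0,0;0,0,0,0;0,0,0,0] with d12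
  set x34 : Matrix (Fin 4) (Fin 4) ℂ := !![0,0,0,0;0,0,0,0;0,0,0,1;0,0,1,0] with d34
  set z : Matrix (Fin 4) (Fin 4) ℂ := !![1,0,0,0;0,-1,0,0;0,0,0,0;0,0,0,0] with dz
  set y : Matrix (Fin 4) (Fin 4) ℂ := !![0,Complex.I,0,0;-Complex.I,0,0,0;0,0,0,0;0,0,0,0] with dy
  have e1 : ‖τ (x12 + x34)‖ ^ 2 = s := by
    apply hs
    · ext i j; fin_cases i <;> fin_cases j <;> simp [d12, d34]
    · ext i j; fin_cases i <;> fin_cases j <;> simp [d12, d34, Matrix.mul_apply, Fin.sum_univ_four]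
    · simp [d12, d34, Matrix.trace, Fin.sum_univ_four]
  have e2 : ‖τ (z + x34)‖ ^ 2 = s := by
    apply hs
    · ext i j; fin_cases i <;> fin_cases j <;> simp [dz, d34]
    · ext i j; fin_cases i <;> fin_cases j <;> simp [dz, d34, Matrix.mul_apply, Fin.sum_univ_four]
    · simp [dz, d34, Matrix.trace, Fin.sum_univ_four]
  have e3 : ‖τ (z - x34)‖ ^ 2 = s := by
    apply hs
    · ext i j; fin_cases i <;> fin_cases j <;> simp [dz, d34]
    · ext i j; fin_cases i <;> fin_cases j <;> simp [dz, d34, Matrix.mul_apply, Fin.sum_univ_four]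
    · simp [dz, d34, Matrix.trace, Fin.sum_univ_four]
  have e4 : ‖τ (y + x34)‖ ^ 2 = s := by
    apply hs
    · ext i j; fin_cases i <;> fin_cases j <;> simp [dy, d34]
    · ext i j; fin_cases i <;> fin_cases j <;> simp [dy, d34, Matrix.mul_apply, Fin.sum_univ_four]
    · simp [dy, d34, Matrix.trace, Fin.sum_univ_four]
  have e5 : ‖τ (y - x34)‖ ^ 2 = s := by
    apply hs
    · ext i j; fin_cases i <;> fin_cases j <;> simp [dy, d34]
    · ext i j; fin_cases i <;> fin_cases j <;> simp [dy, d34, Matrix.mul_apply, Fin.sum_univ_four]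
    · simp [dy, d34, Matrix.trace, Fin.sum_univ_four]
  simp only [map_add, map_sub, hx, zero_add] at e1 e2 e3 e4 e5
  rw [norm_add_sq_real] at e2 e4
  rw [norm_sub_sq_real] at e3 e5
  constructor
  · rw [← norm_eq_zero, ← sq_eq_zero_iff]; linarith
  · rw [← norm_eq_zero, ← sq_eq_zero_iff]; linarith

def colM4 {n : Type} (a b c d : n → ℂ) : Matrix n (Fin 4) ℂ := Matrix.of fun i => ![a i, b i, c i, d i]

structure ON4 {n : Type} [Fintype n] (a b c d : n → ℂ) : Prop where
  aa : star a ⬝ᵥ a = 1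
  bb : star b ⬝ᵥ b = 1
  cc : star c ⬝ᵥ c = 1
  dd : star d ⬝ᵥ d = 1
  ab : star a ⬝ᵥ b = 0
  ac : star a ⬝ᵥ c = 0
  ad : star a ⬝ᵥ d = 0
  bc : star b ⬝ᵥ c = 0
  bd : star b ⬝ᵥ d = 0
  cd : star c ⬝ᵥ d = 0

theorem dot_flip {n : Type} [Fintype n] {a b : n → ℂ} (h : star a ⬝ᵥ b = 0) : star b ⬝ᵥ a = 0 := by
  have := congrArg star h
  rw [Matrix.star_dotProduct] at this
  simpa using this

theorem ON4.iso {n : Type} [Fintype n] [DecidableEq n] {a b c d : n → ℂ} (h : ON4 a b c d) :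
    (colM4 a b c d)ᴴ * colM4 a b c d = 1 := by
  obtain ⟨aa, bb, cc, dd, ab, ac, ad, bc, bd, cd⟩ := h
  have ba := dot_flip ab
  have ca := dot_flip ac
  have da := dot_flip ad
  have cb := dot_flip bc
  have db := dot_flip bd
  have dc := dot_flip cd
  simp only [dotProduct, Pi.star_apply] at *
  ext i j
  fin_cases i <;> fin_cases j <;> simpa [colM4, Matrix.mul_apply, Matrix.one_apply] 

def rk {n : Type} (a b : n → ℂ) : Matrix n n ℂ := vecMulVec a (star b)

noncomputable def compT {n ι E : Type} [Fintype n] [Fintype ι] [NormedAddCommGroup E] [InnerProductSpace ℝ E]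
    (T : Matrix n n ℂ →ₗ[ℝ] E) (V : Matrix n ι ℂ) : Matrix ι ι ℂ →ₗ[ℝ] E where
  toFun M := T (V * M * Vᴴ)
  map_add' A B := by rw [Matrix.mul_add, Matrix.add_mul, map_add]
  map_smul' r A := by rw [Matrix.mul_smul, Matrix.smul_mul, map_smul]; rfl

theorem core_vec {n E : Type} [Fintype n] [DecidableEq n]
    [NormedAddCommGroup E] [InnerProductSpace ℝ E] (T : Matrix n n ℂ →ₗ[ℝ] E)
    (hT : ∀ A : Matrix n n ℂ, Aᴴ = A → A * A = 1 → A.trace = 0 → ‖T A‖ = 1)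
    (l : ℕ) (hc : Fintype.card n = 4 + 2 * l) {a b c d : n → ℂ} (h : ON4 a b c d)
    (hx : T (rk a b + rk b a) = 0) (hne : T (rk c c - rk a a) ≠ 0)
    (α β : ℝ) (hab : ¬ (α = 0 ∧ β = 0)) :
    α • T (rk a c + rk c a) + β • T (rk c d + rk d c) ≠ 0 := by
  obtain ⟨s, hs⟩ := frame_const T hT (colM4 a b c d) h.iso l (by simpa using hc)
  have := core4 (compT T (colM4 a b c d)) s hs ?_ ?_ α β hab
  · convert this using 4
    · refine congrArg T ?_; ext i j; simp [colM4, rk, Matrix.mul_apply, Fin.sum_univ_four, vecMulVec_apply]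
      ring
    · refine congrArg T ?_; ext i j; simp [colM4, rk, Matrix.mul_apply, Fin.sum_univ_four, vecMulVec_apply]
      ring
  · convert hx using 2
    refine congrArg T ?_; ext i j; simp [colM4, rk, Matrix.mul_apply, Fin.sum_univ_four, vecMulVec_apply]
    ring
  · convert hne using 3
    refine congrArg T ?_; ext i j; simp [colM4, rk, Matrix.mul_apply, Fin.sum_univ_four, vecMulVec_apply]
    ring

theorem kill_vec {n E : Type} [Fintype n] [DecidableEq n]
    [NormedAddCommGroup E] [InnerProductSpace ℝ E] (T : Matrix n n ℂ →ₗ[ℝ] E)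
    (hT : ∀ A : Matrix n n ℂ, Aᴴ = A → A * A = 1 → A.trace = 0 → ‖T A‖ = 1)
    (l : ℕ) (hc : Fintype.card n = 4 + 2 * l) {a b c d : n → ℂ} (h : ON4 a b c d)
    (hx : T (rk a b + rk b a) = 0) (t : ℝ) (z : ℂ) :
    T (t • (rk a a - rk b b) + (z • rk a b + star z • rk b a)) = 0 := by
  obtain ⟨s, hs⟩ := frame_const T hT (colM4 a b c d) h.iso l (by simpa using hc)
  have := kill4 (compT T (colM4 a b c d)) s hs ?_
  · obtain ⟨h1, h2⟩ := this
    have h1' : T (rk a a - rk b b) = 0 := by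
      convert h1 using 2
      refine congrArg T ?_; ext i j; simp [colM4, rk, Matrix.mul_apply, Fin.sum_univ_four, vecMulVec_apply]
      ring
    have h2' : T (Complex.I • (rk a b - rk b a)) = 0 := by
      convert h2 using 2
      refine congrArg T ?_; ext i j; simp [colM4, rk, Matrix.mul_apply, Fin.sum_univ_four, vecMulVec_apply]
      ring
    have e : z • rk a b + star z • rk b a = z.re • (rk a b + rk b a) + z.im • (Complex.I • (rk a b - rk b a)) := by
      ext i j
      have hz := Complex.re_add_im z
      have hz' : star z = z.re - z.im * Complex.I := by
        apply Complex.ext <;> simp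
      simp only [Matrix.add_apply, Matrix.smul_apply, Matrix.sub_apply, smul_eq_mul, Complex.real_smul]
      rw [hz']
      nth_rewrite 1 [← hz]
      ring
    rw [e, map_add, map_add, map_smul, map_smul, map_smul, h1', h2', hx]
    simp
  · convert hx using 2
    refine congrArg T ?_; ext i j; simp [colM4, rk, Matrix.mul_apply, Fin.sum_univ_four, vecMulVec_apply]
    ring

theorem rk_add_left {n : Type} (a b c : n → ℂ) : rk (a + b) c = rk a c + rk b c := by
  ext i j; simp [rk, vecMulVec_apply]; ring
theorem rk_add_right {n : Type} (a b c : n → ℂ) : rk c (a + b) = rk c a + rk c b := by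
  ext i j; simp [rk, vecMulVec_apply]; ring
theorem rk_smul_left {n : Type} (r : ℝ) (b c : n → ℂ) : rk (r • b) c = r • rk b c := by
  ext i j; simp [rk, vecMulVec_apply]; ring
theorem rk_smul_right {n : Type} (r : ℝ) (b c : n → ℂ) : rk c (r • b) = r • rk c b := by
  ext i j; simp [rk, vecMulVec_apply]; ring

open scoped ComplexOrder in
theorem normalise {n : Type} [Fintype n] (v : n → ℂ) (hv : v ≠ 0) :
    ∃ (r : ℝ) (w : n → ℂ), r ≠ 0 ∧ star w ⬝ᵥ w = 1 ∧ v = r • w := by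
  have h := (dotProduct_star_self_nonneg v)
  have h' : star v ⬝ᵥ v ≠ 0 := fun h => hv (dotProduct_star_self_eq_zero.1 h)
  obtain ⟨h1, h2⟩ := Complex.le_def.1 h
  simp only [Complex.zero_re, Complex.zero_im] at h1 h2
  have h3 : star v ⬝ᵥ v = ((star v ⬝ᵥ v).re : ℂ) := by apply Complex.ext <;> simp [← h2]
  have h4 : (star v ⬝ᵥ v).re ≠ 0 := by
    intro h0; rw [h0] at h3; exact h' (by simpa using h3)
  set q := (star v ⬝ᵥ v).re
  have hq : √q ≠ 0 := by
    rw [Real.sqrt_ne_zero h1]; exact h4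
  refine ⟨√q, (√q)⁻¹ • v, hq, ?_, ?_⟩
  · rw [star_smul, smul_dotProduct, dotProduct_smul, h3, smul_smul]
    simp only [star_trivial, Complex.real_smul]
    rw [← Complex.ofReal_mul, ← mul_inv, Real.mul_self_sqrt h1, inv_mul_cancel₀ h4, Complex.ofReal_one]
  · rw [smul_smul, mul_inv_cancel₀ hq, one_smul]

theorem normalise2 (c d : ℂ) : ∃ (α : ℝ) (γ δ : ℂ), star γ * γ + star δ * δ = 1 ∧ c = α * γ ∧ d = α * δ := by
  by_cases h : (![c, d] : Fin 2 → ℂ) = 0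
  · refine ⟨0, 1, 0, by simp, ?_, ?_⟩
    · simpa using congrFun h 0
    · simpa using congrFun h 1
  · obtain ⟨r, w, -, h1, h2⟩ := normalise _ h
    refine ⟨r, w 0, w 1, by simpa [dotProduct] using h1, ?_, ?_⟩
    · simpa using congrFun h2 0
    · simpa using congrFun h2 1

def colM2 {n : Type} (a b : n → ℂ) : Matrix n (Fin 2) ℂ := Matrix.of fun i => ![a i, b i]

theorem exists_u {n E : Type} [Fintype n] [DecidableEq n]
    [NormedAddCommGroup E] [InnerProductSpace ℝ E] (T : Matrix n n ℂ →ₗ[ℝ] E)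
    (hT : ∀ A : Matrix n n ℂ, Aᴴ = A → A * A = 1 → A.trace = 0 → ‖T A‖ = 1)
    (l : ℕ) (hc : Fintype.card n = 4 + 2 * l) :
    ∃ u : n → ℂ, star u ⬝ᵥ u = 1 ∧ ∀ v : n → ℂ, v ≠ 0 → star u ⬝ᵥ v = 0 →
      T (rk u v + rk v u) ≠ 0 := by
  by_cases H : ∃ a b : n → ℂ, star a ⬝ᵥ a = 1 ∧ star b ⬝ᵥ b = 1 ∧ star a ⬝ᵥ b = 0 ∧
      T (rk a b + rk b a) = 0
  swap
  · have : Nonempty n := Fintype.card_pos_iff.1 (by omega)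
    obtain ⟨i⟩ := this
    refine ⟨Pi.single i 1, by simp, fun v hv huv h0 => ?_⟩
    obtain ⟨r, w, hr, hw, rfl⟩ := normalise v hv
    apply H
    refine ⟨Pi.single i 1, w, by simp, hw, ?_, ?_⟩
    · rw [dotProduct_smul] at huv
      exact (smul_eq_zero.1 huv).resolve_left hr
    · rw [rk_smul_left, rk_smul_right, ← smul_add, map_smul] at h0
      exact (smul_eq_zero.1 h0).resolve_left hr
  obtain ⟨a, b, aa, bb, ab, hx⟩ := H
  have ba := dot_flip ab
  have hV : (colM2 a b)ᴴ * colM2 a b = 1 := by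
    simp only [dotProduct, Pi.star_apply] at aa bb ab ba
    ext i j
    fin_cases i <;> fin_cases j <;> simpa [colM2, Matrix.mul_apply, Matrix.one_apply]
  obtain ⟨W, w1, w2, w3⟩ := ext_frame (κ := Fin (l + 1) ⊕ Fin (l + 1)) (colM2 a b) hV (by simp [hc]; ring)
  let w : Fin (l + 1) ⊕ Fin (l + 1) → n → ℂ := fun j i => W i j
  have ww : ∀ i j, star (w i) ⬝ᵥ (w j) = if i = j then 1 else 0 := by
    intro i j
    have := congrFun (congrFun w1 i) j
    simpa [Matrix.mul_apply, dotProduct, w, Matrix.one_apply] using this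
  have aw : ∀ j, star a ⬝ᵥ (w j) = 0 := by
    intro j
    have := congrFun (congrFun w2 0) j
    simpa [Matrix.mul_apply, dotProduct, w, colM2] using this
  have bw : ∀ j, star b ⬝ᵥ (w j) = 0 := by
    intro j
    have := congrFun (congrFun w2 1) j
    simpa [Matrix.mul_apply, dotProduct, w, colM2] using this
  have kill := kill_vec T hT l hc (a := a) (b := b) (c := w (Sum.inl 0)) (d := w (Sum.inr 0))
    ⟨aa, bb, by simp [ww], by simp [ww], ab, aw _, aw _, bw _, bw _, by simp [ww]⟩ hx
  have hex : ∃ i, T (rk (w i) (w i) - rk a a) ≠ 0 := by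
    by_contra hcon
    push Not at hcon
    let M : Matrix (Fin 2) (Fin 2) ℂ := diagonal ![1, -1]
    let S : Matrix (Fin (l + 1) ⊕ Fin (l + 1)) (Fin (l + 1) ⊕ Fin (l + 1)) ℂ :=
      diagonal (Sum.elim (fun _ => 1) (fun _ => -1))
    have hM : M * M = 1 := by
      ext i j; fin_cases i <;> fin_cases j <;> simp [M]
    have hM' : Mᴴ = M := by
      ext i j; fin_cases i <;> fin_cases j <;> simp [M]
    have hS : S * S = 1 := by
      simp only [S, diagonal_mul_diagonal]
      rw [← diagonal_one]; congr 1; ext i; rcases i with i | i <;> simp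
    have hS' : Sᴴ = S := by
      simp only [S, diagonal_conjTranspose]
      congr 1; ext i; rcases i with i | i <;> simp
    set V := colM2 a b
    have w2' : Wᴴ * V = 0 := by
      have := congrArg conjTranspose w2
      simpa using this
    have h1 : ‖T (V * M * Vᴴ + W * S * Wᴴ)‖ = 1 := by
      apply hT
      · simp [Matrix.mul_assoc, hM', hS']
      · have e1 : V * M * Vᴴ * (V * M * Vᴴ) = V * Vᴴ := by
          calc _ = V * (M * (Vᴴ * V) * M) * Vᴴ := by simp only [Matrix.mul_assoc]
            _ = _ := by rw [hV, Matrix.mul_one, hM, Matrix.mul_one]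
        have e2 : W * S * Wᴴ * (W * S * Wᴴ) = W * Wᴴ := by
          calc _ = W * (S * (Wᴴ * W) * S) * Wᴴ := by simp only [Matrix.mul_assoc]
            _ = _ := by rw [w1, Matrix.mul_one, hS, Matrix.mul_one]
        have e3 : V * M * Vᴴ * (W * S * Wᴴ) = 0 := by
          calc _ = V * M * (Vᴴ * W) * S * Wᴴ := by simp only [Matrix.mul_assoc]
            _ = _ := by rw [w2]; simp
        have e4 : W * S * Wᴴ * (V * M * Vᴴ) = 0 := by
          calc _ = W * S * (Wᴴ * V) * M * Vᴴ := by simp only [Matrix.mul_assoc]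
            _ = _ := by rw [w2']; simp
        rw [Matrix.add_mul, Matrix.mul_add, Matrix.mul_add, e1, e2, e3, e4, ← w3]; abel
      · have t1 : (V * M * Vᴴ).trace = 0 := by
          rw [Matrix.trace_mul_comm, ← Matrix.mul_assoc, hV]
          simp [M, Matrix.trace]
        have t2 : (W * S * Wᴴ).trace = 0 := by
          rw [Matrix.trace_mul_comm, ← Matrix.mul_assoc, w1]
          simp [S, Matrix.trace]
        rw [Matrix.trace_add, t1, t2, add_zero]
    have h2 : V * M * Vᴴ = rk a a - rk b b := by
      ext i j
      simp [V, M, rk, colM2, Matrix.mul_apply, vecMulVec_apply, Fin.sum_univ_two]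
      ring
    have h3 : W * S * Wᴴ = ∑ j : Fin (l + 1), ((rk (w (Sum.inl j)) (w (Sum.inl j)) - rk a a)
        - (rk (w (Sum.inr j)) (w (Sum.inr j)) - rk a a)) := by
      ext i j
      rw [Matrix.sum_apply]
      rw [Matrix.mul_apply]
      simp only [S, Matrix.mul_diagonal]
      simp [w, rk, vecMulVec_apply, Finset.sum_sub_distrib]
      ring
    have h4 : T (V * M * Vᴴ + W * S * Wᴴ) = 0 := by
      rw [map_add, h3, map_sum, h2]
      have := kill 1 0
      simp only [one_smul, zero_smul, star_zero, add_zero] at this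
      rw [this, zero_add]
      apply Finset.sum_eq_zero
      intro j _
      rw [map_sub, hcon, hcon, sub_zero]
    rw [h4] at h1
    simp at h1
  obtain ⟨i0, hi0⟩ := hex
  refine ⟨w i0, by simp [ww], fun v hv huv => ?_⟩
  set u := w i0 with hu
  have uu : star u ⬝ᵥ u = 1 := by simp [hu, ww]
  have au : star a ⬝ᵥ u = 0 := aw _
  have bu : star b ⬝ᵥ u = 0 := bw _
  have ua := dot_flip au
  have ub := dot_flip bu
  obtain ⟨α, γ, δ, hgd, hγ, hδ⟩ := normalise2 (star a ⬝ᵥ v) (star b ⬝ᵥ v)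
  set p := γ • a + δ • b with hp
  set p' := (-star δ) • a + star γ • b with hp'
  have hd : ∃ (β : ℝ) (d : n → ℂ), v = α • p + β • d ∧ star d ⬝ᵥ d = 1 ∧ star a ⬝ᵥ d = 0 ∧
      star b ⬝ᵥ d = 0 ∧ star u ⬝ᵥ d = 0 := by
    have ra : star a ⬝ᵥ (v - α • p) = 0 := by
      simp [hp, dotProduct_sub, dotProduct_add, dotProduct_smul, aa, ab, hγ]
    have rb : star b ⬝ᵥ (v - α • p) = 0 := by
      simp [hp, dotProduct_sub, dotProduct_add, dotProduct_smul, bb, ba, hδ]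
    have ru : star u ⬝ᵥ (v - α • p) = 0 := by
      simp [hp, dotProduct_sub, dotProduct_add, dotProduct_smul, ua, ub, huv]
    by_cases h0 : v - α • p = 0
    · obtain ⟨j, hj⟩ : ∃ j, i0 ≠ j := by
        rcases i0 with i | i
        · exact ⟨Sum.inr 0, by simp⟩
        · exact ⟨Sum.inl 0, by simp⟩
      refine ⟨0, w j, ?_, by simp [ww], aw _, bw _, by simp [hu, ww, hj]⟩
      rw [zero_smul, add_zero]; exact sub_eq_zero.1 h0
    · obtain ⟨β, d, hβ, dd, hd⟩ := normalise _ h0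
      rw [hd, dotProduct_smul] at ra rb ru
      refine ⟨β, d, by rw [← hd]; abel, dd, (smul_eq_zero.1 ra).resolve_left hβ,
        (smul_eq_zero.1 rb).resolve_left hβ, (smul_eq_zero.1 ru).resolve_left hβ⟩
  obtain ⟨β, d, hvd, dd, ad, bd, ud⟩ := hd
  have hON : ON4 p p' u d := by
    simp only [Complex.star_def] at hgd
    refine ⟨?_, ?_, uu, dd, ?_, ?_, ?_, ?_, ?_, ud⟩ <;>
    simp [hp, hp', dotProduct_add, dotProduct_smul, add_dotProduct, smul_dotProduct,
      aa, ab, ba, bb, au, bu, ad, bd] <;> first | ring1 | linear_combination hgd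
  have hN : star γ * γ = 1 - star δ * δ := by linear_combination hgd
  have k1 : T (rk p p' + rk p' p) = 0 := by
    rw [← kill (-(γ * δ + star (γ * δ)).re) (γ ^ 2 - star δ ^ 2)]
    congr 1
    have hre : (((γ * δ + star (γ * δ)).re : ℝ) : ℂ) = γ * δ + star (γ * δ) := by
      apply Complex.ext <;> simp <;> ring
    ext i j
    simp only [Matrix.add_apply, Matrix.smul_apply, Matrix.sub_apply, smul_eq_mul, Complex.real_smul,
      Complex.ofReal_neg, hre]
    simp [rk, vecMulVec_apply, hp, hp']
    ring
  have k2 : T (rk p p - rk a a) = 0 := by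
    rw [← kill (-(star δ * δ).re) (γ * star δ)]
    congr 1
    have hre : (((star δ * δ).re : ℝ) : ℂ) = star δ * δ := by
      apply Complex.ext <;> simp; ring
    ext i j
    simp only [Matrix.add_apply, Matrix.smul_apply, Matrix.sub_apply, smul_eq_mul, Complex.real_smul,
      Complex.ofReal_neg, hre]
    simp only [Complex.star_def] at hgd
    simp [rk, vecMulVec_apply, hp]
    linear_combination (a i * (starRingEnd ℂ) (a j)) * hgd
  have k3 : T (rk u u - rk p p) ≠ 0 := by
    have : rk u u - rk p p = (rk u u - rk a a) - (rk p p - rk a a) := by abel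
    rw [this, map_sub, k2, sub_zero]; exact hi0
  have := core_vec T hT l hc hON k1 k3 α β ?_
  · rw [← map_smul, ← map_smul, ← map_add] at this
    convert this using 2
    rw [hvd, rk_add_left, rk_add_right, rk_smul_left, rk_smul_left, rk_smul_right, rk_smul_right,
      smul_add, smul_add]
    abel
  · rintro ⟨rfl, rfl⟩
    apply hv; rw [hvd]; simp

theorem dim_bound {n E : Type} [Fintype n] [DecidableEq n]
    [NormedAddCommGroup E] [InnerProductSpace ℝ E] [FiniteDimensional ℝ E] (T : Matrix n n ℂ →ₗ[ℝ] E)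
    (hT : ∀ A : Matrix n n ℂ, Aᴴ = A → A * A = 1 → A.trace = 0 → ‖T A‖ = 1)
    (l : ℕ) (hc : Fintype.card n = 4 + 2 * l) :
    2 * (3 + 2 * l) ≤ Module.finrank ℝ E := by
  obtain ⟨u, uu, hu⟩ := exists_u T hT l hc
  let V : Matrix n Unit ℂ := Matrix.of fun i _ => u i
  have hV : Vᴴ * V = 1 := by
    ext i j
    simpa [V, Matrix.mul_apply, dotProduct] using uu
  obtain ⟨Z, z1, z2, -⟩ := ext_frame (κ := Fin (3 + 2 * l)) V hV (by simp [hc]; ring)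
  let L : (Fin (3 + 2 * l) → ℂ) →ₗ[ℝ] E :=
    { toFun := fun c => T (rk u (Z *ᵥ c) + rk (Z *ᵥ c) u)
      map_add' := fun c d => by
        rw [← map_add, mulVec_add, rk_add_left, rk_add_right]; congr 1; abel
      map_smul' := fun r c => by
        rw [mulVec_smul, rk_smul_left, rk_smul_right, ← smul_add, map_smul]; rfl }
  have hL : Function.Injective L := by
    rw [← LinearMap.ker_eq_bot, LinearMap.ker_eq_bot']
    intro c hc0
    by_contra hne
    refine hu (Z *ᵥ c) ?_ ?_ hc0
    · intro h0
      apply hne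
      have : Zᴴ *ᵥ (Z *ᵥ c) = c := by rw [mulVec_mulVec, z1, one_mulVec]
      rw [← this, h0, mulVec_zero]
    · have : (Vᴴ * Z) *ᵥ c = 0 := by rw [z2, zero_mulVec]
      rw [← mulVec_mulVec] at this
      have := congrFun this ()
      simpa [V, mulVec, dotProduct] using this
  have := LinearMap.finrank_le_finrank_of_injective hL
  rw [Module.finrank_pi_fintype] at this
  simp [Complex.finrank_real_complex] at this
  linarith

theorem cross_zero {n m : Type} [Fintype n] [DecidableEq n] [Fintype m] [DecidableEq m]
    (Φ : Matrix n n ℂ →ₗ[ℝ] Matrix m m ℂ)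
    (hΦ : ∀ A : Matrix n n ℂ, Aᴴ = A → A * A = 1 → A.trace = 0 → (Φ A)ᴴ * Φ A = 1)
    (A B : Matrix n n ℂ) (a1 : Aᴴ = A) (a2 : A * A = 1) (a3 : A.trace = 0)
    (b1 : Bᴴ = B) (b2 : B * B = 1) (b3 : B.trace = 0) (hab : A * B + B * A = 0) :
    (Φ A)ᴴ * Φ B + (Φ B)ᴴ * Φ A = 0 := by
  let r : ℝ := (√2)⁻¹
  have hr : r * r = 1 / 2 := by
    simp only [r]; rw [← mul_inv, Real.mul_self_sqrt (by norm_num)]; norm_num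
  have h := hΦ (r • (A + B)) (by simp [a1, b1]) ?_ (by simp [a3, b3])
  · rw [map_smul, map_add, conjTranspose_smul, Matrix.smul_mul, Matrix.mul_smul, smul_smul,
      star_trivial, hr, conjTranspose_add, Matrix.add_mul, Matrix.mul_add, Matrix.mul_add,
      hΦ A a1 a2 a3, hΦ B b1 b2 b3] at h
    have h2 := congrArg (fun M => (2 : ℝ) • M) h
    simp only [smul_smul] at h2
    norm_num at h2
    rw [two_smul] at h2
    have : (Φ A)ᴴ * Φ B + (Φ B)ᴴ * Φ A =
      (1 + (Φ A)ᴴ * Φ B + ((Φ B)ᴴ * Φ A + 1)) - (1 + 1) := by abel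
    rw [this, h2, sub_self]
  · rw [Matrix.smul_mul, Matrix.mul_smul, smul_smul, hr, Matrix.add_mul, Matrix.mul_add,
      Matrix.mul_add, a2, b2]
    have : 1 + A * B + (B * A + 1) = (2 : ℝ) • (1 : Matrix n n ℂ) + (A * B + B * A) := by
      rw [two_smul]; abel
    rw [this, hab, add_zero, smul_smul]; norm_num

theorem parity {n m : Type} [Fintype n] [DecidableEq n] [Fintype m] [DecidableEq m]
    (Φ : Matrix n n ℂ →ₗ[ℝ] Matrix m m ℂ)
    (hΦ : ∀ A : Matrix n n ℂ, Aᴴ = A → A * A = 1 → A.trace = 0 → (Φ A)ᴴ * Φ A = 1)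
    (k : ℕ) (hc : Fintype.card n = 2 * k) : Even (Fintype.card m) := by
  obtain ⟨W, w1, -, w3⟩ := ext_frame (κ := Fin k ⊕ Fin k) (0 : Matrix n Empty ℂ)
    (by ext i; exact i.elim) (by simp [hc]; ring)
  have key : ∀ M : Matrix (Fin k ⊕ Fin k) (Fin k ⊕ Fin k) ℂ, Mᴴ = M → M * M = 1 → M.trace = 0 →
    (W * M * Wᴴ)ᴴ = W * M * Wᴴ ∧ (W * M * Wᴴ) * (W * M * Wᴴ) = 1 ∧ (W * M * Wᴴ).trace = 0 := by
    intro M m1 m2 m3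
    refine ⟨by simp [Matrix.mul_assoc, m1], ?_, ?_⟩
    · calc _ = W * (M * (Wᴴ * W) * M) * Wᴴ := by simp only [Matrix.mul_assoc]
        _ = W * Wᴴ := by rw [w1, Matrix.mul_one, m2, Matrix.mul_one]
        _ = 1 := by simpa using w3
    · rw [Matrix.trace_mul_comm, ← Matrix.mul_assoc, w1]; simp [m3]
  have key2 : ∀ M N : Matrix (Fin k ⊕ Fin k) (Fin k ⊕ Fin k) ℂ, M * N + N * M = 0 →
    (W * M * Wᴴ) * (W * N * Wᴴ) + (W * N * Wᴴ) * (W * M * Wᴴ) = 0 := by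
    intro M N h
    calc _ = W * (M * (Wᴴ * W) * N) * Wᴴ + W * (N * (Wᴴ * W) * M) * Wᴴ := by
          simp only [Matrix.mul_assoc]
      _ = W * (M * N + N * M) * Wᴴ := by
          rw [w1, Matrix.mul_one, Matrix.mul_one, Matrix.mul_add, Matrix.add_mul]
      _ = 0 := by rw [h]; simp
  let Z : Matrix (Fin k ⊕ Fin k) (Fin k ⊕ Fin k) ℂ := fromBlocks 1 0 0 (-1)
  let X : Matrix (Fin k ⊕ Fin k) (Fin k ⊕ Fin k) ℂ := fromBlocks 0 1 1 0
  let Y : Matrix (Fin k ⊕ Fin k) (Fin k ⊕ Fin k) ℂ :=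
    fromBlocks 0 (Complex.I • 1) (-(Complex.I • 1)) 0
  obtain ⟨z1, z2, z3⟩ := key Z (by simp [Z, fromBlocks_conjTranspose])
    (by simp [Z, fromBlocks_multiply]) (by simp [Z, Matrix.trace])
  obtain ⟨x1, x2, x3⟩ := key X (by simp [X, fromBlocks_conjTranspose])
    (by simp [X, fromBlocks_multiply]) (by simp [X, Matrix.trace])
  obtain ⟨y1, y2, y3⟩ := key Y (by simp [Y, fromBlocks_conjTranspose])
    (by simp [Y, fromBlocks_multiply, smul_smul]) (by simp [Y, Matrix.trace])
  have zx := cross_zero Φ hΦ _ _ z1 z2 z3 x1 x2 x3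
    (key2 _ _ (by simp [Z, X, fromBlocks_multiply, fromBlocks_add]))
  have zy := cross_zero Φ hΦ _ _ z1 z2 z3 y1 y2 y3
    (key2 _ _ (by simp [Z, Y, fromBlocks_multiply, fromBlocks_add]))
  have xy := cross_zero Φ hΦ _ _ x1 x2 x3 y1 y2 y3
    (key2 _ _ (by simp [X, Y, fromBlocks_multiply, fromBlocks_add]))
  have uz := hΦ _ z1 z2 z3
  have ux := hΦ _ x1 x2 x3
  have uy := hΦ _ y1 y2 y3
  generalize Φ (W * Z * Wᴴ) = A at *
  generalize Φ (W * X * Wᴴ) = B at *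
  generalize Φ (W * Y * Wᴴ) = C at *
  have uz' : A * Aᴴ = 1 := mul_eq_one_comm.1 uz
  have hBA : Bᴴ * A = -(Aᴴ * B) := by rw [eq_neg_iff_add_eq_zero, add_comm]; exact zx
  have hCA : Cᴴ * A = -(Aᴴ * C) := by rw [eq_neg_iff_add_eq_zero, add_comm]; exact zy
  have e1 : (Aᴴ * B) * (Aᴴ * C) = -(Bᴴ * C) := by
    have : Aᴴ * B = -(Bᴴ * A) := by rw [hBA, neg_neg]
    rw [this, Matrix.neg_mul]
    congr 1
    calc _ = Bᴴ * (A * Aᴴ) * C := by simp only [Matrix.mul_assoc]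
      _ = _ := by rw [uz', Matrix.mul_one]
  have e2 : (Aᴴ * C) * (Aᴴ * B) = -(Cᴴ * B) := by
    have : Aᴴ * C = -(Cᴴ * A) := by rw [hCA, neg_neg]
    rw [this, Matrix.neg_mul]
    congr 1
    calc _ = Cᴴ * (A * Aᴴ) * B := by simp only [Matrix.mul_assoc]
      _ = _ := by rw [uz', Matrix.mul_one]
  have e3 : (Aᴴ * B) * (Aᴴ * C) = -((Aᴴ * C) * (Aᴴ * B)) := by
    rw [e1, e2, neg_inj, eq_neg_iff_add_eq_zero]; exact xy
  have hd := congrArg det e3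
  rw [det_neg, det_mul, det_mul (Aᴴ * C), mul_comm (det (Aᴴ * C))] at hd
  have nz : ∀ {M : Matrix m m ℂ}, Mᴴ * M = 1 → M.det ≠ 0 := by
    intro M h h0
    have := congrArg det h
    rw [det_mul, h0] at this
    simp at this
  have nA : (Aᴴ).det ≠ 0 := nz (by simpa using uz')
  have hne : (Aᴴ * B).det * (Aᴴ * C).det ≠ 0 := by
    rw [det_mul, det_mul]
    exact mul_ne_zero (mul_ne_zero nA (nz ux)) (mul_ne_zero nA (nz uy))
  have h1 : (-1 : ℂ) ^ Fintype.card m = 1 := by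
    have : ((-1 : ℂ) ^ Fintype.card m - 1) * ((Aᴴ * B).det * (Aᴴ * C).det) = 0 := by
      linear_combination -hd
    exact sub_eq_zero.1 ((mul_eq_zero.1 this).resolve_right hne)
  by_contra hodd
  rw [Nat.not_even_iff_odd] at hodd
  rw [hodd.neg_one_pow] at h1
  norm_num at h1

/-- Proposition `hura`. -/
theorem stmt17 (k m : ℕ) (hk : 0 < k) (hm : 0 < m)
    (h : ∃ φ : H0S (2 * k) → Mat m, IsLinearMap ℝ φ ∧
      ∀ A : H0S (2 * k), (A : Mat (2 * k)) ∈ Matrix.unitaryGroup (Fin (2 * k)) ℂ →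
        φ A ∈ Matrix.unitaryGroup (Fin m) ℂ) :
    2 * k ≤ m := by
  obtain ⟨φ, hl, hφ⟩ := h
  obtain ⟨Φ, hext⟩ := LinearMap.exists_extend (p := H0S (2 * k)) (hl.mk' φ)
  have hΦ : ∀ A : Mat (2 * k), Aᴴ = A → A * A = 1 → A.trace = 0 → (Φ A)ᴴ * Φ A = 1 := by
    intro A a1 a2 a3
    have hA : A ∈ H0S (2 * k) := ⟨a1, a3⟩
    have e : Φ A = φ ⟨A, hA⟩ := by
      have := LinearMap.congr_fun hext ⟨A, hA⟩
      simpa using this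
    have := hφ ⟨A, hA⟩ (by
      rw [Matrix.mem_unitaryGroup_iff]
      change A * Aᴴ = 1
      rw [a1, a2])
    rw [Matrix.mem_unitaryGroup_iff'] at this
    rw [e]; exact this
  have hev := parity Φ hΦ k (by simp)
  simp only [Fintype.card_fin] at hev
  obtain ⟨q, hq⟩ := hev
  by_cases hk1 : k = 1
  · omega
  let i0 : Fin m := ⟨0, hm⟩
  let T : Mat (2 * k) →ₗ[ℝ] EuclideanSpace ℝ (Fin m ⊕ Fin m) :=
    { toFun := fun A => WithLp.toLp 2 (Sum.elim (fun i => (Φ A i i0).re) (fun i => (Φ A i i0).im))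
      map_add' := fun A B => by
        ext i; rcases i with i | i <;> simp
      map_smul' := fun r A => by
        ext i; rcases i with i | i <;> simp }
  have hT : ∀ A : Mat (2 * k), Aᴴ = A → A * A = 1 → A.trace = 0 → ‖T A‖ = 1 := by
    intro A a1 a2 a3
    have h1 := congrArg Complex.re (congrFun (congrFun (hΦ A a1 a2 a3) i0) i0)
    rw [EuclideanSpace.norm_eq, Real.sqrt_eq_one]
    simp [Matrix.mul_apply, Finset.sum_add_distrib] at h1
    simp [T, sq]
    exact h1
  have := dim_bound T hT (k - 2) (by simp; omega)
  simp at this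
  omega
end
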